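/- arXiv:2106.11544 — 3 statements merged into one kernel-verified Lean document; each statement's English description precedes it below -/
import Mathlib

section
/- Let k be an algebraically closed field of characteristic zero. Let C, D be projective curves over k with C smooth, and let f : C → ℙ¹_k and g : D → ℙ¹_k be surjective morphisms with deg f = n ≥ 2 and deg g = d. Let X = (C ×_{ℙ¹} D)_red. Assume: (1) the field extension k(ℙ¹) ⊂ k(C) induced by f has no non-trivial intermediate field extension; (2) ∞ is a branch point of f; (3) the composition of the normalization map ν : D̃ → D with g is étale over ∞. Then X is irreducible and 2g_X − 2 ≥ n(2g_D − 2) + d. -/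
/-!
STATEMENT 10: Let `k` be an algebraically closed field of characteristic zero, `C, D`
projective curves over `k` with `C` smooth, and `f : C → ℙ¹`, `g : D → ℙ¹` surjective
morphisms with `deg f = n ≥ 2`, `deg g = d`.  Let `X = (C ×_{ℙ¹} D)_red`.  Assume:
(1) `k(ℙ¹) ⊂ k(C)` has no non-trivial intermediate field;
(2) `∞` is a branch point of `f`;
(3) `D̃ → D → ℙ¹` is étale over `∞` (`ν : D̃ → D` the normalization).
Then `X` is irreducible and `2g_X − 2 ≥ n(2g_D − 2) + d`.

Formalization notes.  The statement is rendered in terms of function fields, which carry all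
of its content:
* `k(ℙ¹) = RatFunc k`, and the data of `C` (smooth projective, surjecting onto `ℙ¹` with
  degree `n`) is exactly the finite extension `K_C/RatFunc k` of degree `n`; similarly `D`
  gives `K_D` of degree `d` (only the function field of `D` is relevant to the hypotheses and
  the conclusion, which involve the smooth model `D̃` and geometric genera).
* Closed points of the smooth projective model of a function field `L/k` are the places of
  `L/k`, i.e. the valuation subrings `A ⊊ L` containing `k`; `ordAt A` is the corresponding
  normalized order function.  A point lies over `∞ ∈ ℙ¹` iff `t ∉ A`, where `t` is the image
  of `RatFunc.X`; hypothesis (2) says there is exactly one such place for `K_C`, and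
  hypothesis (3) says every such place of `K_D` is unramified over `k(t)`,
  i.e. `ordAt A t = −1`.
* Since `C → ℙ¹` is finite flat, the irreducible components of `C ×_{ℙ¹} D` and their
  function fields are those of the (automatically reduced, char 0) generic fibre
  `Spec (K_C ⊗_{k(t)} K_D)`; thus `X` is irreducible iff `K_C ⊗_{k(t)} K_D` is a field, in
  which case it is the function field of `X`.
* The geometric genus `g` of a function field `L/k` is defined via Riemann's theorem:
  `g − 1` is the supremum over all divisors `D` of `deg D − ℓ(D)`, where `ℓ(D)` is the
  dimension of the Riemann–Roch space of `D`.
-/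

open scoped Classical TensorProduct

noncomputable section

/-- A place of the one-variable function field `L/k`: a valuation subring of `L` containing
`k` and different from `L`. -/
def FFPlace (k L : Type) [Field k] [Field L] [Algebra k L] : Type :=
  {A : ValuationSubring L // (∀ c : k, algebraMap k L c ∈ A) ∧ A ≠ ⊤}

/-- A uniformizer at `A` (junk value `1` if the maximal ideal is not principal). -/
def unifAt {L : Type} [Field L] (A : ValuationSubring L) : L :=
  if h : ∃ π : A, IsLocalRing.maximalIdeal A = Ideal.span {π} ∧ (π : L) ≠ 0 then (h.choose : L)
  else 1

/-- The order of vanishing at `A` of an element of `L` (junk value `0` for `f = 0`). -/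
def ordAt {L : Type} [Field L] (A : ValuationSubring L) (f : L) : ℤ :=
  if h : ∃ n : ℤ, A.valuation f = A.valuation (unifAt A) ^ n then h.choose else 0

/-- The degree of a divisor (`k` algebraically closed, so all residue degrees are `1`). -/
def divDeg {k L : Type} [Field k] [Field L] [Algebra k L] (D : FFPlace k L →₀ ℤ) : ℤ :=
  D.sum fun _ n => n

/-- The dimension `ℓ(D)` of the Riemann–Roch space
`L(D) = {f ∈ L | div(f) + D ≥ 0}` of a divisor `D`. -/
def rrDim (k : Type) {L : Type} [Field k] [Field L] [Algebra k L] (D : FFPlace k L →₀ ℤ) : ℕ :=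
  Module.finrank k (Submodule.span k
    {f : L | f ≠ 0 → ∀ A : FFPlace k L, -(D A) ≤ ordAt A.1 f})

/-- The genus of a one-variable function field `L/k`: by Riemann's theorem,
`g = 1 + sup_D (deg D − ℓ(D))`. -/
def ffGenus (k L : Type) [Field k] [Field L] [Algebra k L] : ℕ :=
  (1 + sSup {m : ℤ | ∃ D : FFPlace k L →₀ ℤ, m = divDeg D - (rrDim k D : ℤ)}).toNat

/-- The genus of a commutative `k`-algebra which happens to be a field (junk value `0`
otherwise). -/
def genusRing (k T : Type) [Field k] [CommRing T] [Algebra k T] : ℕ :=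
  if h : IsField T then @ffGenus k T _ h.toField (by exact inferInstanceAs (Algebra k T)) else 0

/-! ### Integral bases -/

section IntegralBases

open Module

variable {K L : Type} [Field K] [Field L] [Algebra K L]

/-- A `K`-basis of `L` that is an `R`-basis of the integral closure of `R` in `L`. -/
def IsIntBasis (R : Subring K) {ι : Type} (b : Basis ι K L) : Prop :=
  ∀ x : L, IsIntegral R x ↔ ∀ i, b.repr x i ∈ R

variable {R : Subring K} {ι : Type}

theorem IsIntBasis.isIntegral {b : Basis ι K L} (hb : IsIntBasis R b) (i : ι) :
    IsIntegral R (b i) := by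
  refine (hb _).2 fun j => ?_
  rw [b.repr_self, Finsupp.single_apply]
  split_ifs
  · exact R.one_mem
  · exact R.zero_mem

theorem mem_of_isIntegral_subring [IsIntegrallyClosed R] [IsFractionRing R K] {x : K}
    (hx : IsIntegral R x) : x ∈ R := by
  obtain ⟨y, rfl⟩ := IsIntegrallyClosed.isIntegral_iff.1 hx
  exact y.2

theorem isIntegral_algebraMap_of_mem {x : K} (hx : x ∈ R) : IsIntegral R (algebraMap K L x) :=
  isIntegral_algebraMap (R := R) (x := ⟨x, hx⟩)

theorem det_mem_subring {κ : Type} [Fintype κ] [DecidableEq κ] {M : Matrix κ κ K}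
    (hM : ∀ i j, M i j ∈ R) : M.det ∈ R := by
  rw [Matrix.det_apply]
  refine R.sum_mem fun σ _ => ?_
  rw [Units.smul_def, zsmul_eq_mul]
  exact R.mul_mem (intCast_mem R _) (R.prod_mem fun i _ => hM _ _)

theorem adjugate_mem_subring {κ : Type} [Fintype κ] [DecidableEq κ] {M : Matrix κ κ K}
    (hM : ∀ i j, M i j ∈ R) (i j : κ) : M.adjugate i j ∈ R := by
  rw [Matrix.adjugate_apply]
  refine det_mem_subring fun k l => ?_
  rw [Matrix.updateRow_apply]
  split_ifs
  · rw [Pi.single_apply]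
    split_ifs
    · exact R.one_mem
    · exact R.zero_mem
  · exact hM k l

theorem IsIntBasis.exists [CharZero K] [FiniteDimensional K L] [IsPrincipalIdealRing R]
    [IsFractionRing R K] :
    ∃ b : Basis (Fin (finrank K L)) K L, IsIntBasis R b := by
  let C := integralClosure R L
  have : Module.IsTorsionFree R L := FaithfulSMul.to_isTorsionFree R L
  have : IsNoetherian R C := IsIntegralClosure.isNoetherian R K L C
  have : Module.Free R C := IsIntegralClosure.module_free R K L C
  have hr : finrank R C = finrank K L := IsIntegralClosure.rank R K L C
  let b₀ : Basis (Fin (finrank K L)) R C := finBasisOfFinrankEq R C hr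
  have : IsLocalization (Algebra.algebraMapSubmonoid C (nonZeroDivisors R)) L :=
    IsIntegralClosure.isLocalization R K L C
  let b := b₀.localizationLocalization K (nonZeroDivisors R) L
  refine ⟨b, fun x => ⟨fun hx i => ?_, fun hx => ?_⟩⟩
  · have := b₀.localizationLocalization_repr_algebraMap K (nonZeroDivisors R) L ⟨x, hx⟩ i
    change b.repr x i = _ at this
    rw [this]
    exact (b₀.repr ⟨x, hx⟩ i).2
  · rw [← b.sum_repr x]
    refine IsIntegral.sum _ fun i _ => ?_
    rw [Algebra.smul_def]
    refine (isIntegral_algebraMap_of_mem (hx i)).mul ?_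
    have : b i = algebraMap C L (b₀ i) := by simp [b]
    rw [this]
    exact (b₀ i).2

variable [Fintype ι] [DecidableEq ι]

omit [DecidableEq ι] in
theorem IsIntBasis.isIntegral_of_repr {b : Basis ι K L} (hb : ∀ i, IsIntegral R (b i)) {x : L}
    (hx : ∀ i, b.repr x i ∈ R) : IsIntegral R x := by
  rw [← b.sum_repr x]
  refine IsIntegral.sum _ fun i _ => ?_
  rw [Algebra.smul_def]
  exact (isIntegral_algebraMap_of_mem (hx i)).mul (hb i)

theorem discr_eq_det_sq_mul (b : Basis ι K L) (v : ι → L) :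
    Algebra.discr K v = (b.toMatrix v).det ^ 2 * Algebra.discr K b := by
  rw [← Algebra.discr_of_matrix_vecMul]
  congr 1
  ext i
  simp only [Matrix.vecMul, dotProduct, Matrix.map_apply, Basis.toMatrix_apply]
  conv_lhs => rw [← b.sum_repr (v i)]
  exact Finset.sum_congr rfl fun j _ => by rw [Algebra.smul_def, mul_comm]

omit [Fintype ι] [DecidableEq ι] in
theorem IsIntBasis.toMatrix_mem {b : Basis ι K L} (hb : IsIntBasis R b) {κ : Type} {v : κ → L}
    (hv : ∀ i, IsIntegral R (v i)) (i : ι) (j : κ) : b.toMatrix v i j ∈ R :=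
  (hb _).1 (hv j) i

/-- The discriminant of an integral basis divides that of any family of integral elements. -/
theorem IsIntBasis.discr_dvd {b : Basis ι K L} (hb : IsIntBasis R b) {v : ι → L}
    (hv : ∀ i, IsIntegral R (v i)) :
    ∃ r ∈ R, Algebra.discr K v = r * Algebra.discr K b :=
  ⟨_, R.pow_mem (det_mem_subring (hb.toMatrix_mem hv)) 2, discr_eq_det_sq_mul b v⟩

theorem discr_mem_subring [FiniteDimensional K L] [IsIntegrallyClosed R] [IsFractionRing R K]
    {v : ι → L} (hv : ∀ i, IsIntegral R (v i)) : Algebra.discr K v ∈ R :=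
  mem_of_isIntegral_subring (Algebra.discr_isIntegral K hv)

theorem IsIntBasis.discr_dvd' {κ : Type} [Fintype κ] [DecidableEq κ] {b : Basis ι K L}
    (hb : IsIntBasis R b) {c : Basis κ K L} (hc : ∀ i, IsIntegral R (c i)) :
    ∃ r ∈ R, Algebra.discr K c = r * Algebra.discr K b := by
  let e : κ ≃ ι := c.indexEquiv b
  obtain ⟨r, hr, h⟩ := hb.discr_dvd (v := c.reindex e) (fun i => by simpa using hc _)
  refine ⟨r, hr, ?_⟩
  rw [← h, Basis.coe_reindex, Algebra.discr_reindex]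

/-- A family of integral elements with unimodular transition matrix is an integral basis. -/
theorem IsIntBasis.of_det {b : Basis ι K L} (hb : IsIntBasis R b) {v : ι → L}
    (hv : ∀ i, IsIntegral R (v i)) (h0 : (b.toMatrix v).det ≠ 0)
    (hdet : ((b.toMatrix v).det)⁻¹ ∈ R) :
    ∃ c : Basis ι K L, ⇑c = v ∧ IsIntBasis R c := by
  have hbasis := (b.is_basis_iff_det (v := v)).2 (by rw [b.det_apply]; exact h0.isUnit)
  let c : Basis ι K L := Basis.mk hbasis.1 hbasis.2.ge
  have hc : ⇑c = v := Basis.coe_mk _ _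
  refine ⟨c, hc, fun x => ⟨fun hx => ?_, fun hx => ?_⟩⟩
  · have hinv : c.toMatrix b = ((b.toMatrix v).det)⁻¹ • (b.toMatrix v).adjugate := by
      have h1 : c.toMatrix b * b.toMatrix v = 1 := by
        rw [← hc]; exact c.toMatrix_mul_toMatrix_flip b
      rw [← Matrix.inv_eq_left_inv h1, Matrix.inv_def, Ring.inverse_eq_inv']
    intro i
    rw [← b.toMatrix_mulVec_repr c x, Matrix.mulVec, dotProduct]
    refine R.sum_mem fun j _ => R.mul_mem ?_ ((hb x).1 hx j)
    rw [hinv, Matrix.smul_apply, smul_eq_mul]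
    exact R.mul_mem hdet (adjugate_mem_subring (hb.toMatrix_mem hv) i j)
  · exact IsIntBasis.isIntegral_of_repr (by rw [hc]; exact hv) hx

section Tower

variable {F : Type} [Field F] [Algebra K F] [Algebra F L] [IsScalarTower K F L]

/-- The integral closure of a subring `R` of `K` in an extension `F`, as a subring of `F`. -/
def intSubring (R : Subring K) (F : Type) [Field F] [Algebra K F] : Subring F :=
  (integralClosure R F).toSubring

omit [Fintype ι] [DecidableEq ι] in
theorem mem_intSubring {x : F} : x ∈ intSubring R F ↔ IsIntegral R x := Iff.rfl

omit [Fintype ι] [DecidableEq ι] in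
theorem isIntegral_intSubring_iff {x : L} : IsIntegral (intSubring R F) x ↔ IsIntegral R x := by
  let : Algebra R (intSubring R F) := inferInstanceAs (Algebra R (integralClosure R F))
  have : IsScalarTower R (intSubring R F) L := by
    refine IsScalarTower.of_algebraMap_eq fun r => ?_
    exact IsScalarTower.algebraMap_apply K F L r
  have : Algebra.IsIntegral R (intSubring R F) :=
    inferInstanceAs (Algebra.IsIntegral R (integralClosure R F))
  exact ⟨fun h => isIntegral_trans x h, fun h => h.tower_top⟩

variable {κ : Type} [Fintype κ] [DecidableEq κ]

omit [Fintype ι] [DecidableEq ι] [Fintype κ] [DecidableEq κ] in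
theorem IsIntBasis.smulTower {b : Basis ι K F} (hb : IsIntBasis R b) {c : Basis κ F L}
    (hc : IsIntBasis (intSubring R F) c) : IsIntBasis R (b.smulTower c) := by
  intro x
  rw [← isIntegral_intSubring_iff (F := F), hc x]
  simp only [Basis.smulTower_repr, mem_intSubring, hb _]
  exact ⟨fun h ij => h ij.2 ij.1, fun h i j => h (j, i)⟩

/-- Divisibility in towers: the discriminant of `L/K` is a multiple of `disc(F/K)^[L:F]`. -/
theorem IsIntBasis.discr_smulTower [FiniteDimensional K F] [FiniteDimensional F L]
    {b : Basis ι K F} (hb : IsIntBasis R b)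
    {c : Basis κ F L} (hc : ∀ i, IsIntegral R (c i))
    [IsIntegrallyClosed (intSubring R F)] [IsFractionRing (intSubring R F) F] :
    ∃ r ∈ R, Algebra.discr K (b.smulTower c) =
      r * Algebra.discr K b ^ Fintype.card κ := by
  have hτ : ∀ j j', Algebra.trace F L (c j * c j') ∈ intSubring R F := fun j j' =>
    mem_of_isIntegral_subring (Algebra.isIntegral_trace
      ((isIntegral_intSubring_iff.2 (hc j)).mul (isIntegral_intSubring_iff.2 (hc j'))))
  let B : Matrix (ι × κ) (ι × κ) K :=
    fun p q => b.repr (b q.1 * Algebra.trace F L (c p.2 * c q.2)) p.1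
  have hB : ∀ p q, B p q ∈ R := fun p q =>
    (hb _).1 ((hb.isIntegral q.1).mul (hτ p.2 q.2)) p.1
  have hmul : Algebra.traceMatrix K (b.smulTower c) =
      Matrix.kronecker (Algebra.traceMatrix K b) (1 : Matrix κ κ K) * B := by
    ext ⟨i, j⟩ ⟨i', j'⟩
    rw [Matrix.mul_apply, Fintype.sum_prod_type]
    simp only [Matrix.kronecker, Matrix.kroneckerMap_apply, Matrix.one_apply, mul_ite, mul_one,
      mul_zero, ite_mul, zero_mul, Finset.sum_ite_eq, Finset.mem_univ, if_true, B]
    rw [Algebra.traceMatrix_apply, Algebra.traceForm_apply, Basis.smulTower_apply,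
      Basis.smulTower_apply, ← Algebra.trace_trace (S := F)]
    have h1 : b i • c j * b i' • c j' = (b i * b i') • (c j * c j') := by
      rw [smul_mul_smul_comm]
    rw [h1, map_smul, smul_eq_mul, mul_assoc]
    conv_lhs => rw [← b.sum_repr (b i' * Algebra.trace F L (c j * c j'))]
    rw [Finset.mul_sum, map_sum]
    refine Finset.sum_congr rfl fun l _ => ?_
    rw [Algebra.traceMatrix_apply, Algebra.traceForm_apply, mul_smul_comm, map_smul, smul_eq_mul,
      mul_comm]
  refine ⟨B.det, det_mem_subring hB, ?_⟩
  rw [Algebra.discr_def, hmul, Matrix.det_mul, Matrix.kronecker, Matrix.det_kronecker,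
    Matrix.det_one, one_pow, mul_one, mul_comm, Algebra.discr_def]

end Tower

end IntegralBases

section TowerDivisibility

open Module

variable {K L F : Type} [Field K] [Field L] [Field F] [Algebra K L] [Algebra K F] [Algebra F L]
  [IsScalarTower K F L] {R : Subring K}

theorem isFractionRing_intSubring [FiniteDimensional K F] [IsFractionRing R K] :
    IsFractionRing (intSubring R F) F :=
  integralClosure.isFractionRing_of_finite_extension (A := R) K F

theorem isDedekindDomain_intSubring [CharZero K] [FiniteDimensional K F] [IsFractionRing R K]
    [IsDedekindDomain R] : IsDedekindDomain (intSubring R F) :=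
  integralClosure.isDedekindDomain R K F

theorem isPrincipalIdealRing_intSubring [CharZero K] [FiniteDimensional K F] [IsFractionRing R K]
    [IsPrincipalIdealRing R] [IsLocalRing R] : IsPrincipalIdealRing (intSubring R F) := by
  let C := integralClosure R F
  have : Module.IsTorsionFree R F := FaithfulSMul.to_isTorsionFree R F
  have : IsNoetherian R C := IsIntegralClosure.isNoetherian R K F C
  have : IsDedekindDomain C := integralClosure.isDedekindDomain R K F
  have hfin := Algebra.QuasiFinite.finite_primesOver (S := C) (IsLocalRing.maximalIdeal R)
  refine IsPrincipalIdealRing.of_finite_maximals (R := C) (hfin.subset fun P hP => ?_)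
  have hP' : P.IsMaximal := hP
  refine ⟨hP'.isPrime, ⟨?_⟩⟩
  have := Ideal.isMaximal_comap_of_isIntegral_of_isMaximal (R := R) P
  exact (IsLocalRing.eq_maximalIdeal this).symm

/-- The localization of `R ⊆ K` at a prime ideal, as a subring of `K`. -/
def locSubring (R : Subring K) [IsFractionRing R K] (p : Ideal R) [p.IsPrime] : Subring K :=
  (Localization.subalgebra.ofField K p.primeCompl p.primeCompl_le_nonZeroDivisors).toSubring

variable [IsFractionRing R K]

theorem mem_locSubring {p : Ideal R} [p.IsPrime] {x : K} :
    x ∈ locSubring R p ↔ ∃ m ∈ p.primeCompl, (m : K) * x ∈ R := by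
  constructor
  · rintro ⟨a, s, hs, rfl⟩
    refine ⟨s, hs, ?_⟩
    have : (s : K) ≠ 0 := fun h => hs (by
      have : s = 0 := Subtype.ext h
      rw [this]; exact p.zero_mem)
    have h2 : (s : K) * (algebraMap R K a * (algebraMap R K s)⁻¹) = a := by
      change (s : K) * ((a : K) * (s : K)⁻¹) = a
      field_simp
    rw [h2]
    exact a.2
  · rintro ⟨m, hm, h⟩
    refine ⟨⟨_, h⟩, m, hm, ?_⟩
    have : (m : K) ≠ 0 := fun h => hm (by
      have : m = 0 := Subtype.ext h
      rw [this]; exact p.zero_mem)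
    change x = ((m : K) * x) * (m : K)⁻¹
    field_simp

theorem le_locSubring {p : Ideal R} [p.IsPrime] : R ≤ locSubring R p := fun x hx =>
  mem_locSubring.2 ⟨1, p.primeCompl.one_mem, by simpa using hx⟩

theorem isIntegral_of_le {R S : Subring K} (h : R ≤ S) {x : L} (hx : IsIntegral R x) :
    IsIntegral S x := by
  obtain ⟨f, hf, h0⟩ := hx
  refine ⟨f.map (Subring.inclusion h), hf.map _, ?_⟩
  rw [Polynomial.eval₂_map]
  exact h0

omit [IsFractionRing R K] in
theorem exists_isIntegral_of_isLocalization (M : Submonoid R) (A : Subalgebra R K)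
    [IsLocalization M A] {x : L} (hx : IsIntegral A.toSubring x) :
    ∃ m ∈ M, IsIntegral R (algebraMap K L m * x) := by
  let : Algebra A L := inferInstanceAs (Algebra A.toSubring L)
  have : IsScalarTower R A L := IsScalarTower.of_algebraMap_eq fun r => rfl
  obtain ⟨m, hm⟩ := IsIntegral.exists_multiple_integral_of_isLocalization M (Rₘ := A) x hx
  refine ⟨m, m.2, ?_⟩
  rw [Submonoid.smul_def, Algebra.smul_def] at hm
  exact hm

theorem exists_isIntegral_of_locSubring {p : Ideal R} [p.IsPrime] {x : L}
    (hx : IsIntegral (locSubring R p) x) :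
    ∃ m ∈ p.primeCompl, IsIntegral R (algebraMap K L m * x) :=
  exists_isIntegral_of_isLocalization p.primeCompl
    (Localization.subalgebra.ofField K p.primeCompl p.primeCompl_le_nonZeroDivisors) hx

theorem IsIntBasis.locSubring {ι : Type} [Fintype ι] {b : Basis ι K L} (hb : IsIntBasis R b)
    (p : Ideal R) [p.IsPrime] : IsIntBasis (locSubring R p) b := by
  refine fun x => ⟨fun hx i => ?_, fun hx => ?_⟩
  · obtain ⟨m, hm, h⟩ := exists_isIntegral_of_locSubring hx
    have := (hb _).1 h i
    rw [← Algebra.smul_def, map_smul] at this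
    exact mem_locSubring.2 ⟨m, hm, this⟩
  · exact IsIntBasis.isIntegral_of_repr (fun i => isIntegral_of_le le_locSubring (hb.isIntegral i))
      hx

theorem mem_of_forall_mem_locSubring {x : K}
    (h : ∀ (p : Ideal R) [p.IsMaximal], x ∈ locSubring R p) : x ∈ R := by
  let I : Ideal R := 
    { carrier := {m | (m : K) * x ∈ R}
      add_mem' := fun {a b} ha hb => by
        simpa [add_mul] using R.add_mem ha hb
      zero_mem' := by simp
      smul_mem' := fun c m hm => by
        simpa [mul_assoc] using R.mul_mem c.2 hm }
  by_cases hI : I = ⊤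
  · have : (1 : R) ∈ I := hI ▸ Submodule.mem_top
    simpa [I] using this
  · obtain ⟨p, hp, hle⟩ := Ideal.exists_le_maximal I hI
    obtain ⟨m, hm, h'⟩ := mem_locSubring.1 (h p)
    exact absurd (hle h') hm

variable [CharZero K] [FiniteDimensional K F] [FiniteDimensional F L] [IsPrincipalIdealRing R]

theorem discr_pow_dvd_of_isLocalRing [IsLocalRing R] {ι κ : Type}
    [Fintype ι] [DecidableEq ι] [Fintype κ] [DecidableEq κ]
    {b : Basis ι K F} (hb : IsIntBasis R b)
    {c : Basis κ K L} (hc : ∀ i, IsIntegral R (c i)) :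
    ∃ r ∈ R, Algebra.discr K c = r * Algebra.discr K b ^ finrank F L := by
  have := isPrincipalIdealRing_intSubring (R := R) (F := F)
  have := isFractionRing_intSubring (R := R) (F := F)
  have : CharZero F := charZero_of_injective_algebraMap (algebraMap K F).injective
  obtain ⟨z, hz⟩ := IsIntBasis.exists (R := intSubring R F) (L := L)
  obtain ⟨r, hr, h⟩ := hb.discr_smulTower (c := z)
    (fun i => isIntegral_intSubring_iff.1 (hz.isIntegral i))
  obtain ⟨s, hs, h'⟩ := (hb.smulTower hz).discr_dvd' hc
  refine ⟨s * r, R.mul_mem hs hr, ?_⟩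
  rw [h', h, Fintype.card_fin, mul_assoc]

/-- The discriminant `disc(F/K)^[L:F]` divides `disc(L/K)`. -/
theorem discr_pow_dvd {ι κ : Type}
    [Fintype ι] [DecidableEq ι] [Fintype κ] [DecidableEq κ]
    {b : Basis ι K F} (hb : IsIntBasis R b)
    {c : Basis κ K L} (hc : ∀ i, IsIntegral R (c i)) :
    ∃ r ∈ R, Algebra.discr K c = r * Algebra.discr K b ^ finrank F L := by
  have h0 : Algebra.discr K b ≠ 0 := Algebra.discr_not_zero_of_basis K b
  refine ⟨Algebra.discr K c / Algebra.discr K b ^ finrank F L,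
    mem_of_forall_mem_locSubring fun p hp => ?_, by field_simp⟩
  let A := Localization.subalgebra.ofField K p.primeCompl p.primeCompl_le_nonZeroDivisors
  have : IsFractionRing (locSubring R p) K :=
    inferInstanceAs (IsFractionRing A K)
  have : IsLocalRing (locSubring R p) := IsLocalization.AtPrime.isLocalRing A p
  have : IsDedekindDomain (locSubring R p) :=
    IsLocalization.isDedekindDomain R p.primeCompl_le_nonZeroDivisors A
  have : IsPrincipalIdealRing (locSubring R p) := inferInstance
  obtain ⟨r, hr, h⟩ := discr_pow_dvd_of_isLocalRing (hb.locSubring p)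
    (fun i => isIntegral_of_le le_locSubring (hc i))
  rw [h, mul_div_cancel_right₀ _ (pow_ne_zero _ h0)]
  exact hr

end TowerDivisibility

section Places

open WithZero IsDedekindDomain

variable {L : Type} [Field L]

theorem valuationSubring_valuation_eq_iff (w : Valuation L ℤᵐ⁰) (x y : L) :
    w.valuationSubring.valuation x = w.valuationSubring.valuation y ↔ w x = w y :=
  w.isEquiv_valuation_valuationSubring.symm.eq_iff

theorem valuation_unifAt (w : Valuation L ℤᵐ⁰) (hw : Function.Surjective w) :
    w (unifAt w.valuationSubring) = exp (-1) := by
  have hmem (x : w.valuationSubring) :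
      x ∈ IsLocalRing.maximalIdeal w.valuationSubring ↔ w x < 1 := by
    rw [ValuationSubring.valuation_lt_one_iff]
    exact w.isEquiv_valuation_valuationSubring.symm.lt_one_iff_lt_one
  obtain ⟨ϖ, hϖ⟩ := hw (exp (-1))
  have hϖ1 : w ϖ < 1 := by rw [hϖ, ← exp_zero, exp_lt_exp]; norm_num
  have hdvd {x y : L} (h : w x ≤ w y) (hy : y ≠ 0) : ∃ z ∈ w.valuationSubring, x = z * y := by
    refine ⟨x / y, ?_, by field_simp⟩
    change w (x / y) ≤ 1
    rw [map_div₀]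
    exact div_le_one_of_le₀ h zero_le
  have hϖ0 : ϖ ≠ 0 := by
    rintro rfl
    rw [map_zero] at hϖ
    exact exp_ne_zero hϖ.symm
  have key : ∃ π : w.valuationSubring,
      IsLocalRing.maximalIdeal w.valuationSubring = Ideal.span {π} ∧ (π : L) ≠ 0 := by
    refine ⟨⟨ϖ, hϖ1.le⟩, ?_, hϖ0⟩
    ext x
    rw [hmem, Ideal.mem_span_singleton']
    constructor
    · intro hx
      obtain ⟨z, hz, h⟩ := hdvd (x := x) (y := ϖ) (by
        rw [hϖ]
        by_cases hx0 : w x = 0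
        · rw [hx0]; exact zero_le
        · rw [← exp_log hx0, exp_le_exp]
          rw [← exp_log hx0, ← exp_zero, exp_lt_exp] at hx
          lia) hϖ0
      exact ⟨⟨z, hz⟩, Subtype.ext h.symm⟩
    · rintro ⟨z, rfl⟩
      have hz : w z ≤ 1 := z.2
      push_cast
      rw [map_mul]
      exact lt_of_le_of_lt (mul_le_of_le_one_left zero_le hz) hϖ1
  have hdef : unifAt w.valuationSubring = key.choose := dif_pos key
  obtain ⟨hspan, hne⟩ := key.choose_spec
  rw [hdef]
  set π := key.choose
  have h1 : w π < 1 := (hmem π).1 (hspan ▸ Ideal.mem_span_singleton_self π)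
  have h2 : (⟨ϖ, hϖ1.le⟩ : w.valuationSubring) ∈ Ideal.span {π} := hspan ▸ (hmem _).2 hϖ1
  obtain ⟨z, hz⟩ := Ideal.mem_span_singleton'.1 h2
  have hz1 : w z ≤ 1 := z.2
  have h3 : w ϖ ≤ w π := by
    have : ϖ = z * π := (congrArg Subtype.val hz).symm
    rw [this, map_mul]
    exact mul_le_of_le_one_left zero_le hz1
  have hπ0 : w π ≠ 0 := (Valuation.ne_zero_iff _).2 hne
  rw [← exp_log hπ0, ← exp_zero, exp_lt_exp] at h1
  rw [hϖ, ← exp_log hπ0, exp_le_exp] at h3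
  rw [← exp_log hπ0, exp_inj]
  lia

theorem valuation_eq_exp_ordAt (w : Valuation L ℤᵐ⁰) (hw : Function.Surjective w) {x : L}
    (hx : x ≠ 0) : w x = exp (-(ordAt w.valuationSubring x)) := by
  have hu := valuation_unifAt w hw
  have h0 : w x ≠ 0 := (Valuation.ne_zero_iff _).2 hx
  have key : ∃ n : ℤ, w.valuationSubring.valuation x =
      w.valuationSubring.valuation (unifAt w.valuationSubring) ^ n := by
    refine ⟨-log (w x), ?_⟩
    rw [← map_zpow₀, valuationSubring_valuation_eq_iff, map_zpow₀, hu, ← exp_zsmul]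
    simp [exp_log h0]
  have hdef : ordAt w.valuationSubring x = key.choose := dif_pos key
  have h := key.choose_spec
  rw [← hdef, ← map_zpow₀, valuationSubring_valuation_eq_iff, map_zpow₀, hu, ← exp_zsmul] at h
  rw [h]
  simp

/-- A valuation ring is discrete if it is defined by a normalized discrete valuation. -/
def IsDiscretePlace (A : ValuationSubring L) : Prop :=
  ∃ w : Valuation L ℤᵐ⁰, Function.Surjective w ∧ w.valuationSubring = A

variable {A : ValuationSubring L}

namespace IsDiscretePlace

theorem ordAt_mul (hA : IsDiscretePlace A) {x y : L} (hx : x ≠ 0) (hy : y ≠ 0) :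
    ordAt A (x * y) = ordAt A x + ordAt A y := by
  obtain ⟨w, hw, rfl⟩ := hA
  have h := valuation_eq_exp_ordAt w hw (mul_ne_zero hx hy)
  rw [map_mul, valuation_eq_exp_ordAt w hw hx, valuation_eq_exp_ordAt w hw hy, ← exp_add,
    exp_inj] at h
  lia

theorem ordAt_one (hA : IsDiscretePlace A) : ordAt A 1 = 0 := by
  have := hA.ordAt_mul one_ne_zero one_ne_zero
  rw [mul_one] at this
  lia

theorem ordAt_inv (hA : IsDiscretePlace A) {x : L} (hx : x ≠ 0) :
    ordAt A x⁻¹ = -ordAt A x := by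
  have := hA.ordAt_mul hx (inv_ne_zero hx)
  rw [mul_inv_cancel₀ hx, hA.ordAt_one] at this
  lia

theorem ordAt_div (hA : IsDiscretePlace A) {x y : L} (hx : x ≠ 0) (hy : y ≠ 0) :
    ordAt A (x / y) = ordAt A x - ordAt A y := by
  rw [div_eq_mul_inv, hA.ordAt_mul hx (inv_ne_zero hy), hA.ordAt_inv hy, sub_eq_add_neg]

theorem ordAt_pow (hA : IsDiscretePlace A) {x : L} (hx : x ≠ 0) (n : ℕ) :
    ordAt A (x ^ n) = n * ordAt A x := by
  induction n with
  | zero => simp [hA.ordAt_one]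
  | succ n ih =>
    rw [pow_succ, hA.ordAt_mul (pow_ne_zero _ hx) hx, ih]
    push_cast
    ring

theorem ordAt_nonneg_iff (hA : IsDiscretePlace A) {x : L} (hx : x ≠ 0) :
    0 ≤ ordAt A x ↔ x ∈ A := by
  obtain ⟨w, hw, rfl⟩ := hA
  rw [Valuation.mem_valuationSubring_iff, valuation_eq_exp_ordAt w hw hx, ← exp_zero, exp_le_exp]
  lia

theorem ordAt_pos_iff (hA : IsDiscretePlace A) {x : L} (hx : x ≠ 0) :
    0 < ordAt A x ↔ A.valuation x < 1 := by
  obtain ⟨w, hw, rfl⟩ := hA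
  rw [w.isEquiv_valuation_valuationSubring.symm.lt_one_iff_lt_one,
    valuation_eq_exp_ordAt w hw hx, ← exp_zero, exp_lt_exp]
  lia

theorem le_ordAt_add (hA : IsDiscretePlace A) {x y : L} {n : ℤ} (hx : x ≠ 0 → n ≤ ordAt A x)
    (hy : y ≠ 0 → n ≤ ordAt A y) (hxy : x + y ≠ 0) : n ≤ ordAt A (x + y) := by
  by_cases hx0 : x = 0
  · subst hx0
    rw [zero_add] at hxy ⊢
    exact hy hxy
  by_cases hy0 : y = 0
  · subst hy0
    rw [add_zero] at hxy ⊢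
    exact hx hxy
  obtain ⟨w, hw, rfl⟩ := hA
  have h : w (x + y) ≤ exp (-n) := by
    refine (w.map_add x y).trans (max_le ?_ ?_)
    · rw [valuation_eq_exp_ordAt w hw hx0, exp_le_exp]
      linarith [hx hx0]
    · rw [valuation_eq_exp_ordAt w hw hy0, exp_le_exp]
      linarith [hy hy0]
  rw [valuation_eq_exp_ordAt w hw hxy, exp_le_exp] at h
  lia

end IsDiscretePlace

variable {B : Type} [CommRing B] [IsDedekindDomain B] [Algebra B L] [IsFractionRing B L]

variable (L) in
/-- The valuation ring of `L` attached to a prime of a Dedekind domain with fraction field `L`. -/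
def valRing (v : HeightOneSpectrum B) : ValuationSubring L := (v.valuation L).valuationSubring

theorem mem_valRing {v : HeightOneSpectrum B} {x : L} : x ∈ valRing L v ↔ v.valuation L x ≤ 1 :=
  Iff.rfl

theorem algebraMap_mem_valRing (v : HeightOneSpectrum B) (b : B) :
    algebraMap B L b ∈ valRing L v := v.valuation_le_one b

theorem isDiscretePlace_valRing (v : HeightOneSpectrum B) : IsDiscretePlace (valRing L v) :=
  ⟨_, v.valuation_surjective L, rfl⟩

theorem valuation_eq_exp_ordAt_valRing (v : HeightOneSpectrum B) {x : L} (hx : x ≠ 0) :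
    v.valuation L x = exp (-(ordAt (valRing L v) x)) :=
  valuation_eq_exp_ordAt _ (v.valuation_surjective L) hx

theorem valRing_valuation_lt_one_iff (v : HeightOneSpectrum B) {x : L} :
    (valRing L v).valuation x < 1 ↔ v.valuation L x < 1 :=
  (v.valuation L).isEquiv_valuation_valuationSubring.symm.lt_one_iff_lt_one

theorem valRing_ne_top (v : HeightOneSpectrum B) : valRing L v ≠ ⊤ := by
  intro h
  obtain ⟨π, hπ⟩ := v.valuation_exists_uniformizer L
  have : π⁻¹ ∈ valRing L v := h ▸ trivial
  rw [mem_valRing, map_inv₀, hπ, ← exp_neg, ← exp_zero, exp_le_exp] at this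
  norm_num at this

theorem valRing_injective : Function.Injective (valRing L : HeightOneSpectrum B → _) := by
  intro v w h
  refine HeightOneSpectrum.eq_of_valuation_isEquiv_valuation (K := L) ?_
  exact (Valuation.isEquiv_iff_valuationSubring _ _).2 h

/-- Every proper valuation ring containing `B` comes from a prime of `B`. -/
theorem exists_eq_valRing (hB : ∀ b : B, algebraMap B L b ∈ A) (hA : A ≠ ⊤) :
    ∃ v : HeightOneSpectrum B, A = valRing L v := by
  let P : Ideal B := (IsLocalRing.maximalIdeal A).comap
    ((algebraMap B L).codRestrict A.toSubring hB)
  have hP : P.IsPrime := Ideal.comap_isPrime _ _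
  have hmem (b : B) : b ∈ P ↔ A.valuation (algebraMap B L b) < 1 := by
    rw [show algebraMap B L b = (⟨_, hB b⟩ : A) from rfl, ← ValuationSubring.valuation_lt_one_iff]
    rfl
  have hinv (b : B) (hb : b ∉ P) : (algebraMap B L b)⁻¹ ∈ A := by
    rw [← A.valuation_le_one_iff, map_inv₀]
    rw [hmem, not_lt] at hb
    exact inv_le_one_of_one_le₀ hb
  have hP0 : P ≠ ⊥ := by
    intro h
    refine hA (top_unique fun x _ => ?_)
    obtain ⟨a, b, hb, rfl⟩ := IsFractionRing.div_surjective (A := B) x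
    rw [div_eq_mul_inv]
    refine A.mul_mem _ _ (hB a) (hinv b ?_)
    rw [h, Ideal.mem_bot]
    exact nonZeroDivisors.ne_zero hb
  let v : HeightOneSpectrum B := ⟨P, hP, hP0⟩
  have hle (x : L) (hx : x ∈ valRing L v) : x ∈ A := by
    obtain ⟨n, d, h⟩ := v.exists_primeCompl_mul_eq_of_integer x hx
    have hd0 : algebraMap B L d ≠ 0 := by
      intro h0
      have : (d : B) = 0 := (IsFractionRing.injective B L) (by rw [h0, map_zero])
      exact d.2 (this ▸ P.zero_mem)
    rw [← eq_div_iff hd0, div_eq_mul_inv] at h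
    rw [h]
    exact A.mul_mem _ _ (hB n) (hinv d d.2)
  refine ⟨v, le_antisymm (fun x hx => ?_) hle⟩
  by_contra hxv
  refine hA (top_unique fun y _ => ?_)
  rw [mem_valRing, not_le] at hxv
  obtain ⟨n, hn⟩ : ∃ n : ℕ, v.valuation L y ≤ v.valuation L x ^ n := by
    by_cases hy : v.valuation L y = 0
    · exact ⟨0, by rw [hy]; exact zero_le⟩
    have hx0 : v.valuation L x ≠ 0 := (zero_lt_one.trans hxv).ne'
    rw [← exp_log hx0, ← exp_zero, exp_lt_exp] at hxv
    refine ⟨(log (v.valuation L y)).toNat, ?_⟩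
    rw [← exp_log hy, ← exp_log hx0, ← exp_nsmul, exp_le_exp, log_exp, nsmul_eq_mul]
    nlinarith [Int.self_le_toNat (log (v.valuation L y))]
  have hx0 : x ≠ 0 := by
    rintro rfl
    simp at hxv
  have h2 : y / x ^ n ∈ valRing L v := by
    rw [mem_valRing, map_div₀, map_pow]
    exact div_le_one_of_le₀ hn zero_le
  have h3 := A.mul_mem _ _ (hle _ h2) (pow_mem hx n)
  rwa [div_mul_cancel₀ _ (pow_ne_zero _ hx0)] at h3

end Places

section RationalFunctions

variable (k : Type) [Field k]

/-- The polynomial ring as a subring of `k(t)`. -/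
def finSubring : Subring (RatFunc k) := (algebraMap (Polynomial k) (RatFunc k)).range

/-- The local ring of the projective line at infinity. -/
def infSubring : Subring (RatFunc k) where
  carrier := {f | f.intDegree ≤ 0}
  zero_mem' := by simp
  one_mem' := by simp
  mul_mem' := by
    intro a b ha hb
    by_cases ha0 : a = 0
    · simp [ha0]
    by_cases hb0 : b = 0
    · simp [hb0]
    simp only [Set.mem_ofPred_eq] at ha hb ⊢
    rw [RatFunc.intDegree_mul ha0 hb0]
    lia
  add_mem' := by
    intro a b ha hb
    by_cases hb0 : b = 0
    · simpa [hb0] using ha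
    by_cases hab : a + b = 0
    · simp [hab]
    exact (RatFunc.intDegree_add_le hb0 hab).trans (max_le ha hb)
  neg_mem' := by
    intro a ha
    simpa using ha

variable {k}

theorem mem_infSubring {f : RatFunc k} : f ∈ infSubring k ↔ f.intDegree ≤ 0 := Iff.rfl

theorem algebraMap_mem_finSubring (p : Polynomial k) :
    algebraMap (Polynomial k) (RatFunc k) p ∈ finSubring k := ⟨p, rfl⟩

theorem C_mem_finSubring (c : k) : RatFunc.C c ∈ finSubring k :=
  ⟨Polynomial.C c, RatFunc.algebraMap_C c⟩

theorem X_mem_finSubring : (RatFunc.X : RatFunc k) ∈ finSubring k :=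
  ⟨Polynomial.X, RatFunc.algebraMap_X⟩

theorem C_mem_infSubring (c : k) : RatFunc.C c ∈ infSubring k := by
  simp [mem_infSubring]

theorem inv_X_mem_infSubring : (RatFunc.X : RatFunc k)⁻¹ ∈ infSubring k := by
  simp [mem_infSubring]

theorem intDegree_nonneg_of_mem_finSubring {f : RatFunc k} (hf : f ∈ finSubring k) :
    0 ≤ f.intDegree := by
  obtain ⟨p, rfl⟩ := hf
  simp

theorem exists_eq_C_of_mem {f : RatFunc k} (hf : f ∈ finSubring k) (hf' : f ∈ infSubring k) :
    ∃ c : k, f = RatFunc.C c := by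
  obtain ⟨p, rfl⟩ := hf
  rw [mem_infSubring, RatFunc.intDegree_polynomial] at hf'
  refine ⟨p.coeff 0, ?_⟩
  rw [Polynomial.eq_C_of_natDegree_le_zero (p := p) (by exact_mod_cast hf')]
  simp

theorem intDegree_pow {f : RatFunc k} (hf : f ≠ 0) (n : ℕ) :
    (f ^ n).intDegree = n * f.intDegree := by
  induction n with
  | zero => simp
  | succ n ih =>
    rw [pow_succ, RatFunc.intDegree_mul (pow_ne_zero _ hf) hf, ih]
    push_cast
    ring

theorem intDegree_X_zpow (n : ℤ) : ((RatFunc.X : RatFunc k) ^ n).intDegree = n := by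
  cases n with
  | ofNat n => simp [intDegree_pow RatFunc.X_ne_zero]
  | negSucc n =>
    rw [zpow_negSucc, RatFunc.intDegree_inv, intDegree_pow RatFunc.X_ne_zero]
    simp
    lia

/-- The value at infinity. -/
theorem exists_X_mul_sub_C_mem {f : RatFunc k} (hf : f ∈ infSubring k) :
    ∃ c : k, RatFunc.X * (f - RatFunc.C c) ∈ infSubring k := by
  by_cases hf0 : f = 0
  · exact ⟨0, by simp [hf0]⟩
  have key {g : RatFunc k} (hg : g ≠ 0 → g.intDegree < 0) : RatFunc.X * g ∈ infSubring k := by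
    by_cases hg0 : g = 0
    · simp [hg0]
    rw [mem_infSubring, RatFunc.intDegree_mul RatFunc.X_ne_zero hg0, RatFunc.intDegree_X]
    linarith [hg hg0]
  by_cases hneg : f.intDegree < 0
  · exact ⟨0, key (by simpa using fun _ => hneg)⟩
  have hdeg : f.num.natDegree = f.denom.natDegree := by
    have : f.intDegree = 0 := le_antisymm hf (not_lt.1 hneg)
    unfold RatFunc.intDegree at this
    lia
  have hn0 : f.num ≠ 0 := RatFunc.num_ne_zero hf0
  have hd0 : f.denom ≠ 0 := f.denom_ne_zero
  have hl0 : f.denom.leadingCoeff ≠ 0 := Polynomial.leadingCoeff_ne_zero.2 hd0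
  set c := f.num.leadingCoeff / f.denom.leadingCoeff with hc
  have hc0 : c ≠ 0 := div_ne_zero (Polynomial.leadingCoeff_ne_zero.2 hn0) hl0
  refine ⟨c, key fun hg => ?_⟩
  have hd0' : algebraMap (Polynomial k) (RatFunc k) f.denom ≠ 0 :=
    RatFunc.algebraMap_ne_zero hd0
  have heq : f - RatFunc.C c = algebraMap (Polynomial k) (RatFunc k)
      (f.num - Polynomial.C c * f.denom) / algebraMap (Polynomial k) (RatFunc k) f.denom := by
    rw [map_sub, map_mul, sub_div, RatFunc.num_div_denom, RatFunc.algebraMap_C,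
      mul_div_cancel_right₀ _ hd0']
  have hnum : f.num - Polynomial.C c * f.denom ≠ 0 := by
    intro h
    rw [heq, h] at hg
    simp at hg
  rw [heq, RatFunc.intDegree_div (RatFunc.algebraMap_ne_zero hnum) hd0',
    RatFunc.intDegree_polynomial, RatFunc.intDegree_polynomial, sub_neg, Nat.cast_lt]
  have := Polynomial.degree_sub_lt_left (p := f.num) (q := Polynomial.C c * f.denom)
    (by rw [Polynomial.degree_C_mul hc0, Polynomial.degree_eq_natDegree hn0,
      Polynomial.degree_eq_natDegree hd0, hdeg]) hn0
    (by rw [Polynomial.leadingCoeff_mul, Polynomial.leadingCoeff_C, hc]; field_simp)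
  rw [← hdeg]
  exact Polynomial.natDegree_lt_natDegree hnum this

instance : IsPrincipalIdealRing (finSubring k) :=
  IsPrincipalIdealRing.of_surjective (algebraMap (Polynomial k) (RatFunc k)).rangeRestrict
    (algebraMap (Polynomial k) (RatFunc k)).rangeRestrict_surjective

instance : IsFractionRing (finSubring k) (RatFunc k) :=
  IsFractionRing.of_field _ _ fun z =>
    ⟨⟨_, algebraMap_mem_finSubring z.num⟩, ⟨_, algebraMap_mem_finSubring z.denom⟩,
      (RatFunc.num_div_denom z).symm⟩

theorem mem_infSubring_or_inv_mem (f : RatFunc k) : f ∈ infSubring k ∨ f⁻¹ ∈ infSubring k := by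
  simp only [mem_infSubring, RatFunc.intDegree_inv]
  lia

instance : IsFractionRing (infSubring k) (RatFunc k) :=
  IsFractionRing.of_field _ _ fun z => by
    rcases mem_infSubring_or_inv_mem z with h | h
    · exact ⟨⟨z, h⟩, 1, by simp; rfl⟩
    · refine ⟨1, ⟨z⁻¹, h⟩, ?_⟩
      change z = ((1 : infSubring k) : RatFunc k) / z⁻¹
      simp

theorem dvd_infSubring_iff {f g : infSubring k} (hg : (g : RatFunc k) ≠ 0)
    (hf : (f : RatFunc k) ≠ 0) :
    g ∣ f ↔ (f : RatFunc k).intDegree ≤ (g : RatFunc k).intDegree := by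
  constructor
  · rintro ⟨h, rfl⟩
    push_cast at hf ⊢
    rw [RatFunc.intDegree_mul hg (right_ne_zero_of_mul hf)]
    have := mem_infSubring.1 h.2
    lia
  · intro h
    refine ⟨⟨f / g, ?_⟩, Subtype.ext ?_⟩
    · rw [mem_infSubring, RatFunc.intDegree_div hf hg]
      lia
    · push_cast
      field_simp

instance : IsPrincipalIdealRing (infSubring k) where
  principal I := by
    by_cases hI : I = ⊥
    · rw [hI]; infer_instance
    obtain ⟨x, hx, hx0⟩ := Submodule.exists_mem_ne_zero_of_ne_bot hI
    let P : ℕ → Prop := fun n => ∃ y ∈ I, y ≠ 0 ∧ (y : RatFunc k).intDegree = -n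
    have hP : ∃ n, P n := ⟨(-(x : RatFunc k).intDegree).toNat, x, hx, hx0, by
      have := mem_infSubring.1 x.2
      lia⟩
    obtain ⟨y, hy, hy0, hyd⟩ := Nat.find_spec hP
    have hne {z : infSubring k} (hz : z ≠ 0) : (z : RatFunc k) ≠ 0 := fun h => hz (Subtype.ext h)
    refine ⟨y, le_antisymm (fun z hz => ?_) ?_⟩
    · by_cases hz0 : z = 0
      · rw [hz0]; exact zero_mem _
      refine Ideal.mem_span_singleton.2 ((dvd_infSubring_iff (hne hy0) (hne hz0)).2 ?_)
      rw [hyd]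
      have h1 := mem_infSubring.1 z.2
      have : Nat.find hP ≤ (-(z : RatFunc k).intDegree).toNat :=
        Nat.find_min' hP ⟨z, hz, hz0, by lia⟩
      lia
    · exact (Ideal.span_singleton_le_iff_mem _).2 hy

theorem isUnit_infSubring_iff {f : infSubring k} :
    IsUnit f ↔ (f : RatFunc k) ≠ 0 ∧ (f : RatFunc k).intDegree = 0 := by
  by_cases hf : (f : RatFunc k) = 0
  · have : f = 0 := Subtype.ext hf
    simp [this]
  · have := mem_infSubring.1 f.2
    rw [isUnit_iff_dvd_one, dvd_infSubring_iff hf (by simp)]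
    simp only [OneMemClass.coe_one, RatFunc.intDegree_one]
    constructor
    · intro h; exact ⟨hf, by lia⟩
    · rintro ⟨-, h⟩; lia

theorem X_mul_mem_of_not_isUnit {f : infSubring k} (hf : ¬ IsUnit f) :
    RatFunc.X * (f : RatFunc k) ∈ infSubring k := by
  by_cases hf0 : (f : RatFunc k) = 0
  · simp [hf0]
  rw [isUnit_infSubring_iff] at hf
  have := mem_infSubring.1 f.2
  rw [mem_infSubring, RatFunc.intDegree_mul RatFunc.X_ne_zero hf0, RatFunc.intDegree_X]
  have : (f : RatFunc k).intDegree ≠ 0 := fun h => hf ⟨hf0, h⟩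
  lia

theorem not_isUnit_of_X_mul_mem {f : infSubring k}
    (hf : RatFunc.X * (f : RatFunc k) ∈ infSubring k) :
    ¬ IsUnit f := by
  rw [isUnit_infSubring_iff]
  rintro ⟨h0, h⟩
  rw [mem_infSubring, RatFunc.intDegree_mul RatFunc.X_ne_zero h0, RatFunc.intDegree_X] at hf
  lia

instance : IsLocalRing (infSubring k) :=
  IsLocalRing.of_nonunits_add fun a b ha hb => by
    refine not_isUnit_of_X_mul_mem ?_
    push_cast
    rw [mul_add]
    exact add_mem (X_mul_mem_of_not_isUnit ha) (X_mul_mem_of_not_isUnit hb)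

theorem mem_maximalIdeal_infSubring {f : infSubring k} :
    f ∈ IsLocalRing.maximalIdeal (infSubring k) ↔ RatFunc.X * (f : RatFunc k) ∈ infSubring k :=
  ⟨X_mul_mem_of_not_isUnit, not_isUnit_of_X_mul_mem⟩

end RationalFunctions

section FunctionFieldPlaces

open IsDedekindDomain Module

section General

variable {k K L : Type} [Field k] [Field K] [Field L] [Algebra K L] [Algebra k K] [Algebra k L]
  [IsScalarTower k K L] {R : Subring K} {A : ValuationSubring L}

theorem mem_of_isIntegral_of_subring_le (hRA : ∀ r ∈ R, algebraMap K L r ∈ A) {x : L}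
    (hx : IsIntegral R x) : x ∈ A := by
  obtain ⟨f, hf, h0⟩ := hx
  have : IsIntegral A x := by
    refine ⟨f.map (((algebraMap K L).comp R.subtype).codRestrict A.toSubring
      fun r => hRA r r.2), hf.map _, ?_⟩
    rw [Polynomial.eval₂_map]
    exact h0
  obtain ⟨y, rfl⟩ := IsIntegrallyClosed.isIntegral_iff.1 this
  exact y.2

theorem eq_top_of_forall_algebraMap_mem [FiniteDimensional K L]
    (h : ∀ x : K, algebraMap K L x ∈ A) : A = ⊤ := by
  refine top_unique fun x _ => mem_of_isIntegral_of_subring_le (K := K) (R := ⊤)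
    (fun r _ => h r) ?_
  obtain ⟨f, hf, h0⟩ := Algebra.IsIntegral.isIntegral (R := K) x
  refine ⟨f.map Subring.topEquiv.symm.toRingHom, hf.map _, ?_⟩
  rw [Polynomial.eval₂_map]
  exact h0

section

variable [CharZero K] [FiniteDimensional K L] [IsPrincipalIdealRing R] [IsFractionRing R K]

instance isDedekindDomain_integralClosure_subring : IsDedekindDomain (integralClosure R L) :=
  integralClosure.isDedekindDomain R K L

instance isFractionRing_integralClosure_subring : IsFractionRing (integralClosure R L) L :=
  integralClosure.isFractionRing_of_finite_extension (A := R) K L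

instance finite_integralClosure_subring : Module.Finite R (integralClosure R L) := by
  have : IsNoetherian R (integralClosure R L) :=
    IsIntegralClosure.isNoetherian R K L (integralClosure R L)
  infer_instance

theorem exists_eq_valRing_integralClosure (hRA : ∀ r ∈ R, algebraMap K L r ∈ A) (hA : A ≠ ⊤) :
    ∃ v : HeightOneSpectrum (integralClosure R L), A = valRing L v :=
  exists_eq_valRing (fun b => mem_of_isIntegral_of_subring_le hRA b.2) hA

theorem algebraMap_mem_valRing_of_mem (v : HeightOneSpectrum (integralClosure R L)) {r : K}
    (hr : r ∈ R) : algebraMap K L r ∈ valRing L v :=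
  algebraMap_mem_valRing v (algebraMap R (integralClosure R L) ⟨r, hr⟩)

theorem isIntegral_of_forall_mem_valRing {x : L}
    (h : ∀ v : HeightOneSpectrum (integralClosure R L), x ∈ valRing L v) : IsIntegral R x := by
  obtain ⟨y, rfl⟩ := HeightOneSpectrum.mem_integers_of_valuation_le_one L x h
  exact y.2

end

omit [Algebra k K] [IsScalarTower k K L] in
/-- Integral elements are constant modulo a place if the elements of the base ring are. -/
theorem exists_valuation_sub_lt_of_isIntegral [IsAlgClosed k] (hkA : ∀ c : k, algebraMap k L c ∈ A)
    (hRA : ∀ r ∈ R, algebraMap K L r ∈ A)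
    (hR : ∀ r ∈ R, ∃ c : k, A.valuation (algebraMap K L r - algebraMap k L c) < 1) {b : L}
    (hb : IsIntegral R b) : ∃ c : k, A.valuation (b - algebraMap k L c) < 1 := by
  let π : A →+* IsLocalRing.ResidueField A := IsLocalRing.residue A
  let φ : k →+* IsLocalRing.ResidueField A :=
    π.comp ((algebraMap k L).codRestrict A.toSubring hkA)
  let ψ : R →+* IsLocalRing.ResidueField A :=
    π.comp (((algebraMap K L).comp R.subtype).codRestrict A.toSubring fun r => hRA r r.2)
  have hπ (x : L) (hx : x ∈ A) (c : k) :
      A.valuation (x - algebraMap k L c) < 1 ↔ φ c = π ⟨x, hx⟩ := by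
    rw [show φ c = π ⟨algebraMap k L c, hkA c⟩ from rfl, eq_comm (a := π _), ← sub_eq_zero,
      ← map_sub, IsLocalRing.residue_eq_zero_iff, ValuationSubring.valuation_lt_one_iff]
    rfl
  have hbA := mem_of_isIntegral_of_subring_le hRA hb
  obtain ⟨q, hq, hq0⟩ := hb
  have h1 : Polynomial.eval₂ ψ (π ⟨b, hbA⟩) q = 0 := by
    have := Polynomial.hom_eval₂ q (((algebraMap K L).comp R.subtype).codRestrict A.toSubring
      fun r => hRA r r.2) π ⟨b, hbA⟩
    rw [← this]
    have h2 : Polynomial.eval₂ (((algebraMap K L).comp R.subtype).codRestrict A.toSubring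
      fun r => hRA r r.2) (⟨b, hbA⟩ : A) q = 0 := by
      refine Subtype.ext ?_
      have := Polynomial.hom_eval₂ q (((algebraMap K L).comp R.subtype).codRestrict A.toSubring
        fun r => hRA r r.2) A.subtype ⟨b, hbA⟩
      exact this.trans hq0
    rw [h2, map_zero]
  have hlift : q.map ψ ∈ Polynomial.lifts φ := by
    rw [Polynomial.lifts_iff_coeff_lifts]
    intro n
    obtain ⟨c, hc⟩ := hR _ (q.coeff n).2
    refine ⟨c, ?_⟩
    rw [Polynomial.coeff_map]
    exact (hπ _ (hRA _ (q.coeff n).2) c).1 hc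
  obtain ⟨Q, hQ, -, hQm⟩ := Polynomial.lifts_and_natDegree_eq_and_monic hlift (hq.map _)
  have h2 : Polynomial.eval₂ φ (π ⟨b, hbA⟩) Q = 0 := by
    rw [← Polynomial.eval_map, hQ, Polynomial.eval_map, h1]
  rw [(IsAlgClosed.splits Q).eq_prod_roots_of_monic hQm, Polynomial.eval₂_multiset_prod,
    Multiset.prod_eq_zero_iff] at h2
  simp only [Multiset.map_map, Multiset.mem_map, Function.comp_apply, Polynomial.eval₂_sub,
    Polynomial.eval₂_X, Polynomial.eval₂_C] at h2
  obtain ⟨c, -, hc⟩ := h2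
  exact ⟨c, (hπ b hbA c).2 (sub_eq_zero.1 hc).symm⟩

omit [Algebra k K] [IsScalarTower k K L] in
/-- The residue field of a place is the field of constants. -/
theorem exists_valuation_sub_lt [CharZero K] [FiniteDimensional K L] [IsPrincipalIdealRing R]
    [IsFractionRing R K] [IsAlgClosed k] (hA : A ≠ ⊤) (hkA : ∀ c : k, algebraMap k L c ∈ A)
    (hRA : ∀ r ∈ R, algebraMap K L r ∈ A)
    (hR : ∀ r ∈ R, ∃ c : k, A.valuation (algebraMap K L r - algebraMap k L c) < 1) {x : L}
    (hx : x ∈ A) : ∃ c : k, A.valuation (x - algebraMap k L c) < 1 := by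
  obtain ⟨v, rfl⟩ := exists_eq_valRing_integralClosure hRA hA
  obtain ⟨n, d, h⟩ := v.exists_primeCompl_mul_eq_of_integer x hx
  obtain ⟨c, hc⟩ := exists_valuation_sub_lt_of_isIntegral hkA hRA hR n.2
  obtain ⟨e, he⟩ := exists_valuation_sub_lt_of_isIntegral hkA hRA hR (d : integralClosure R L).2
  simp only [valRing_valuation_lt_one_iff] at hc he ⊢
  have hd : v.valuation L (d : integralClosure R L) = 1 :=
    (v.valuation_eq_one_iff_notMem (K := L)).2 d.2
  have he0 : algebraMap k L e ≠ 0 := by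
    intro h0
    rw [h0, sub_zero, hd] at he
    exact lt_irrefl _ he
  refine ⟨c / e, ?_⟩
  have hle : v.valuation L (algebraMap k L (c / e)) ≤ 1 := hkA _
  have h' : x * (d : integralClosure R L) = (n : L) := h
  have key : (x - algebraMap k L (c / e)) * (d : integralClosure R L) =
      ((n : L) - algebraMap k L c) -
        algebraMap k L (c / e) * (((d : integralClosure R L) : L) - algebraMap k L e) := by
    rw [sub_mul, h', map_div₀]
    field_simp
    ring
  have h3 : v.valuation L ((x - algebraMap k L (c / e)) * (d : integralClosure R L)) < 1 := by
    rw [key]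
    refine (v.valuation L).map_sub_lt hc ?_
    rw [map_mul]
    exact mul_lt_one_of_nonneg_of_lt_one_right hle zero_le he
  rwa [map_mul, hd, mul_one] at h3

end General

end FunctionFieldPlaces

section FunctionFieldPlaces

open IsDedekindDomain Module

variable {k L : Type} [Field k] [Field L] [Algebra (RatFunc k) L] [Algebra k L]
  [IsScalarTower k (RatFunc k) L] {A : ValuationSubring L}

theorem algebraMap_ratFunc_C (c : k) :
    algebraMap (RatFunc k) L (RatFunc.C c) = algebraMap k L c := by
  rw [← RatFunc.algebraMap_eq_C, ← IsScalarTower.algebraMap_apply]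

theorem algebraMap_mem_of_mem_finSubring (hkA : ∀ c : k, algebraMap k L c ∈ A)
    (hX : algebraMap (RatFunc k) L RatFunc.X ∈ A) {r : RatFunc k} (hr : r ∈ finSubring k) :
    algebraMap (RatFunc k) L r ∈ A := by
  obtain ⟨p, rfl⟩ := hr
  induction p using Polynomial.induction_on with
  | C a => rw [RatFunc.algebraMap_C, algebraMap_ratFunc_C]; exact hkA a
  | add p q hp hq => rw [map_add, map_add]; exact add_mem hp hq
  | monomial n a h =>
    rw [pow_succ, ← mul_assoc, map_mul, map_mul, RatFunc.algebraMap_X]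
    exact mul_mem h hX

theorem algebraMap_mem_of_mem_infSubring (hkA : ∀ c : k, algebraMap k L c ∈ A)
    (hX : algebraMap (RatFunc k) L RatFunc.X ∉ A) {r : RatFunc k} (hr : r ∈ infSubring k) :
    algebraMap (RatFunc k) L r ∈ A := by
  by_cases hr0 : r = 0
  · simp [hr0]
  let w := A.valuation.comap (algebraMap (RatFunc k) L)
  have hle (c : k) : w (algebraMap k (RatFunc k) c) ≤ 1 := by
    rw [Valuation.comap_apply, ← IsScalarTower.algebraMap_apply]
    exact (A.valuation_le_one_iff _).2 (hkA c)
  have : w.IsTrivialOn k := ⟨fun c hc => le_antisymm (hle c) <| by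
    have h := hle c⁻¹
    rw [map_inv₀, map_inv₀] at h
    exact (inv_le_one₀ (zero_lt_iff.2 <| (Valuation.ne_zero_iff _).2 <|
      (map_ne_zero _).2 hc)).1 h⟩
  have hlt : 1 < w RatFunc.X := by
    rw [← not_le]
    exact fun h => hX ((A.valuation_le_one_iff _).1 h)
  have h := RatFunc.valuation_eq_valuation_X_zpow_intDegree_of_one_lt_valuation_X hlt hr0
  refine (A.valuation_le_one_iff _).1 ?_
  change w r ≤ 1
  rw [h]
  exact zpow_le_one_of_nonpos₀ hlt.le hr

theorem algebraMap_X_notMem [FiniteDimensional (RatFunc k) L] (hA : A ≠ ⊤)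
    (hinf : ∀ r ∈ infSubring k, algebraMap (RatFunc k) L r ∈ A) :
    algebraMap (RatFunc k) L RatFunc.X ∉ A := by
  intro hX
  refine hA (eq_top_of_forall_algebraMap_mem (K := RatFunc k) fun x => ?_)
  have hkA (c : k) : algebraMap k L c ∈ A := by
    rw [← algebraMap_ratFunc_C]
    exact hinf _ (C_mem_infSubring c)
  rcases mem_infSubring_or_inv_mem x with h | h
  · exact hinf x h
  obtain ⟨n, hn⟩ : ∃ n : ℕ, x.intDegree ≤ n := ⟨_, Int.self_le_toNat _⟩
  have hx : x = RatFunc.X ^ n * (x * (RatFunc.X ^ n)⁻¹) := by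
    rw [mul_left_comm, mul_inv_cancel₀ (pow_ne_zero _ RatFunc.X_ne_zero), mul_one]
  rw [hx, map_mul, map_pow]
  refine mul_mem (pow_mem hX n) (hinf _ ?_)
  by_cases hx0 : x = 0
  · simp [hx0]
  have hX0 : (RatFunc.X : RatFunc k) ^ n ≠ 0 := pow_ne_zero _ RatFunc.X_ne_zero
  rw [mem_infSubring, RatFunc.intDegree_mul hx0 (inv_ne_zero hX0), RatFunc.intDegree_inv,
    intDegree_pow RatFunc.X_ne_zero, RatFunc.intDegree_X]
  lia

theorem exists_valuation_sub_lt_of_mem_infSubring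
    (hX : algebraMap (RatFunc k) L RatFunc.X ∉ A)
    (hinf : ∀ r ∈ infSubring k, algebraMap (RatFunc k) L r ∈ A) {r : RatFunc k}
    (hr : r ∈ infSubring k) :
    ∃ c : k, A.valuation (algebraMap (RatFunc k) L r - algebraMap k L c) < 1 := by
  obtain ⟨c, hc⟩ := exists_X_mul_sub_C_mem hr
  refine ⟨c, ?_⟩
  have h := (A.valuation_le_one_iff _).2 (hinf _ hc)
  have hX' : 1 < A.valuation (algebraMap (RatFunc k) L RatFunc.X) := by
    rw [← not_le]
    exact fun h => hX ((A.valuation_le_one_iff _).1 h)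
  rw [map_mul, map_mul, map_sub, algebraMap_ratFunc_C] at h
  by_contra! h'
  exact absurd (hX'.trans_le (le_mul_of_one_le_right zero_le h')) (not_lt.2 h)

theorem exists_valuation_X_sub_lt [FiniteDimensional (RatFunc k) L] [IsAlgClosed k] (hA : A ≠ ⊤)
    (hfin : ∀ r ∈ finSubring k, algebraMap (RatFunc k) L r ∈ A) :
    ∃ c : k, A.valuation
      (algebraMap (RatFunc k) L RatFunc.X - algebraMap k L c) < 1 := by
  by_contra! hc
  let w := A.valuation.comap (algebraMap (RatFunc k) L)
  refine hA (eq_top_of_forall_algebraMap_mem (K := RatFunc k) fun x => ?_)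
  have h1 (c : k) : 1 ≤ w (RatFunc.X - RatFunc.C c) := by
    have := hc c
    rwa [← algebraMap_ratFunc_C c, ← map_sub] at this
  have hle {f : RatFunc k} (hf : f ∈ finSubring k) : w f ≤ 1 :=
    (A.valuation_le_one_iff _).2 (hfin f hf)
  have hC (a : k) (ha : a ≠ 0) : 1 ≤ w (RatFunc.C a) := by
    have h := hle (C_mem_finSubring a⁻¹)
    rw [map_inv₀, map_inv₀] at h
    exact (inv_le_one₀ (zero_lt_iff.2 <| (Valuation.ne_zero_iff _).2 <|
      (map_ne_zero _).2 ha)).1 h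
  have h2 (p : Polynomial k) (hp : p ≠ 0) :
      1 ≤ w (algebraMap (Polynomial k) (RatFunc k) p) := by
    rw [(IsAlgClosed.splits p).eq_prod_roots, map_mul, map_mul, RatFunc.algebraMap_C]
    refine one_le_mul (hC _ (Polynomial.leadingCoeff_ne_zero.2 hp)) ?_
    rw [map_multiset_prod, map_multiset_prod]
    refine Multiset.one_le_prod_of_one_le ?_
    simp only [Multiset.map_map, Multiset.mem_map, Function.comp_apply]
    rintro _ ⟨a, -, rfl⟩
    rw [map_sub, RatFunc.algebraMap_X, RatFunc.algebraMap_C]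
    exact h1 a
  refine (A.valuation_le_one_iff _).1 ?_
  change w x ≤ 1
  rw [← RatFunc.num_div_denom x, map_div₀]
  exact div_le_one_of_le₀ ((hle (algebraMap_mem_finSubring _)).trans
    (h2 _ (RatFunc.denom_ne_zero x))) zero_le

theorem exists_valuation_sub_lt_of_mem_finSubring [FiniteDimensional (RatFunc k) L] [IsAlgClosed k]
    (hA : A ≠ ⊤) (hfin : ∀ r ∈ finSubring k, algebraMap (RatFunc k) L r ∈ A) {r : RatFunc k}
    (hr : r ∈ finSubring k) :
    ∃ c : k, A.valuation (algebraMap (RatFunc k) L r - algebraMap k L c) < 1 := by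
  obtain ⟨c, hc⟩ := exists_valuation_X_sub_lt hA hfin
  obtain ⟨p, rfl⟩ := hr
  refine ⟨p.eval c, ?_⟩
  obtain ⟨q, hq⟩ := Polynomial.X_sub_C_dvd_sub_C_eval (p := p) (a := c)
  have h := congrArg (algebraMap (RatFunc k) L)
    (congrArg (algebraMap (Polynomial k) (RatFunc k)) hq)
  simp only [map_sub, map_mul, RatFunc.algebraMap_X, RatFunc.algebraMap_C,
    algebraMap_ratFunc_C] at h
  rw [h, map_mul]
  exact mul_lt_one_of_lt_of_le hc
    ((A.valuation_le_one_iff _).2 (hfin _ (algebraMap_mem_finSubring q)))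

namespace FFPlace

variable (P : FFPlace k L)

theorem algebraMap_mem_of_fin (hX : algebraMap (RatFunc k) L RatFunc.X ∈ P.1) :
    ∀ r ∈ finSubring k, algebraMap (RatFunc k) L r ∈ P.1 :=
  fun _ hr => algebraMap_mem_of_mem_finSubring P.2.1 hX hr

theorem algebraMap_mem_of_inf (hX : algebraMap (RatFunc k) L RatFunc.X ∉ P.1) :
    ∀ r ∈ infSubring k, algebraMap (RatFunc k) L r ∈ P.1 :=
  fun _ hr => algebraMap_mem_of_mem_infSubring P.2.1 hX hr

variable [CharZero k] [FiniteDimensional (RatFunc k) L]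

theorem isDiscretePlace : IsDiscretePlace P.1 := by
  by_cases hX : algebraMap (RatFunc k) L RatFunc.X ∈ P.1
  · obtain ⟨v, hv⟩ := exists_eq_valRing_integralClosure (P.algebraMap_mem_of_fin hX) P.2.2
    rw [hv]
    exact isDiscretePlace_valRing v
  · obtain ⟨v, hv⟩ := exists_eq_valRing_integralClosure (P.algebraMap_mem_of_inf hX) P.2.2
    rw [hv]
    exact isDiscretePlace_valRing v

theorem exists_valuation_sub_lt [IsAlgClosed k] {x : L} (hx : x ∈ P.1) :
    ∃ c : k, P.1.valuation (x - algebraMap k L c) < 1 := by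
  by_cases hX : algebraMap (RatFunc k) L RatFunc.X ∈ P.1
  · exact _root_.exists_valuation_sub_lt P.2.2 P.2.1 (P.algebraMap_mem_of_fin hX)
      (fun r hr => exists_valuation_sub_lt_of_mem_finSubring P.2.2
        (P.algebraMap_mem_of_fin hX) hr) hx
  · exact _root_.exists_valuation_sub_lt P.2.2 P.2.1 (P.algebraMap_mem_of_inf hX)
      (fun r hr => exists_valuation_sub_lt_of_mem_infSubring hX
        (P.algebraMap_mem_of_inf hX) hr) hx

end FFPlace

variable [CharZero k] [FiniteDimensional (RatFunc k) L]

theorem isIntegral_finSubring_iff {x : L} : IsIntegral (finSubring k) x ↔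
    ∀ P : FFPlace k L, algebraMap (RatFunc k) L RatFunc.X ∈ P.1 → x ∈ P.1 := by
  refine ⟨fun h P hP => mem_of_isIntegral_of_subring_le (P.algebraMap_mem_of_fin hP) h,
    fun h => isIntegral_of_forall_mem_valRing fun v => ?_⟩
  refine h ⟨valRing L v, fun c => ?_, valRing_ne_top v⟩
    (algebraMap_mem_valRing_of_mem v X_mem_finSubring)
  rw [← algebraMap_ratFunc_C]
  exact algebraMap_mem_valRing_of_mem v (C_mem_finSubring c)

theorem isIntegral_infSubring_iff {x : L} : IsIntegral (infSubring k) x ↔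
    ∀ P : FFPlace k L, algebraMap (RatFunc k) L RatFunc.X ∉ P.1 → x ∈ P.1 := by
  refine ⟨fun h P hP => mem_of_isIntegral_of_subring_le (P.algebraMap_mem_of_inf hP) h,
    fun h => isIntegral_of_forall_mem_valRing fun v => ?_⟩
  have hinf : ∀ r ∈ infSubring k, algebraMap (RatFunc k) L r ∈ valRing L v :=
    fun r hr => algebraMap_mem_valRing_of_mem v hr
  refine h ⟨valRing L v, fun c => ?_, valRing_ne_top v⟩
    (algebraMap_X_notMem (valRing_ne_top v) hinf)
  rw [← algebraMap_ratFunc_C]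
  exact hinf _ (C_mem_infSubring c)

end FunctionFieldPlaces

section Divisors

open IsDedekindDomain Module WithZero

theorem divDeg_add {k L : Type} [Field k] [Field L] [Algebra k L] (D E : FFPlace k L →₀ ℤ) :
    divDeg (D + E) = divDeg D + divDeg E :=
  map_add (Finsupp.liftAddHom fun _ : FFPlace k L => AddMonoidHom.id ℤ) D E

theorem divDeg_smul {k L : Type} [Field k] [Field L] [Algebra k L] (m : ℤ)
    (D : FFPlace k L →₀ ℤ) : divDeg (m • D) = m * divDeg D :=
  map_zsmul (Finsupp.liftAddHom fun _ : FFPlace k L => AddMonoidHom.id ℤ) m D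

theorem divDeg_sub {k L : Type} [Field k] [Field L] [Algebra k L] (D E : FFPlace k L →₀ ℤ) :
    divDeg (D - E) = divDeg D - divDeg E :=
  map_sub (Finsupp.liftAddHom fun _ : FFPlace k L => AddMonoidHom.id ℤ) D E

theorem divDeg_sum {k L ι : Type} [Field k] [Field L] [Algebra k L] (s : Finset ι)
    (D : ι → FFPlace k L →₀ ℤ) : divDeg (∑ i ∈ s, D i) = ∑ i ∈ s, divDeg (D i) :=
  map_sum (Finsupp.liftAddHom fun _ : FFPlace k L => AddMonoidHom.id ℤ) D s

theorem divDeg_single {k L : Type} [Field k] [Field L] [Algebra k L] (P : FFPlace k L) (m : ℤ) :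
    divDeg (Finsupp.single P m) = m :=
  Finsupp.sum_single_index rfl

variable {k L : Type} [Field k] [Field L] [Algebra (RatFunc k) L] [Algebra k L]
  [IsScalarTower k (RatFunc k) L] [CharZero k] [FiniteDimensional (RatFunc k) L]
  {R : Subring (RatFunc k)} [IsPrincipalIdealRing R] [IsFractionRing R (RatFunc k)]

instance isTorsionFree_subring {K L : Type} [Field K] [Field L] [Algebra K L] (R : Subring K) :
    IsTorsionFree R L :=
  have : FaithfulSMul R L := (faithfulSMul_iff_algebraMap_injective R L).2
    ((algebraMap K L).injective.comp Subtype.val_injective)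
  inferInstance

theorem algebraMap_integralClosure_subring_ne_zero {K L : Type} [Field K] [Field L] [Algebra K L]
    {R : Subring K} {p : R} (hp : p ≠ 0) : algebraMap R (integralClosure R L) p ≠ 0 := by
  intro h
  refine hp (Subtype.ext ((algebraMap K L).injective ?_))
  rw [ZeroMemClass.coe_zero, map_zero]
  exact congrArg Subtype.val h

omit [Algebra k L] [IsScalarTower k (RatFunc k) L] in
theorem ramificationIdx_eq_ordAt {p : R} (hp : Prime p)
    (v : HeightOneSpectrum (integralClosure R L)) [v.asIdeal.LiesOver (Ideal.span {p})] :
    (v.asIdeal.ramificationIdx R : ℤ) =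
      ordAt (valRing L v) (algebraMap (RatFunc k) L (p : RatFunc k)) := by
  have h0 : algebraMap R (integralClosure R L) p ≠ 0 :=
    algebraMap_integralClosure_subring_ne_zero hp.ne_zero
  have hL : algebraMap (integralClosure R L) L (algebraMap R (integralClosure R L) p) =
    algebraMap (RatFunc k) L (p : RatFunc k) := rfl
  have hL0 : algebraMap (RatFunc k) L (p : RatFunc k) ≠ 0 := by
    rw [← hL]
    exact fun h => h0 (Subtype.ext h)
  have h1 := valuation_eq_exp_ordAt_valRing v hL0
  rw [← hL, HeightOneSpectrum.valuation_of_algebraMap, v.intValuation_eq_exp_neg_multiplicity h0,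
    exp_inj, neg_inj] at h1
  have : v.asIdeal.IsPrime := v.isPrime
  rw [Ideal.IsDedekindDomain.ramificationIdx_eq_multiplicity (Ideal.span {p}), Ideal.map_span,
    Set.image_singleton, h1, hL]
  rw [Ideal.map_span, Set.image_singleton, Ne, Ideal.span_singleton_eq_bot]
  exact h0

theorem inertiaDeg_eq_one [IsAlgClosed k] {p : R} (hp : Prime p)
    (hk : ∀ c : k, RatFunc.C c ∈ R) (hres : ∀ r : R, ∃ c : k, p ∣ r - ⟨RatFunc.C c, hk c⟩)
    (v : HeightOneSpectrum (integralClosure R L)) [v.asIdeal.LiesOver (Ideal.span {p})] :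
    v.asIdeal.inertiaDeg R = 1 := by
  have hmax : (Ideal.span {p}).IsMaximal :=
    PrincipalIdealRing.isMaximal_of_irreducible hp.irreducible
  have := v.isMaximal
  have hmem (b : integralClosure R L) : b ∈ v.asIdeal ↔ (valRing L v).valuation (b : L) < 1 := by
    rw [valRing_valuation_lt_one_iff, ← v.valuation_lt_one_iff_mem (K := L)]
    rfl
  have hkC (c : k) : algebraMap k L c =
      (algebraMap R (integralClosure R L) ⟨RatFunc.C c, hk c⟩ : integralClosure R L) :=
    (algebraMap_ratFunc_C c).symm
  rw [Ideal.inertiaDeg_eq_of_isMaximal (Ideal.span {p})]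
  let : Field (R ⧸ Ideal.span {p}) := Ideal.Quotient.field _
  refine finrank_eq_one 1 one_ne_zero fun w => ?_
  obtain ⟨b, rfl⟩ := Ideal.Quotient.mk_surjective w
  obtain ⟨c, hc⟩ := exists_valuation_sub_lt_of_isIntegral (k := k) (K := RatFunc k) (R := R)
    (A := valRing L v) (fun c => by
      rw [← algebraMap_ratFunc_C]
      exact algebraMap_mem_valRing_of_mem v (hk c))
    (fun r hr => algebraMap_mem_valRing_of_mem v hr)
    (fun r hr => by
      obtain ⟨c, hc⟩ := hres ⟨r, hr⟩
      refine ⟨c, ?_⟩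
      rw [← algebraMap_ratFunc_C c, ← map_sub]
      refine (hmem (algebraMap R (integralClosure R L) (⟨r, hr⟩ - ⟨RatFunc.C c, hk c⟩))).1 ?_
      have h := Ideal.mem_span_singleton.2 hc
      rw [v.asIdeal.over_def (Ideal.span {p}), Ideal.mem_comap] at h
      exact h) b.2
  refine ⟨Ideal.Quotient.mk _ ⟨RatFunc.C c, hk c⟩, ?_⟩
  rw [Algebra.smul_def, mul_one, Ideal.Quotient.algebraMap_mk_of_liesOver, eq_comm,
    Ideal.Quotient.mk_eq_mk_iff_sub_mem, hmem]
  rw [hkC] at hc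
  exact hc

/-- The divisor of zeros of a prime element with residue field `k` has degree `[L : k(t)]`. -/
theorem exists_divisor_of_prime [IsAlgClosed k] {p : R} (hp : Prime p)
    (hk : ∀ c : k, RatFunc.C c ∈ R) (hres : ∀ r : R, ∃ c : k, p ∣ r - ⟨RatFunc.C c, hk c⟩) :
    ∃ Z : FFPlace k L →₀ ℤ, divDeg Z = finrank (RatFunc k) L ∧ ∀ P : FFPlace k L, Z P =
      if (∀ r ∈ R, algebraMap (RatFunc k) L r ∈ P.1) ∧
        P.1.valuation (algebraMap (RatFunc k) L (p : RatFunc k)) < 1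
      then ordAt P.1 (algebraMap (RatFunc k) L (p : RatFunc k)) else 0 := by
  have hmax : (Ideal.span {p}).IsMaximal :=
    PrincipalIdealRing.isMaximal_of_irreducible hp.irreducible
  have hp0 : Ideal.span {p} ≠ ⊥ := by
    rw [Ne, Ideal.span_singleton_eq_bot]
    exact hp.ne_zero
  let S := integralClosure R L
  have hfree : Module.Free R S := IsIntegralClosure.module_free R (RatFunc k) L S
  have hfin : ((Ideal.span {p}).primesOver S).Finite := Algebra.QuasiFinite.finite_primesOver _
  let := hfin.fintype
  have hsum := Ideal.sum_ramification_inertia_eq_finrank (Ideal.span {p}) S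
  rw [IsIntegralClosure.rank R (RatFunc k) L S] at hsum
  let V (q : (Ideal.span {p}).primesOver S) : HeightOneSpectrum S :=
    ⟨q.1, q.2.1, by
      have := q.2.2
      exact Ideal.ne_bot_of_liesOver_of_ne_bot hp0 q.1⟩
  have hV (q) : (V q).asIdeal.LiesOver (Ideal.span {p}) := q.2.2
  have hRV (v : HeightOneSpectrum S) : ∀ r ∈ R, algebraMap (RatFunc k) L r ∈ valRing L v :=
    fun r hr => algebraMap_mem_valRing_of_mem v hr
  let Φ (v : HeightOneSpectrum S) : FFPlace k L := ⟨valRing L v, fun c => by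
    rw [← algebraMap_ratFunc_C]; exact hRV v _ (hk c), valRing_ne_top _⟩
  let o (P : FFPlace k L) : ℤ := ordAt P.1 (algebraMap (RatFunc k) L (p : RatFunc k))
  refine ⟨∑ q, Finsupp.single (Φ (V q)) (o (Φ (V q))), ?_, fun P => ?_⟩
  · simp only [divDeg_sum, divDeg_single]
    rw [← hsum, Nat.cast_sum]
    refine Finset.sum_congr rfl fun q _ => ?_
    have h1 := ramificationIdx_eq_ordAt hp (V q)
    have h2 := inertiaDeg_eq_one hp hk hres (V q)
    change _ = (((V q).asIdeal.ramificationIdx R * (V q).asIdeal.inertiaDeg R : ℕ) : ℤ)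
    rw [h2, mul_one, h1]
  · have hval (v : HeightOneSpectrum S) : (Φ v).1.valuation (algebraMap (RatFunc k) L p) < 1 ↔
        p ∈ v.asIdeal.comap (algebraMap R S) := by
      rw [Ideal.mem_comap, ← v.valuation_lt_one_iff_mem (K := L)]
      exact valRing_valuation_lt_one_iff v
    rw [Finsupp.finsetSum_apply]
    split_ifs with h
    · obtain ⟨v, hv⟩ := exists_eq_valRing_integralClosure h.1 P.2.2
      obtain rfl : P = Φ v := Subtype.ext hv
      have hover : v.asIdeal.LiesOver (Ideal.span {p}) := ⟨by
        refine hmax.eq_of_le ?_ ?_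
        · exact (Ideal.comap_ne_top _ v.isPrime.ne_top)
        · rw [Ideal.span_singleton_le_iff_mem]
          exact (hval v).1 h.2⟩
      rw [Finset.sum_eq_single (⟨v.asIdeal, v.isPrime, hover⟩ : (Ideal.span {p}).primesOver S)]
      · exact Finsupp.single_eq_same
      · intro q _ hq
        refine Finsupp.single_eq_of_ne' fun h => hq ?_
        have := valRing_injective (L := L) (congrArg Subtype.val h)
        exact Subtype.ext (congrArg HeightOneSpectrum.asIdeal this)
      · exact fun h => absurd (Finset.mem_univ _) h
    · refine Finset.sum_eq_zero fun q _ => Finsupp.single_eq_of_ne' ?_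
      rintro rfl
      refine h ⟨hRV _, (hval _).2 ?_⟩
      rw [← Ideal.under_def, ← (hV q).over]
      exact Ideal.mem_span_singleton_self p

end Divisors

section RiemannRochSpaces

open Module

variable {k L : Type} [Field k] [Field L] [Algebra (RatFunc k) L] [Algebra k L]
  [IsScalarTower k (RatFunc k) L] [CharZero k] [FiniteDimensional (RatFunc k) L]

omit [CharZero k] in
theorem prime_X_sub_C_finSubring (c : k) :
    Prime (⟨_, algebraMap_mem_finSubring (Polynomial.X - Polynomial.C c)⟩ : finSubring k) := by
  let e : Polynomial k ≃+* finSubring k :=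
    RingEquiv.ofBijective (algebraMap (Polynomial k) (RatFunc k)).rangeRestrict
      ⟨fun a b h => RatFunc.algebraMap_injective k (congrArg Subtype.val h),
        RingHom.rangeRestrict_surjective _⟩
  exact (MulEquiv.prime_iff e).2 (Polynomial.prime_X_sub_C c)

omit [CharZero k] in
theorem prime_inv_X_infSubring : Prime (⟨_, inv_X_mem_infSubring⟩ : infSubring k) := by
  have h0 : (⟨_, inv_X_mem_infSubring⟩ : infSubring k) ≠ 0 := fun h =>
    inv_ne_zero RatFunc.X_ne_zero (congrArg Subtype.val h)
  rw [← Ideal.span_singleton_prime h0]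
  suffices h : Ideal.span {(⟨_, inv_X_mem_infSubring⟩ : infSubring k)} =
      IsLocalRing.maximalIdeal (infSubring k) by
    rw [h]
    infer_instance
  ext f
  rw [mem_maximalIdeal_infSubring, Ideal.mem_span_singleton']
  constructor
  · rintro ⟨a, rfl⟩
    push_cast
    rw [mul_left_comm, mul_inv_cancel₀ RatFunc.X_ne_zero, mul_one]
    exact a.2
  · intro h
    refine ⟨⟨_, h⟩, Subtype.ext ?_⟩
    push_cast
    rw [mul_comm, ← mul_assoc, inv_mul_cancel₀ RatFunc.X_ne_zero, one_mul]

omit [CharZero k] [FiniteDimensional (RatFunc k) L] in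
theorem algebraMap_X_sub_ne_zero (c : k) :
    algebraMap (RatFunc k) L RatFunc.X - algebraMap k L c ≠ 0 := by
  rw [← algebraMap_ratFunc_C c, ← map_sub, Ne, map_eq_zero, ← RatFunc.algebraMap_X,
    ← RatFunc.algebraMap_C, ← map_sub, FaithfulSMul.algebraMap_eq_zero_iff]
  exact Polynomial.X_sub_C_ne_zero c

omit [CharZero k] [FiniteDimensional (RatFunc k) L] in
theorem algebraMap_X_ne_zero : algebraMap (RatFunc k) L RatFunc.X ≠ 0 := by
  simpa using algebraMap_X_sub_ne_zero (k := k) (L := L) 0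

variable (k L) in
theorem exists_poleDivisor [IsAlgClosed k] : ∃ D : FFPlace k L →₀ ℤ,
    divDeg D = finrank (RatFunc k) L ∧ ∀ P : FFPlace k L, D P =
      if algebraMap (RatFunc k) L RatFunc.X ∈ P.1 then 0
      else -ordAt P.1 (algebraMap (RatFunc k) L RatFunc.X) := by
  obtain ⟨D, hD, h⟩ := exists_divisor_of_prime (L := L) prime_inv_X_infSubring
    (fun c : k => C_mem_infSubring c) (fun r => by
      obtain ⟨c, hc⟩ := exists_X_mul_sub_C_mem r.2
      refine ⟨c, ⟨_, hc⟩, Subtype.ext ?_⟩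
      push_cast
      rw [← mul_assoc, inv_mul_cancel₀ RatFunc.X_ne_zero, one_mul])
  refine ⟨D, hD, fun P => ?_⟩
  rw [h]
  simp only [map_inv₀, P.isDiscretePlace.ordAt_inv algebraMap_X_ne_zero]
  by_cases hX : algebraMap (RatFunc k) L RatFunc.X ∈ P.1
  · rw [if_pos hX, if_neg]
    rintro ⟨h, -⟩
    exact algebraMap_X_notMem P.2.2 h hX
  · rw [if_neg hX, if_pos]
    refine ⟨P.algebraMap_mem_of_inf hX, ?_⟩
    rw [inv_lt_one₀ (zero_lt_iff.2 <| (Valuation.ne_zero_iff _).2 algebraMap_X_ne_zero), ← not_le]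
    exact fun h => hX ((P.1.valuation_le_one_iff _).1 h)

variable (L) in
theorem exists_zeroDivisor [IsAlgClosed k] (c : k) : ∃ Z : FFPlace k L →₀ ℤ,
    divDeg Z = finrank (RatFunc k) L ∧ ∀ P : FFPlace k L, Z P =
      if algebraMap (RatFunc k) L RatFunc.X ∈ P.1
      then ordAt P.1 (algebraMap (RatFunc k) L RatFunc.X - algebraMap k L c) else 0 := by
  obtain ⟨D, hD, h⟩ := exists_divisor_of_prime (L := L) (prime_X_sub_C_finSubring c)
    (fun c : k => C_mem_finSubring c) (fun r => by
      obtain ⟨p, hp⟩ := r.2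
      obtain ⟨q, hq⟩ := Polynomial.X_sub_C_dvd_sub_C_eval (p := p) (a := c)
      refine ⟨p.eval c, ⟨_, algebraMap_mem_finSubring q⟩, Subtype.ext ?_⟩
      have := congrArg (algebraMap (Polynomial k) (RatFunc k)) hq
      rw [map_sub, hp, map_mul, RatFunc.algebraMap_C] at this
      exact this)
  refine ⟨D, hD, fun P => ?_⟩
  rw [h]
  simp only [map_sub, RatFunc.algebraMap_X, RatFunc.algebraMap_C, algebraMap_ratFunc_C]
  by_cases hX : algebraMap (RatFunc k) L RatFunc.X ∈ P.1
  · have hpos := P.isDiscretePlace.ordAt_pos_iff (algebraMap_X_sub_ne_zero (L := L) c)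
    rw [if_pos hX]
    have h0 := (P.isDiscretePlace.ordAt_nonneg_iff (algebraMap_X_sub_ne_zero c)).2
      (sub_mem hX (P.2.1 c))
    split_ifs with hc
    · rfl
    · by_contra! h1
      exact hc ⟨P.algebraMap_mem_of_fin hX, hpos.1 (lt_of_le_of_ne h0 h1)⟩
  · rw [if_neg hX, if_neg]
    exact fun h => hX (h.1 _ X_mem_finSubring)

namespace FFPlace

variable (P : FFPlace k L)

theorem ordAt_algebraMap {c : k} (hc : c ≠ 0) : ordAt P.1 (algebraMap k L c) = 0 := by
  have h {c : k} (hc : c ≠ 0) : 0 ≤ ordAt P.1 (algebraMap k L c) :=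
    (P.isDiscretePlace.ordAt_nonneg_iff ((map_ne_zero _).2 hc)).2 (P.2.1 c)
  have h1 := h (inv_ne_zero hc)
  rw [map_inv₀, P.isDiscretePlace.ordAt_inv ((map_ne_zero _).2 hc)] at h1
  have := h hc
  lia

theorem ordAt_X_sub (hX : algebraMap (RatFunc k) L RatFunc.X ∉ P.1) (c : k) :
    ordAt P.1 (algebraMap (RatFunc k) L RatFunc.X - algebraMap k L c) =
      ordAt P.1 (algebraMap (RatFunc k) L RatFunc.X) := by
  by_cases hc : c = 0
  · simp [hc]
  have h0 : ordAt P.1 (algebraMap (RatFunc k) L RatFunc.X) < 0 := by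
    rw [← not_le, P.isDiscretePlace.ordAt_nonneg_iff algebraMap_X_ne_zero]
    exact hX
  have hc1 := P.ordAt_algebraMap hc
  have hc2 : ordAt P.1 (-algebraMap k L c) = 0 := by
    rw [← map_neg]
    exact P.ordAt_algebraMap (neg_ne_zero.2 hc)
  refine le_antisymm ?_ ?_
  · by_contra! h
    have := P.isDiscretePlace.le_ordAt_add
      (x := algebraMap (RatFunc k) L RatFunc.X - algebraMap k L c) (y := algebraMap k L c)
      (n := ordAt P.1 (algebraMap (RatFunc k) L RatFunc.X) + 1)
      (fun _ => h) (fun _ => by lia) (by rw [sub_add_cancel]; exact algebraMap_X_ne_zero)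
    rw [sub_add_cancel] at this
    lia
  · rw [sub_eq_add_neg]
    refine P.isDiscretePlace.le_ordAt_add (fun _ => le_rfl) (fun _ => by lia) ?_
    rw [← sub_eq_add_neg]
    exact algebraMap_X_sub_ne_zero c

end FFPlace

variable (k L) in
/-- Divisors of nonzero functions that have degree zero. -/
def principalDivisors : AddSubmonoid (FFPlace k L →₀ ℤ) where
  carrier := {U | divDeg U = 0 ∧ ∃ u : L, u ≠ 0 ∧ ∀ P : FFPlace k L, U P = ordAt P.1 u}
  zero_mem' := ⟨rfl, 1, one_ne_zero, fun P => P.isDiscretePlace.ordAt_one.symm⟩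
  add_mem' := by
    rintro U V ⟨hU, u, hu, h⟩ ⟨hV, v, hv, hV'⟩
    refine ⟨by rw [divDeg_add, hU, hV, add_zero], u * v, mul_ne_zero hu hv, fun P => ?_⟩
    rw [P.isDiscretePlace.ordAt_mul hu hv, Finsupp.add_apply, h, hV']

/-- The Riemann–Roch space of a divisor. -/
def rrSpace (D : FFPlace k L →₀ ℤ) : Submodule k L where
  carrier := {f | f ≠ 0 → ∀ P : FFPlace k L, -(D P) ≤ ordAt P.1 f}
  zero_mem' := fun h => absurd rfl h
  add_mem' := fun hf hg h P =>
    P.isDiscretePlace.le_ordAt_add (fun h => hf h P) (fun h => hg h P) h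
  smul_mem' := fun c f hf h P => by
    rw [Algebra.smul_def] at h ⊢
    have hc := left_ne_zero_of_mul h
    rw [P.isDiscretePlace.ordAt_mul hc (right_ne_zero_of_mul h),
      P.ordAt_algebraMap ((map_ne_zero _).1 hc), zero_add]
    exact hf (right_ne_zero_of_mul h) P

theorem mem_rrSpace {D : FFPlace k L →₀ ℤ} {f : L} :
    f ∈ rrSpace D ↔ (f ≠ 0 → ∀ P : FFPlace k L, -(D P) ≤ ordAt P.1 f) := Iff.rfl

theorem rrDim_eq (D : FFPlace k L →₀ ℤ) : rrDim k D = finrank k (rrSpace D) := by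
  unfold rrDim
  rw [← Submodule.span_eq (rrSpace D)]
  rfl

theorem rrDim_add_single_le [IsAlgClosed k] (D : FFPlace k L →₀ ℤ) (P : FFPlace k L) :
    rrDim k (D + Finsupp.single P 1) ≤ rrDim k D + 1 := by
  rw [rrDim_eq, rrDim_eq]
  set V := rrSpace (D + Finsupp.single P 1)
  set W := rrSpace D
  by_cases hfin : FiniteDimensional k V
  swap
  · rw [finrank_of_infinite_dimensional hfin]
    exact Nat.zero_le _
  have hWV : W ≤ V := fun f hf hf0 Q => by
    have h1 := hf hf0 Q
    have h2 : 0 ≤ Finsupp.single P (1 : ℤ) Q := by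
      rw [Finsupp.single_apply]
      split_ifs <;> decide
    rw [Finsupp.add_apply]
    lia
  have hsub {f : L} (hf : f ∈ V) (h : f ≠ 0 → -(D P) ≤ ordAt P.1 f) : f ∈ W := fun hf0 Q => by
    by_cases hQ : Q = P
    · subst hQ
      exact h hf0
    · have := hf hf0 Q
      rwa [Finsupp.add_apply, Finsupp.single_eq_of_ne hQ, add_zero] at this
  by_cases hVW : V ≤ W
  · rw [le_antisymm hWV hVW]
    exact Nat.le_succ _
  obtain ⟨y, hyV, hyW⟩ := SetLike.not_le_iff_exists.1 hVW
  have hy0 : y ≠ 0 := by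
    rintro rfl
    exact hyW W.zero_mem
  have hV {x : L} (hx : x ∈ V) (hx0 : x ≠ 0) : -(D P) - 1 ≤ ordAt P.1 x := by
    have := hx hx0 P
    rw [Finsupp.add_apply, Finsupp.single_eq_same] at this
    lia
  have hy : ordAt P.1 y = -(D P) - 1 := by
    refine le_antisymm ?_ (hV hyV hy0)
    by_contra! h
    exact hyW (hsub hyV fun _ => by lia)
  have hle : V ≤ W ⊔ Submodule.span k {y} := by
    intro x hx
    by_cases hx0 : x = 0
    · rw [hx0]
      exact Submodule.zero_mem _
    have hxy : x / y ∈ P.1 := by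
      rw [← P.isDiscretePlace.ordAt_nonneg_iff (div_ne_zero hx0 hy0),
        P.isDiscretePlace.ordAt_div hx0 hy0]
      have := hV hx hx0
      lia
    obtain ⟨c, hc⟩ := P.exists_valuation_sub_lt hxy
    have hz : x - c • y ∈ W := by
      refine hsub (V.sub_mem hx (V.smul_mem c hyV)) fun h0 => ?_
      have hne : x / y - algebraMap k L c ≠ 0 := by
        intro h
        apply h0
        rw [Algebra.smul_def, ← sub_eq_zero.1 h, div_mul_cancel₀ _ hy0, sub_self]
      have h1 := (P.isDiscretePlace.ordAt_pos_iff hne).2 hc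
      have h2 : x - c • y = (x / y - algebraMap k L c) * y := by
        rw [Algebra.smul_def, sub_mul, div_mul_cancel₀ _ hy0]
      rw [h2, P.isDiscretePlace.ordAt_mul hne hy0]
      lia
    rw [← sub_add_cancel x (c • y)]
    exact Submodule.add_mem_sup hz (Submodule.smul_mem _ _ (Submodule.mem_span_singleton_self y))
  have hWfin : FiniteDimensional k W := Submodule.finiteDimensional_of_le hWV
  calc finrank k V ≤ finrank k ↥(W ⊔ Submodule.span k {y}) := Submodule.finrank_mono hle
    _ ≤ finrank k W + finrank k (Submodule.span k {y}) :=
      Submodule.finrank_add_le_finrank_add_finrank _ _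
    _ ≤ finrank k W + 1 := by
        gcongr
        rw [finrank_span_singleton hy0]

theorem divDeg_sub_rrDim_mono [IsAlgClosed k] {D E : FFPlace k L →₀ ℤ} (h : ∀ P, D P ≤ E P) :
    divDeg D - (rrDim k D : ℤ) ≤ divDeg E - (rrDim k E : ℤ) := by
  have key : ∀ (n : ℕ) (F : FFPlace k L →₀ ℤ), (∀ P, 0 ≤ F P) → divDeg F = n →
      (rrDim k (D + F) : ℤ) ≤ rrDim k D + n := by
    intro n
    induction n with
    | zero =>
      intro F hF hF0
      have : F = 0 := by
        ext P
        by_contra hP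
        have hmem : P ∈ F.support := Finsupp.mem_support_iff.2 hP
        have h1 : F P ≤ ∑ Q ∈ F.support, F Q := Finset.single_le_sum (fun Q _ => hF Q) hmem
        have h2 : (∑ Q ∈ F.support, F Q) = 0 := hF0
        have h3 := hF P
        change F P ≠ 0 at hP
        lia
      simp [this]
    | succ n ih =>
      intro F hF hFn
      obtain ⟨P, hP⟩ : ∃ P, 0 < F P := by
        by_contra! hneg
        have h2 : (∑ Q ∈ F.support, F Q) = (n + 1 : ℕ) := hFn
        have h3 : (∑ Q ∈ F.support, F Q) ≤ 0 := Finset.sum_nonpos fun Q _ => hneg Q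
        lia
      have h1 := ih (F - Finsupp.single P 1) (fun Q => by
        rw [Finsupp.sub_apply, Finsupp.single_apply]
        split_ifs with hQ
        · subst hQ; lia
        · simpa using hF Q) (by rw [divDeg_sub, divDeg_single, hFn]; push_cast; ring)
      have h2 := rrDim_add_single_le (D + (F - Finsupp.single P 1)) P
      rw [add_assoc, sub_add_cancel] at h2
      push_cast
      lia
  have h1 := key (divDeg (E - D)).toNat (E - D)
    (fun P => by rw [Finsupp.sub_apply]; have := h P; lia)
    (by
      rw [Int.toNat_of_nonneg]
      exact Finset.sum_nonneg fun P _ => by rw [Finsupp.sub_apply]; have := h P; lia)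
  have h0 : 0 ≤ divDeg (E - D) :=
    Finset.sum_nonneg fun P _ => by rw [Finsupp.sub_apply]; have := h P; lia
  rw [add_sub_cancel, Int.toNat_of_nonneg h0, divDeg_sub] at h1
  lia

theorem divDeg_sub_rrDim_add {U : FFPlace k L →₀ ℤ} (hU : U ∈ principalDivisors k L)
    (D : FFPlace k L →₀ ℤ) :
    divDeg (D + U) - (rrDim k (D + U) : ℤ) = divDeg D - (rrDim k D : ℤ) := by
  obtain ⟨hdeg, u, hu, hord⟩ := hU
  rw [divDeg_add, hdeg, add_zero, rrDim_eq, rrDim_eq]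
  have hinj : Function.Injective (LinearMap.mulLeft k u) := fun a b h => mul_left_cancel₀ hu h
  have hmap : rrSpace D = (rrSpace (D + U)).map (LinearMap.mulLeft k u) := by
    ext f
    constructor
    · intro hf
      refine ⟨f / u, fun h P => ?_, mul_div_cancel₀ f hu⟩
      have hf0 : f ≠ 0 := (div_ne_zero_iff.1 h).1
      have := hf hf0 P
      rw [P.isDiscretePlace.ordAt_div hf0 hu, Finsupp.add_apply, hord]
      lia
    · rintro ⟨g, hg, rfl⟩ h P
      rw [LinearMap.mulLeft_apply] at h ⊢
      have hg0 := right_ne_zero_of_mul h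
      have := hg hg0 P
      rw [Finsupp.add_apply, hord] at this
      rw [P.isDiscretePlace.ordAt_mul hu hg0]
      lia
  rw [hmap, ← LinearEquiv.finrank_eq (Submodule.equivMapOfInjective _ hinj _)]

/-- Up to linear equivalence, every divisor is dominated by a multiple of the divisor of poles. -/
theorem divDeg_sub_rrDim_le [IsAlgClosed k] {D₀ : FFPlace k L →₀ ℤ}
    (hD₀ : divDeg D₀ = finrank (RatFunc k) L) (h₀ : ∀ P : FFPlace k L, D₀ P =
      if algebraMap (RatFunc k) L RatFunc.X ∈ P.1 then 0
      else -ordAt P.1 (algebraMap (RatFunc k) L RatFunc.X)) (D : FFPlace k L →₀ ℤ) :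
    ∃ m₀ : ℕ, ∀ m : ℕ, m₀ ≤ m →
      divDeg D - (rrDim k D : ℤ) ≤ divDeg ((m : ℤ) • D₀) - (rrDim k ((m : ℤ) • D₀) : ℤ) := by
  choose Z hZdeg hZ using exists_zeroDivisor (k := k) L
  have hprin (c : k) : D₀ - Z c ∈ principalDivisors k L := by
    refine ⟨by rw [divDeg_sub, hD₀, hZdeg, sub_self],
      (algebraMap (RatFunc k) L RatFunc.X - algebraMap k L c)⁻¹,
      inv_ne_zero (algebraMap_X_sub_ne_zero c), fun P => ?_⟩
    rw [P.isDiscretePlace.ordAt_inv (algebraMap_X_sub_ne_zero c), Finsupp.sub_apply, h₀, hZ]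
    split_ifs with hX
    · ring
    · rw [P.ordAt_X_sub hX]
      ring
  have hc (P : FFPlace k L) (hP : algebraMap (RatFunc k) L RatFunc.X ∈ P.1) :=
    P.exists_valuation_sub_lt hP
  choose! c hc using hc
  set D' := D + ∑ P ∈ D.support, (D P).natAbs • (D₀ - Z (c P)) with hD'
  have hE : divDeg D' - (rrDim k D' : ℤ) = divDeg D - (rrDim k D : ℤ) :=
    divDeg_sub_rrDim_add (sum_mem fun P _ => nsmul_mem (hprin _) _) D
  have hZ0 (c : k) (P : FFPlace k L) : 0 ≤ Z c P := by
    rw [hZ]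
    split_ifs with hX
    · exact (P.isDiscretePlace.ordAt_nonneg_iff (algebraMap_X_sub_ne_zero c)).2
        (sub_mem hX (P.2.1 c))
    · exact le_rfl
  have hfin (Q : FFPlace k L) (hQ : algebraMap (RatFunc k) L RatFunc.X ∈ Q.1) : D' Q ≤ 0 := by
    rw [hD', Finsupp.add_apply, Finsupp.finsetSum_apply]
    have hterm (P : FFPlace k L) : ((D P).natAbs • (D₀ - Z (c P))) Q =
        -(((D P).natAbs : ℤ) * Z (c P) Q) := by
      rw [Finsupp.smul_apply, Finsupp.sub_apply, h₀, if_pos hQ, nsmul_eq_mul]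
      ring
    simp only [hterm]
    by_cases hDQ : D Q = 0
    · rw [hDQ, zero_add]
      exact Finset.sum_nonpos fun P _ => by
        have := mul_nonneg (Nat.cast_nonneg (α := ℤ) (D P).natAbs) (hZ0 (c P) Q)
        lia
    · have h1 : -(((D Q).natAbs : ℤ) * Z (c Q) Q) ≤ -|D Q| := by
        have h2 : 1 ≤ Z (c Q) Q := by
          rw [hZ, if_pos hQ]
          exact (Q.isDiscretePlace.ordAt_pos_iff (algebraMap_X_sub_ne_zero _)).2 (hc Q hQ)
        rw [Int.natCast_natAbs]
        nlinarith [abs_nonneg (D Q)]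
      rw [← Finset.add_sum_erase _ _ (Finsupp.mem_support_iff.2 hDQ)]
      have h3 : ∑ P ∈ D.support.erase Q, -(((D P).natAbs : ℤ) * Z (c P) Q) ≤ 0 :=
        Finset.sum_nonpos fun P _ => by
          have := mul_nonneg (Nat.cast_nonneg (α := ℤ) (D P).natAbs) (hZ0 (c P) Q)
          lia
      have := le_abs_self (D Q)
      lia
  refine ⟨∑ P ∈ D'.support, (D' P).natAbs, fun m hm => ?_⟩
  rw [← hE]
  refine divDeg_sub_rrDim_mono fun P => ?_
  rw [Finsupp.smul_apply, h₀, smul_eq_mul]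
  split_ifs with hX
  · rw [mul_zero]
    exact hfin P hX
  · have h1 : D' P ≤ m := by
      by_cases hP : D' P = 0
      · rw [hP]
        exact Nat.cast_nonneg _
      · have := Finset.single_le_sum (f := fun P => (D' P).natAbs) (fun _ _ => Nat.zero_le _)
          (Finsupp.mem_support_iff.2 hP)
        change (D' P).natAbs ≤ _ at this
        lia
    have h2 : 1 ≤ -ordAt P.1 (algebraMap (RatFunc k) L RatFunc.X) := by
      have : ¬ 0 ≤ ordAt P.1 (algebraMap (RatFunc k) L RatFunc.X) := by
        rw [P.isDiscretePlace.ordAt_nonneg_iff algebraMap_X_ne_zero]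
        exact hX
      lia
    nlinarith [Nat.cast_nonneg (α := ℤ) m]

theorem mem_rrSpace_smul_poleDivisor {D₀ : FFPlace k L →₀ ℤ} (h₀ : ∀ P : FFPlace k L, D₀ P =
      if algebraMap (RatFunc k) L RatFunc.X ∈ P.1 then 0
      else -ordAt P.1 (algebraMap (RatFunc k) L RatFunc.X)) {m : ℕ} {f : L} :
    f ∈ rrSpace ((m : ℤ) • D₀) ↔ IsIntegral (finSubring k) f ∧
      IsIntegral (infSubring k) ((RatFunc.X ^ m : RatFunc k)⁻¹ • f) := by
  by_cases hf : f = 0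
  · subst hf
    rw [smul_zero]
    exact ⟨fun _ => ⟨isIntegral_zero, isIntegral_zero⟩, fun _ => Submodule.zero_mem _⟩
  have hX0 := algebraMap_X_ne_zero (k := k) (L := L)
  have hXm := pow_ne_zero m hX0
  rw [mem_rrSpace, isIntegral_finSubring_iff, isIntegral_infSubring_iff, imp_iff_right hf,
    ← forall_and]
  refine forall_congr' fun P => ?_
  rw [Algebra.smul_def, map_inv₀, map_pow, Finsupp.smul_apply, h₀,
    ← P.isDiscretePlace.ordAt_nonneg_iff (mul_ne_zero (inv_ne_zero hXm) hf),
    P.isDiscretePlace.ordAt_mul (inv_ne_zero hXm) hf, P.isDiscretePlace.ordAt_inv hXm,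
    P.isDiscretePlace.ordAt_pow hX0, ← P.isDiscretePlace.ordAt_nonneg_iff hf, smul_eq_mul]
  split_ifs with hX
  · simp [hX]
  · simp only [hX, not_false_eq_true, false_imp_iff, true_and, true_imp_iff]
    constructor <;> intro h <;> lia

end RiemannRochSpaces

section AdaptedBases

open Module

variable {k L : Type} [Field k] [Field L] [Algebra (RatFunc k) L]

theorem det_toMatrix_update_sum {K V ι : Type} [Field K] [AddCommGroup V] [Module K V]
    [Fintype ι] [DecidableEq ι]
    (e : Basis ι K V) (v : ι → V) (s : ι → K) (i : ι) :
    (e.toMatrix (Function.update v i (∑ j, s j • v j))).det = s i * (e.toMatrix v).det := by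
  rw [Basis.toMatrix_update, ← smul_eq_mul, ← Matrix.det_updateCol_sum]
  congr 2
  ext l
  simp [Basis.toMatrix_apply]

theorem intDegree_ratFunc_C_mul_X_zpow_mul {c : k} (hc : c ≠ 0) (n : ℤ) {f : RatFunc k}
    (hf : f ≠ 0) : (RatFunc.C c * RatFunc.X ^ n * f).intDegree = n + f.intDegree := by
  have hX : (RatFunc.X : RatFunc k) ≠ 0 := RatFunc.X_ne_zero
  have hC : RatFunc.C c ≠ 0 := by simpa using hc
  rw [RatFunc.intDegree_mul (mul_ne_zero hC (zpow_ne_zero _ hX)) hf,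
    RatFunc.intDegree_mul hC (zpow_ne_zero _ hX), RatFunc.intDegree_C, intDegree_X_zpow, zero_add]

/-- If a square matrix over `infSubring k` is singular modulo the maximal ideal, its columns
satisfy a nontrivial constant linear relation modulo the maximal ideal. -/
theorem exists_const_mulVec_mem {ι : Type} [Fintype ι] [DecidableEq ι] {M : Matrix ι ι (RatFunc k)}
    (hM : ∀ i j, M i j ∈ infSubring k) (hdet : M.det.intDegree < 0) :
    ∃ γ : ι → k, γ ≠ 0 ∧ ∀ i, RatFunc.X * ∑ j, RatFunc.C (γ j) * M i j ∈ infSubring k := by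
  let M' : Matrix ι ι (infSubring k) := fun i j => ⟨M i j, hM i j⟩
  have hM' : (M'.det : RatFunc k) = M.det := by
    rw [← Subring.subtype_apply, RingHom.map_det]
    rfl
  have h0 : (M'.map (IsLocalRing.residue (infSubring k))).det = 0 := by
    rw [← RingHom.mapMatrix_apply, ← RingHom.map_det, IsLocalRing.residue_eq_zero_iff,
      IsLocalRing.mem_maximalIdeal, mem_nonunits_iff, isUnit_infSubring_iff, hM']
    exact fun h => hdet.ne h.2
  obtain ⟨v, hv0, hv⟩ := Matrix.exists_mulVec_eq_zero_iff.2 h0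
  have hlift (i : ι) :
      ∃ c : k, IsLocalRing.residue (infSubring k) ⟨_, C_mem_infSubring c⟩ = v i := by
    obtain ⟨w, hw⟩ := IsLocalRing.residue_surjective (v i)
    obtain ⟨c, hc⟩ := exists_X_mul_sub_C_mem w.2
    refine ⟨c, ?_⟩
    rw [← hw, eq_comm, ← sub_eq_zero, ← map_sub, IsLocalRing.residue_eq_zero_iff,
      mem_maximalIdeal_infSubring]
    exact hc
  choose γ hγ using hlift
  refine ⟨γ, ?_, fun i => ?_⟩
  · rintro rfl
    apply hv0
    ext i
    rw [← hγ i, Pi.zero_apply]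
    exact (congrArg _ (Subtype.ext (map_zero _))).trans (map_zero _)
  · have h := congrFun hv i
    simp only [Matrix.mulVec, dotProduct, Matrix.map_apply, ← hγ, ← map_mul, ← map_sum,
      Pi.zero_apply, IsLocalRing.residue_eq_zero_iff, mem_maximalIdeal_infSubring] at h
    convert h using 2
    push_cast
    exact Finset.sum_congr rfl fun j _ => mul_comm _ _

variable {ι : Type} [Fintype ι] [DecidableEq ι]

/-- One reduction step towards an adapted basis. -/
theorem IsIntBasis.exists_reduction {b e : Basis ι (RatFunc k) L} (hb : IsIntBasis (finSubring k) b)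
    (he : IsIntBasis (infSubring k) e) {a : ι → ℤ}
    (ha : ∀ i, IsIntegral (infSubring k) ((RatFunc.X : RatFunc k) ^ (-a i) • b i))
    (h0 : (e.toMatrix fun i => (RatFunc.X : RatFunc k) ^ (-a i) • b i).det ≠ 0)
    (hneg : (e.toMatrix fun i => (RatFunc.X : RatFunc k) ^ (-a i) • b i).det.intDegree < 0) :
    ∃ (b' : Basis ι (RatFunc k) L) (a' : ι → ℤ), IsIntBasis (finSubring k) b' ∧
      (∀ i, IsIntegral (infSubring k) ((RatFunc.X : RatFunc k) ^ (-a' i) • b' i)) ∧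
      (e.toMatrix fun i => (RatFunc.X : RatFunc k) ^ (-a' i) • b' i).det ≠ 0 ∧
      (e.toMatrix fun i => (RatFunc.X : RatFunc k) ^ (-a' i) • b' i).det.intDegree =
        (e.toMatrix fun i => (RatFunc.X : RatFunc k) ^ (-a i) • b i).det.intDegree + 1 := by
  have hX : (RatFunc.X : RatFunc k) ≠ 0 := RatFunc.X_ne_zero
  set c : ι → L := fun i => (RatFunc.X : RatFunc k) ^ (-a i) • b i with hc
  obtain ⟨γ, hγ0, hγ⟩ := exists_const_mulVec_mem (he.toMatrix_mem ha) hneg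
  obtain ⟨i₀, hi₀, hmax⟩ := Finset.exists_max_image (Finset.univ.filter fun i => γ i ≠ 0) a (by
    obtain ⟨i, hi⟩ := Function.ne_iff.1 hγ0
    exact ⟨i, by simpa using hi⟩)
  simp only [Finset.mem_filter, Finset.mem_univ, true_and] at hi₀ hmax
  have hC : RatFunc.C (γ i₀) ≠ 0 := by simpa using hi₀
  set s : ι → RatFunc k := fun j => RatFunc.C (γ j) * RatFunc.X ^ (a i₀ - a j) with hs
  have hs₀ : s i₀ = RatFunc.C (γ i₀) := by simp [hs]
  have hsmem (j : ι) : s j ∈ finSubring k := by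
    by_cases hj : γ j = 0
    · simp [hs, hj]
    · obtain ⟨n, hn⟩ := Int.eq_ofNat_of_zero_le (sub_nonneg.2 (hmax j hj))
      simp only [hs, hn, zpow_natCast]
      exact mul_mem (C_mem_finSubring _) (pow_mem X_mem_finSubring n)
  have hdet := det_toMatrix_update_sum b b s i₀
  rw [b.toMatrix_self, Matrix.det_one, mul_one, hs₀] at hdet
  obtain ⟨b', hb'v, hb'⟩ := hb.of_det (v := Function.update b i₀ (∑ j, s j • b j))
    (fun i => by
      by_cases hi : i = i₀
      · subst hi
        rw [Function.update_self]
        refine IsIntegral.sum _ fun j _ => ?_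
        rw [Algebra.smul_def]
        exact (isIntegral_algebraMap_of_mem (hsmem j)).mul (hb.isIntegral j)
      · rw [Function.update_of_ne hi]
        exact hb.isIntegral i) (by rw [hdet]; exact hC) (by
          rw [hdet, ← map_inv₀]
          exact C_mem_finSubring _)
  have hc' : (fun i => (RatFunc.X : RatFunc k) ^ (-Function.update a i₀ (a i₀ - 1) i) • b' i) =
      Function.update c i₀ (∑ j, (RatFunc.X * RatFunc.C (γ j)) • c j) := by
    ext i
    by_cases hi : i = i₀
    · subst hi
      rw [hb'v, Function.update_self, Function.update_self, Function.update_self, Finset.smul_sum]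
      refine Finset.sum_congr rfl fun j _ => ?_
      rw [hc, smul_smul, smul_smul]
      congr 1
      simp only [hs]
      rw [mul_left_comm, ← zpow_add₀ hX, mul_comm RatFunc.X, mul_assoc, ← zpow_one_add₀ hX]
      congr 2
      ring
    · rw [hb'v, Function.update_of_ne hi, Function.update_of_ne hi, Function.update_of_ne hi]
  have hdet' := det_toMatrix_update_sum e c (fun j => RatFunc.X * RatFunc.C (γ j)) i₀
  rw [← hc'] at hdet'
  refine ⟨b', Function.update a i₀ (a i₀ - 1), hb', fun i => ?_, ?_, ?_⟩
  · have hi' := congrFun hc' i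
    rw [hi']
    by_cases hi : i = i₀
    · subst hi
      rw [Function.update_self, he]
      intro l
      convert hγ l using 1
      simp only [hc, map_sum, map_smul, Finsupp.coe_finsetSum, Finset.sum_apply, Finsupp.smul_apply,
        smul_eq_mul, Finset.mul_sum, mul_assoc, Basis.toMatrix_apply]
    · rw [Function.update_of_ne hi]
      exact ha i
  · rw [hdet']
    exact mul_ne_zero (mul_ne_zero hX hC) h0
  · rw [hdet', mul_comm RatFunc.X, ← zpow_one RatFunc.X,
      intDegree_ratFunc_C_mul_X_zpow_mul hi₀ 1 h0, add_comm]

/-- A basis of `L` adapted to both the finite and the infinite part of the projective line. -/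
theorem exists_adapted_basis (k L : Type) [Field k] [CharZero k] [Field L] [Algebra (RatFunc k) L]
    [FiniteDimensional (RatFunc k) L] :
    ∃ (b c : Basis (Fin (finrank (RatFunc k) L)) (RatFunc k) L)
      (a : Fin (finrank (RatFunc k) L) → ℤ),
      IsIntBasis (finSubring k) b ∧ IsIntBasis (infSubring k) c ∧
      ∀ i, c i = (RatFunc.X : RatFunc k) ^ (-a i) • b i := by
  have hX : (RatFunc.X : RatFunc k) ≠ 0 := RatFunc.X_ne_zero
  obtain ⟨b₀, hb₀⟩ := IsIntBasis.exists (L := L) (R := finSubring k)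
  obtain ⟨e, he⟩ := IsIntBasis.exists (L := L) (R := infSubring k)
  have hdeg (b : Basis (Fin (finrank (RatFunc k) L)) (RatFunc k) L)
      (a : Fin (finrank (RatFunc k) L) → ℤ)
      (ha : ∀ i, IsIntegral (infSubring k) ((RatFunc.X : RatFunc k) ^ (-a i) • b i)) :
      (e.toMatrix fun i => (RatFunc.X : RatFunc k) ^ (-a i) • b i).det.intDegree ≤ 0 :=
    mem_infSubring.1 (det_mem_subring (he.toMatrix_mem ha))
  have key : ∀ (m : ℕ) (b : Basis (Fin (finrank (RatFunc k) L)) (RatFunc k) L)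
      (a : Fin (finrank (RatFunc k) L) → ℤ), IsIntBasis (finSubring k) b →
      (∀ i, IsIntegral (infSubring k) ((RatFunc.X : RatFunc k) ^ (-a i) • b i)) →
      (e.toMatrix fun i => (RatFunc.X : RatFunc k) ^ (-a i) • b i).det ≠ 0 →
      (e.toMatrix fun i => (RatFunc.X : RatFunc k) ^ (-a i) • b i).det.intDegree = -m →
      ∃ (b c : Basis (Fin (finrank (RatFunc k) L)) (RatFunc k) L)
        (a : Fin (finrank (RatFunc k) L) → ℤ),
        IsIntBasis (finSubring k) b ∧ IsIntBasis (infSubring k) c ∧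
        ∀ i, c i = (RatFunc.X : RatFunc k) ^ (-a i) • b i := by
    intro m
    induction m with
    | zero =>
      intro b a hb ha h0 hm
      obtain ⟨c, hc, hc'⟩ := he.of_det ha h0 (by
        rw [mem_infSubring, RatFunc.intDegree_inv, hm]
        simp)
      exact ⟨b, c, a, hb, hc', fun i => congrFun hc i⟩
    | succ m ih =>
      intro b a hb ha h0 hm
      obtain ⟨b', a', hb', ha', h0', hm'⟩ := hb.exists_reduction he ha h0 (by rw [hm]; lia)
      refine ih b' a' hb' ha' h0' ?_
      rw [hm', hm]
      push_cast
      ring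
  have hexp (i : Fin (finrank (RatFunc k) L)) : ∃ a : ℤ,
      IsIntegral (infSubring k) ((RatFunc.X : RatFunc k) ^ (-a) • b₀ i) := by
    obtain ⟨A, hA⟩ := (Set.finite_range fun j => (e.repr (b₀ i) j).intDegree).bddAbove
    refine ⟨A, (he _).2 fun j => ?_⟩
    rw [map_smul, Finsupp.smul_apply, smul_eq_mul]
    by_cases hj : e.repr (b₀ i) j = 0
    · rw [hj, mul_zero]
      exact zero_mem _
    · rw [mem_infSubring, RatFunc.intDegree_mul (zpow_ne_zero _ hX) hj, intDegree_X_zpow]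
      exact neg_add_nonpos_iff.2 (hA (Set.mem_range_self j))
  choose a ha using hexp
  have h0 : (e.toMatrix fun i => (RatFunc.X : RatFunc k) ^ (-a i) • b₀ i).det ≠ 0 := by
    let c := b₀.isUnitSMul (w := fun i => (RatFunc.X : RatFunc k) ^ (-a i))
      fun i => (zpow_ne_zero _ hX).isUnit
    have hc : ⇑c = fun i => (RatFunc.X : RatFunc k) ^ (-a i) • b₀ i :=
      funext fun i => b₀.isUnitSMul_apply _ i
    have h1 := (e.isUnit_det c).ne_zero
    rwa [e.det_apply, hc] at h1
  refine key (-(e.toMatrix fun i => (RatFunc.X : RatFunc k) ^ (-a i) • b₀ i).det.intDegree).toNat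
    b₀ a hb₀ ha h0 ?_
  have := hdeg b₀ a ha
  lia

end AdaptedBases

section GenusFormula

open Module

variable {k L : Type} [Field k] [CharZero k] [Field L] [Algebra (RatFunc k) L] [Algebra k L]
  [IsScalarTower k (RatFunc k) L] [FiniteDimensional (RatFunc k) L]

omit [CharZero k] in
theorem X_zpow_neg_mul_mem_infSubring_iff {p : Polynomial k} {n : ℤ} :
    (RatFunc.X : RatFunc k) ^ (-n) * algebraMap (Polynomial k) (RatFunc k) p ∈ infSubring k ↔
      p ∈ Polynomial.degreeLT k (n + 1).toNat := by
  by_cases hp : p = 0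
  · subst hp
    simp [zero_mem]
  · rw [mem_infSubring, RatFunc.intDegree_mul (zpow_ne_zero _ RatFunc.X_ne_zero)
      (RatFunc.algebraMap_ne_zero hp), intDegree_X_zpow, RatFunc.intDegree_polynomial,
      Polynomial.mem_degreeLT, Polynomial.degree_eq_natDegree hp, Nat.cast_lt]
    lia

theorem rrDim_smul_poleDivisor {D₀ : FFPlace k L →₀ ℤ} (h₀ : ∀ P : FFPlace k L, D₀ P =
      if algebraMap (RatFunc k) L RatFunc.X ∈ P.1 then 0
      else -ordAt P.1 (algebraMap (RatFunc k) L RatFunc.X)) {ι : Type} [Fintype ι]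
    {b c : Basis ι (RatFunc k) L} {a : ι → ℤ} (hb : IsIntBasis (finSubring k) b)
    (hc : IsIntBasis (infSubring k) c) (h : ∀ i, c i = (RatFunc.X : RatFunc k) ^ (-a i) • b i)
    (m : ℕ) : rrDim k ((m : ℤ) • D₀) = ∑ i, (m - a i + 1).toNat := by
  have hX : (RatFunc.X : RatFunc k) ≠ 0 := RatFunc.X_ne_zero
  let φ : ((i : ι) → Polynomial.degreeLT k (m - a i + 1).toNat) →ₗ[k] L :=
    { toFun := fun p => ∑ i, algebraMap (Polynomial k) (RatFunc k) (p i) • b i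
      map_add' := fun p q => by
        simp only [Pi.add_apply, Submodule.coe_add, map_add, add_smul, Finset.sum_add_distrib]
      map_smul' := fun t p => by
        simp only [Pi.smul_apply, Submodule.coe_smul, RingHom.id_apply, Finset.smul_sum]
        refine Finset.sum_congr rfl fun i _ => ?_
        rw [Polynomial.smul_eq_C_mul, map_mul, RatFunc.algebraMap_C, mul_smul, Algebra.smul_def t,
          ← algebraMap_ratFunc_C t, ← Algebra.smul_def] }
  have hrepr (p) (i : ι) : b.repr (φ p) i = algebraMap (Polynomial k) (RatFunc k) (p i) :=
    congrFun (b.repr_sum_self fun i => algebraMap (Polynomial k) (RatFunc k) (p i)) i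
  have hinj : Function.Injective φ := fun p q hpq => by
    ext1 i
    apply Subtype.ext
    apply RatFunc.algebraMap_injective k
    rw [← hrepr, ← hrepr, hpq]
  have hcrepr (f : L) (i : ι) : c.repr ((RatFunc.X ^ m : RatFunc k)⁻¹ • f) i =
      RatFunc.X ^ (-(m - a i) : ℤ) * b.repr f i := by
    have h1 : b.repr f i = RatFunc.X ^ (-a i) * c.repr f i := by
      have h2 : f = ∑ j, (c.repr f j * RatFunc.X ^ (-a j)) • b j := by
        conv_lhs => rw [← c.sum_repr f]
        exact Finset.sum_congr rfl fun j _ => by rw [h, smul_smul]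
      conv_lhs => rw [h2]
      rw [b.repr_sum_self, mul_comm]
    rw [map_smul, Finsupp.smul_apply, smul_eq_mul, h1, ← mul_assoc, ← zpow_add₀ hX, ← zpow_natCast,
      ← zpow_neg]
    congr 2
    ring
  have hrange : LinearMap.range φ = rrSpace ((m : ℤ) • D₀) := by
    ext f
    rw [mem_rrSpace_smul_poleDivisor h₀, hb, hc]
    simp only [hcrepr]
    constructor
    · rintro ⟨p, rfl⟩
      refine ⟨fun i => ?_, fun i => ?_⟩
      · rw [hrepr]
        exact algebraMap_mem_finSubring _
      · rw [hrepr, X_zpow_neg_mul_mem_infSubring_iff]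
        exact (p i).2
    · rintro ⟨h1, h2⟩
      choose p hp using h1
      simp only [← hp, X_zpow_neg_mul_mem_infSubring_iff] at h2
      refine ⟨fun i => ⟨p i, h2 i⟩, ?_⟩
      change ∑ i, algebraMap (Polynomial k) (RatFunc k) (p i) • b i = f
      simp only [hp, b.sum_repr]
  rw [rrDim_eq, ← hrange, LinearMap.finrank_range_of_inj hinj]
  have (i : ι) : Module.Finite k (Polynomial.degreeLT k (m - a i + 1).toNat) :=
    Module.Finite.equiv (Polynomial.degreeLTEquiv k _).symm
  rw [finrank_pi_fintype]
  refine Finset.sum_congr rfl fun i _ => ?_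
  rw [(Polynomial.degreeLTEquiv k _).finrank_eq, finrank_fin_fun]

theorem ffGenus_eq_of_adapted_basis [IsAlgClosed k] {ι : Type} [Fintype ι]
    {b c : Basis ι (RatFunc k) L} {a : ι → ℤ} (hb : IsIntBasis (finSubring k) b)
    (hc : IsIntBasis (infSubring k) c) (h : ∀ i, c i = (RatFunc.X : RatFunc k) ^ (-a i) • b i) :
    ffGenus k L = (1 + (∑ i, a i - finrank (RatFunc k) L)).toNat ∧
      -(rrDim k (0 : FFPlace k L →₀ ℤ) : ℤ) ≤ ∑ i, a i - finrank (RatFunc k) L := by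
  obtain ⟨D₀, hdeg, h₀⟩ := exists_poleDivisor k L
  have hval (m : ℕ) (hm : ∀ i, a i ≤ m) :
      divDeg ((m : ℤ) • D₀) - (rrDim k ((m : ℤ) • D₀) : ℤ) = ∑ i, a i - finrank (RatFunc k) L := by
    rw [rrDim_smul_poleDivisor h₀ hb hc h, divDeg_smul, hdeg, finrank_eq_card_basis b]
    push_cast
    have (i : ι) : ((m - a i + 1).toNat : ℤ) = m - a i + 1 :=
      Int.toNat_of_nonneg (by have := hm i; lia)
    simp only [this, Finset.sum_add_distrib, Finset.sum_sub_distrib, Finset.sum_const,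
      Finset.card_univ, nsmul_eq_mul]
    ring
  obtain ⟨A, hA⟩ := (Set.finite_range a).bddAbove
  have hA' (m : ℕ) (hm : A.toNat ≤ m) (i : ι) : a i ≤ m := by
    have := hA (Set.mem_range_self i)
    lia
  have hle (D : FFPlace k L →₀ ℤ) :
      divDeg D - (rrDim k D : ℤ) ≤ ∑ i, a i - finrank (RatFunc k) L := by
    obtain ⟨m₀, hm₀⟩ := divDeg_sub_rrDim_le hdeg h₀ D
    exact (hm₀ _ (le_max_left m₀ A.toNat)).trans (hval _ (hA' _ (le_max_right _ _))).le
  constructor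
  · unfold ffGenus
    congr 2
    refine IsGreatest.csSup_eq ⟨⟨_, (hval _ (hA' _ le_rfl)).symm⟩, ?_⟩
    rintro _ ⟨D, rfl⟩
    exact hle D
  · simpa [divDeg] using hle 0

omit [CharZero k] in
/-- Functions without poles are constant. -/
theorem exists_algebraMap_eq_of_isIntegral [IsAlgClosed k] {f : L}
    (hfin : IsIntegral (finSubring k) f) (hinf : IsIntegral (infSubring k) f) :
    ∃ c : k, algebraMap k L c = f := by
  have hcoeff (i : ℕ) : (minpoly (RatFunc k) f).coeff i ∈ (RatFunc.C (K := k)).range := by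
    obtain ⟨c, hc⟩ := exists_eq_C_of_mem (f := (minpoly (RatFunc k) f).coeff i) (by
      rw [minpoly.isIntegrallyClosed_eq_field_fractions' (RatFunc k) hfin, Polynomial.coeff_map]
      exact Subtype.property _) (by
      rw [minpoly.isIntegrallyClosed_eq_field_fractions' (RatFunc k) hinf, Polynomial.coeff_map]
      exact Subtype.property _)
    exact ⟨c, hc.symm⟩
  obtain ⟨q, hq⟩ := (Polynomial.lifts_iff_coeff_lifts _).2 hcoeff
  have hC : (algebraMap (RatFunc k) L).comp RatFunc.C = algebraMap k L :=
    RingHom.ext algebraMap_ratFunc_C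
  have hf : Polynomial.eval₂ (algebraMap k L) f q = 0 := by
    rw [← hC, ← Polynomial.eval₂_map]
    change Polynomial.eval₂ _ f (Polynomial.mapRingHom RatFunc.C q) = 0
    rw [hq]
    exact minpoly.aeval _ _
  have hq0 : q ≠ 0 := by
    rintro rfl
    rw [map_zero] at hq
    exact minpoly.ne_zero (IsIntegral.of_finite (RatFunc k) f) hq.symm
  have halg : IsIntegral k f := isAlgebraic_iff_isIntegral.1 ⟨q, hq0, hf⟩
  exact minpoly.mem_range_of_degree_eq_one k f
    (IsAlgClosed.degree_eq_one_of_irreducible k (minpoly.irreducible halg))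

theorem rrDim_zero_le_one [IsAlgClosed k] : rrDim k (0 : FFPlace k L →₀ ℤ) ≤ 1 := by
  obtain ⟨D₀, -, h₀⟩ := exists_poleDivisor k L
  have h (f : L) : f ∈ rrSpace (0 : FFPlace k L →₀ ℤ) ↔
      IsIntegral (finSubring k) f ∧ IsIntegral (infSubring k) f := by
    simpa using mem_rrSpace_smul_poleDivisor h₀ (m := 0) (f := f)
  rw [rrDim_eq, ← finrank_self k]
  have hle : rrSpace (0 : FFPlace k L →₀ ℤ) ≤ LinearMap.range (Algebra.linearMap k L) :=
    fun f hf => exists_algebraMap_eq_of_isIntegral ((h f).1 hf).1 ((h f).1 hf).2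
  exact (Submodule.finrank_mono hle).trans (LinearMap.finrank_range_le _)

omit [Algebra k L] [IsScalarTower k (RatFunc k) L] in
theorem intDegree_discr_eq_of_isIntBasis {R : Subring (RatFunc k)}
    (hR : ∀ r ∈ R, r⁻¹ ∈ R → r.intDegree = 0)
    {ι κ : Type} [Fintype ι] [DecidableEq ι] [Fintype κ] [DecidableEq κ]
    {b : Basis ι (RatFunc k) L} {c : Basis κ (RatFunc k) L} (hb : IsIntBasis R b)
    (hc : IsIntBasis R c) : (Algebra.discr (RatFunc k) b).intDegree =
      (Algebra.discr (RatFunc k) c).intDegree := by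
  obtain ⟨r, hr, h⟩ := hb.discr_dvd' hc.isIntegral
  obtain ⟨s, hs, h'⟩ := hc.discr_dvd' hb.isIntegral
  have hb0 := Algebra.discr_not_zero_of_basis (RatFunc k) b
  have hsr : s * r = 1 := by
    rw [h, ← mul_assoc] at h'
    exact mul_right_cancel₀ hb0 (h'.symm.trans (one_mul _).symm)
  have hr0 : r ≠ 0 := right_ne_zero_of_mul_eq_one hsr
  rw [h, RatFunc.intDegree_mul hr0 hb0, hR r hr (by rwa [← eq_inv_of_mul_eq_one_left hsr]),
    zero_add]

omit [CharZero k] in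
theorem intDegree_eq_zero_of_mem_finSubring {r : RatFunc k} (hr : r ∈ finSubring k)
    (hr' : r⁻¹ ∈ finSubring k) : r.intDegree = 0 := by
  have h1 := intDegree_nonneg_of_mem_finSubring hr
  have h2 := intDegree_nonneg_of_mem_finSubring hr'
  rw [RatFunc.intDegree_inv] at h2
  lia

omit [CharZero k] in
theorem intDegree_eq_zero_of_mem_infSubring {r : RatFunc k} (hr : r ∈ infSubring k)
    (hr' : r⁻¹ ∈ infSubring k) : r.intDegree = 0 := by
  rw [mem_infSubring] at hr hr'
  rw [RatFunc.intDegree_inv] at hr'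
  lia

/-- The Riemann–Hurwitz formula for `L` over `RatFunc k`, in terms of discriminants. -/
theorem two_mul_ffGenus_sub_two [IsAlgClosed k] {ι κ : Type} [Fintype ι] [DecidableEq ι] [Fintype κ]
    [DecidableEq κ] {b : Basis ι (RatFunc k) L} {c : Basis κ (RatFunc k) L}
    (hb : IsIntBasis (finSubring k) b) (hc : IsIntBasis (infSubring k) c) :
    2 * (ffGenus k L : ℤ) - 2 = -2 * finrank (RatFunc k) L +
      (Algebra.discr (RatFunc k) b).intDegree - (Algebra.discr (RatFunc k) c).intDegree := by
  obtain ⟨b', c', a, hb', hc', h⟩ := exists_adapted_basis k L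
  obtain ⟨hg, hge⟩ := ffGenus_eq_of_adapted_basis hb' hc' h
  have h1 := rrDim_zero_le_one (k := k) (L := L)
  have hdiscr : Algebra.discr (RatFunc k) c' =
      RatFunc.X ^ (-(2 * ∑ i, a i)) * Algebra.discr (RatFunc k) b' := by
    have hdiag : ⇑c' = Matrix.vecMul b' ((Matrix.diagonal fun i =>
        (RatFunc.X : RatFunc k) ^ (-a i)).map (algebraMap (RatFunc k) L)) := by
      ext i
      rw [h, Matrix.diagonal_map (map_zero _), Matrix.vecMul_diagonal, Algebra.smul_def, mul_comm]
    have hprod : ∏ i, (RatFunc.X : RatFunc k) ^ (-a i) = RatFunc.X ^ (-∑ i, a i) := by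
      rw [← Finset.sum_neg_distrib]
      induction (Finset.univ : Finset (Fin (finrank (RatFunc k) L))) using Finset.induction_on with
      | empty => simp
      | insert i s hi ih =>
        rw [Finset.prod_insert hi, Finset.sum_insert hi, zpow_add₀ RatFunc.X_ne_zero, ih]
    rw [hdiag, Algebra.discr_of_matrix_vecMul, Matrix.det_diagonal, hprod, ← zpow_natCast,
      ← zpow_mul]
    congr 2
    push_cast
    ring
  rw [intDegree_discr_eq_of_isIntBasis (fun _ => intDegree_eq_zero_of_mem_finSubring) hb hb',
    intDegree_discr_eq_of_isIntBasis (fun _ => intDegree_eq_zero_of_mem_infSubring) hc hc', hdiscr,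
    RatFunc.intDegree_mul (zpow_ne_zero _ RatFunc.X_ne_zero)
      (Algebra.discr_not_zero_of_basis (RatFunc k) b'), intDegree_X_zpow, hg,
    Int.toNat_of_nonneg (by lia)]
  ring

end GenusFormula

section UnramifiedAtInfinity

open Module Polynomial

variable {k : Type} [Field k]

/-- A constant as an element of the local ring at infinity. -/
def constInf (c : k) : infSubring k := ⟨RatFunc.C c, C_mem_infSubring c⟩

theorem residue_constInf_injective :
    Function.Injective fun c : k => IsLocalRing.residue (infSubring k) (constInf c) := by
  intro c d h
  let φ : k →+* infSubring k :=
    RingHom.codRestrict (RatFunc.C (K := k)) (infSubring k) fun c => C_mem_infSubring c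
  exact ((IsLocalRing.residue (infSubring k)).comp φ).injective h

section Places

variable {L : Type} [Field L] [Algebra (RatFunc k) L] [Algebra k L] [IsScalarTower k (RatFunc k) L]

theorem FFPlace.residue_eq_zero_of_valuation_lt_one (P : FFPlace k L)
    (hX : algebraMap (RatFunc k) L RatFunc.X ∉ P.1) {r : infSubring k}
    (h : P.1.valuation (algebraMap (RatFunc k) L r) < 1) :
    IsLocalRing.residue (infSubring k) r = 0 := by
  rw [IsLocalRing.residue_eq_zero_iff, IsLocalRing.mem_maximalIdeal, mem_nonunits_iff]
  rintro ⟨u, rfl⟩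
  have h1 := (P.1.valuation_le_one_iff _).2
    (P.algebraMap_mem_of_inf hX _ ((u⁻¹ : (infSubring k)ˣ) : infSubring k).2)
  have h2 := mul_lt_one_of_lt_of_le h h1
  rw [← map_mul, ← map_mul, ← Subring.coe_mul, Units.mul_inv, Subring.coe_one, map_one,
    map_one] at h2
  exact h2.false

theorem FFPlace.valuation_aeval_sub_lt_one (P : FFPlace k L)
    (hX : algebraMap (RatFunc k) L RatFunc.X ∉ P.1) (f : (infSubring k)[X]) {x : L} {c : k}
    (h : P.1.valuation (x - algebraMap k L c) < 1) :
    P.1.valuation (aeval x f -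
      algebraMap (RatFunc k) L ((f.eval (constInf c) : infSubring k) : RatFunc k)) < 1 := by
  let φ : infSubring k →+* P.1 := RingHom.codRestrict
    ((algebraMap (RatFunc k) L).comp (infSubring k).subtype) P.1
    fun r => P.algebraMap_mem_of_inf hX r r.2
  have hx : x ∈ P.1 := by
    rw [← sub_add_cancel x (algebraMap k L c)]
    exact add_mem ((P.1.valuation_le_one_iff _).1 h.le) (P.2.1 c)
  have h1 : (aeval x f : L) = ((eval₂ φ ⟨x, hx⟩ f : P.1) : L) := by
    rw [aeval_def, ← P.1.subtype_apply, hom_eval₂]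
    rfl
  have h2 : algebraMap (RatFunc k) L ((f.eval (constInf c) : infSubring k) : RatFunc k) =
      ((eval₂ φ ⟨algebraMap k L c, P.2.1 c⟩ f : P.1) : L) := by
    have h3 : (⟨algebraMap k L c, P.2.1 c⟩ : P.1) = φ (constInf c) :=
      Subtype.ext (algebraMap_ratFunc_C c).symm
    rw [h3, eval₂_at_apply]
    rfl
  rw [h1, h2, ← P.1.coe_sub, ← ValuationSubring.valuation_lt_one_iff, ← eval_map, ← eval_map]
  refine Ideal.mem_of_dvd _ (sub_dvd_eval_sub _ _ _) ?_
  rw [ValuationSubring.valuation_lt_one_iff]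
  exact h

variable [CharZero k] [FiniteDimensional (RatFunc k) L] [IsAlgClosed k]

theorem valuation_aeval_derivative_eq_one (P : FFPlace k L)
    (hX : algebraMap (RatFunc k) L RatFunc.X ∉ P.1) {f : (infSubring k)[X]} (hf : f.Monic)
    (hsep : (f.map (IsLocalRing.residue (infSubring k))).Separable) {x : L} (hx : aeval x f = 0) :
    P.1.valuation (aeval x (derivative f)) = 1 := by
  have hxP : x ∈ P.1 := mem_of_isIntegral_of_subring_le (P.algebraMap_mem_of_inf hX) ⟨f, hf, hx⟩
  obtain ⟨c, hc⟩ := P.exists_valuation_sub_lt hxP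
  have h1 := P.valuation_aeval_sub_lt_one hX f hc
  rw [hx, zero_sub, Valuation.map_neg] at h1
  have h2 := P.residue_eq_zero_of_valuation_lt_one hX h1
  have h3 := hsep.eval₂_derivative_ne_zero (RingHom.id _)
    (x := IsLocalRing.residue _ (constInf c)) (by
      rw [eval₂_id, eval_map, eval₂_at_apply, h2])
  rw [eval₂_id, derivative_map, eval_map, eval₂_at_apply] at h3
  have h4 := P.valuation_aeval_sub_lt_one hX (derivative f) hc
  have h5 : P.1.valuation (algebraMap (RatFunc k) L
      (((derivative f).eval (constInf c) : infSubring k) : RatFunc k)) = 1 :=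
    le_antisymm ((P.1.valuation_le_one_iff _).2 (P.algebraMap_mem_of_inf hX _ (Subtype.property _)))
      (not_lt.1 fun h => h3 (P.residue_eq_zero_of_valuation_lt_one hX h))
  rw [← h5]
  refine (Valuation.map_eq_of_sub_lt _ ?_)
  rwa [h5]

/-- The derivative of a polynomial with separable reduction is invertible at its roots. -/
theorem isIntegral_inv_aeval_derivative {f : (infSubring k)[X]} (hf : f.Monic)
    (hsep : (f.map (IsLocalRing.residue (infSubring k))).Separable) {x : L} (hx : aeval x f = 0) :
    IsIntegral (infSubring k) (aeval x (derivative f))⁻¹ := by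
  rw [isIntegral_infSubring_iff]
  intro P hX
  rw [← P.1.valuation_le_one_iff, map_inv₀, valuation_aeval_derivative_eq_one P hX hf hsep hx,
    inv_one]

/-- If `L` is unramified over infinity, it is generated by an integral element whose minimal
polynomial has separable reduction at infinity. -/
theorem exists_separable_generator (hunr : ∀ P : FFPlace k L,
      algebraMap (RatFunc k) L RatFunc.X ∉ P.1 →
      ordAt P.1 (algebraMap (RatFunc k) L RatFunc.X) = -1) :
    ∃ θ : L, IsIntegral (infSubring k) θ ∧
      (minpoly (infSubring k) θ).natDegree = finrank (RatFunc k) L ∧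
      ((minpoly (infSubring k) θ).map (IsLocalRing.residue (infSubring k))).Separable := by
  obtain ⟨D, hD, h⟩ := exists_poleDivisor k L
  have hsupp (P : FFPlace k L) : P ∈ D.support ↔ algebraMap (RatFunc k) L RatFunc.X ∉ P.1 := by
    rw [Finsupp.mem_support_iff, h]
    split_ifs with hX
    · simp [hX]
    · simp [hX, hunr P hX]
  have hcard : Fintype.card D.support = finrank (RatFunc k) L := by
    rw [Fintype.card_coe, ← Nat.cast_inj (R := ℤ), ← hD, divDeg, Finsupp.sum,
      Finset.card_eq_sum_ones]
    push_cast
    refine Finset.sum_congr rfl fun P hP => ?_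
    rw [hsupp] at hP
    rw [h, if_neg hP, hunr P hP, neg_neg]
  obtain ⟨b, hb⟩ := IsIntBasis.exists (L := L) (R := infSubring k)
  have hmem (P : D.support) {x : L} (hx : IsIntegral (infSubring k) x) : x ∈ P.1.1 :=
    isIntegral_infSubring_iff.1 hx P.1 ((hsupp _).1 P.2)
  have hres (P : D.support) (i : Fin (finrank (RatFunc k) L)) :
      ∃ c : k, P.1.1.valuation (b i - algebraMap k L c) < 1 :=
    P.1.exists_valuation_sub_lt (hmem P (hb.isIntegral i))
  choose c hc using hres
  let Φ : (Fin (finrank (RatFunc k) L) → k) →ₗ[k] (D.support → k) :=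
    { toFun := fun γ P => ∑ i, γ i * c P i
      map_add' := fun γ δ => by
        ext P
        simp only [Pi.add_apply, add_mul, Finset.sum_add_distrib]
      map_smul' := fun t γ => by
        ext P
        simp only [Pi.smul_apply, smul_eq_mul, mul_assoc, Finset.mul_sum, RingHom.id_apply] }
  have hΦ (γ) (P : D.support) :
      P.1.1.valuation (∑ i, RatFunc.C (γ i) • b i - algebraMap k L (Φ γ P)) < 1 := by
    have h1 : ∑ i, RatFunc.C (γ i) • b i - algebraMap k L (Φ γ P) =
        ∑ i, algebraMap k L (γ i) * (b i - algebraMap k L (c P i)) := by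
      change _ - algebraMap k L (∑ i, γ i * c P i) = _
      simp only [map_sum, map_mul, mul_sub, Finset.sum_sub_distrib, Algebra.smul_def,
        algebraMap_ratFunc_C]
    rw [h1]
    refine Valuation.map_sum_lt _ one_ne_zero fun i _ => ?_
    rw [map_mul]
    exact (mul_le_of_le_one_left' ((P.1.1.valuation_le_one_iff _).2 (P.1.2.1 _))).trans_lt (hc P i)
  have hinj : Function.Injective Φ := by
    rw [← LinearMap.ker_eq_bot, LinearMap.ker_eq_bot']
    intro γ hγ
    have hint :
        IsIntegral (infSubring k) ((RatFunc.X : RatFunc k) • ∑ i, RatFunc.C (γ i) • b i) := by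
      rw [isIntegral_infSubring_iff]
      intro P hX
      have h1 := hΦ γ ⟨P, (hsupp P).2 hX⟩
      rw [hγ, Pi.zero_apply, map_zero, sub_zero] at h1
      by_cases h0 : ∑ i, RatFunc.C (γ i) • b i = 0
      · rw [h0, smul_zero]
        exact zero_mem _
      · rw [Algebra.smul_def,
          ← P.isDiscretePlace.ordAt_nonneg_iff (mul_ne_zero algebraMap_X_ne_zero h0),
          P.isDiscretePlace.ordAt_mul algebraMap_X_ne_zero h0, hunr P hX]
        have := (P.isDiscretePlace.ordAt_pos_iff h0).2 h1
        lia
    ext i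
    have h2 := (hb _).1 hint i
    rw [map_smul, Finsupp.smul_apply, b.repr_sum_self, smul_eq_mul] at h2
    by_contra h0
    have h3 := intDegree_ratFunc_C_mul_X_zpow_mul (c := γ i) h0 1 one_ne_zero
    rw [mul_one, zpow_one, mul_comm, RatFunc.intDegree_one] at h3
    rw [mem_infSubring] at h2
    lia
  have hsurj := (LinearMap.injective_iff_surjective_of_finrank_eq_finrank (by
    rw [finrank_fin_fun, finrank_fintype_fun_eq_card, hcard])).1 hinj
  let t : D.support ↪ k :=
    (Fintype.equivFin _).toEmbedding.trans (Fin.valEmbedding.trans Nat.castEmbedding)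
  obtain ⟨γ, hγ⟩ := hsurj t
  set θ := ∑ i, RatFunc.C (γ i) • b i with hθ
  have hθint : IsIntegral (infSubring k) θ := by
    rw [hb]
    intro i
    rw [b.repr_sum_self]
    exact C_mem_infSubring _
  set f := minpoly (infSubring k) θ with hf
  have hmonic : f.Monic := minpoly.monic hθint
  set fbar := f.map (IsLocalRing.residue (infSubring k)) with hfbar
  have hroot (P : D.support) : fbar.IsRoot (IsLocalRing.residue _ (constInf (t P))) := by
    have h1 := P.1.valuation_aeval_sub_lt_one ((hsupp _).1 P.2) f (hΦ γ P)
    rw [minpoly.aeval, zero_sub, Valuation.map_neg, hγ] at h1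
    rw [IsRoot.def, eval_map, eval₂_at_apply]
    exact P.1.residue_eq_zero_of_valuation_lt_one ((hsupp _).1 P.2) h1
  let e : D.support ↪ IsLocalRing.ResidueField (infSubring k) :=
    t.trans ⟨_, residue_constInf_injective⟩
  have hdvd : ∏ P, (X - C (e P)) ∣ fbar :=
    Finset.prod_dvd_of_coprime (fun P _ Q _ hPQ => pairwise_coprime_X_sub_C e.injective hPQ)
      fun P _ => dvd_iff_isRoot.2 (hroot P)
  have hbar : fbar.Monic := hmonic.map _
  have hdegprod : (∏ P, (X - C (e P))).natDegree = finrank (RatFunc k) L := by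
    rw [natDegree_prod_of_monic _ _ fun P _ => monic_X_sub_C _]
    simp only [natDegree_X_sub_C, Finset.sum_const, Finset.card_univ, hcard, smul_eq_mul, mul_one]
  have hle : f.natDegree ≤ finrank (RatFunc k) L := by
    have h1 := minpoly.natDegree_le (A := RatFunc k) θ
    rwa [minpoly.isIntegrallyClosed_eq_field_fractions' (RatFunc k) hθint,
      (minpoly.monic hθint).natDegree_map] at h1
  have hge := natDegree_le_of_dvd hdvd hbar.ne_zero
  have hnat : fbar.natDegree = f.natDegree := hmonic.natDegree_map _
  refine ⟨θ, hθint, by lia, ?_⟩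
  have heq : fbar = ∏ P, (X - C (e P)) :=
    eq_of_monic_of_dvd_of_natDegree_le
      (monic_prod_of_monic _ (fun P => X - C (e P)) fun P _ => monic_X_sub_C _) hbar hdvd (by lia)
  change fbar.Separable
  rw [heq, separable_prod_X_sub_C_iff]
  exact e.injective

end Places

end UnramifiedAtInfinity

section UnitDiscriminant

open Module Polynomial

variable {F L : Type} [Field F] [Field L] [Algebra F L] {S : Subring F}

theorem repr_mem_of_trace_mem [CharZero F] [FiniteDimensional F L] {ι : Type} [Fintype ι]
    [DecidableEq ι] {v : Basis ι F L} (hv : ∀ i j, Algebra.trace F L (v i * v j) ∈ S)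
    (hd : (Algebra.discr F v)⁻¹ ∈ S) {x : L} (hx : ∀ j, Algebra.trace F L (x * v j) ∈ S) (i : ι) :
    v.repr x i ∈ S := by
  have h0 : (Algebra.traceMatrix F v).det ≠ 0 := by
    rw [← Algebra.discr_def]
    exact Algebra.discr_not_zero_of_basis F v
  have h1 := congrArg ((Algebra.traceMatrix F v)⁻¹).mulVec (Algebra.traceMatrix_of_basis_mulVec v x)
  rw [Matrix.mulVec_mulVec, Matrix.nonsing_inv_mul _ h0.isUnit, Matrix.one_mulVec] at h1
  have h2 := congrFun h1 i
  rw [v.equivFun_apply] at h2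
  rw [h2, Matrix.inv_def, Ring.inverse_eq_inv', ← Algebra.discr_def]
  refine S.sum_mem fun j _ => S.mul_mem (?_ : (_ • _ : Matrix ι ι F) i j ∈ S) (hx j)
  rw [Matrix.smul_apply, smul_eq_mul]
  exact S.mul_mem hd (adjugate_mem_subring hv i j)

theorem trace_mem_subring [FiniteDimensional F L] [IsIntegrallyClosed S] [IsFractionRing S F]
    {x : L} (hx : IsIntegral S x) : Algebra.trace F L x ∈ S :=
  mem_of_isIntegral_subring (Algebra.isIntegral_trace hx)

/-- A basis consisting of integral elements with invertible discriminant is an integral basis. -/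
theorem IsIntBasis.of_inv_discr_mem [CharZero F] [FiniteDimensional F L] [IsIntegrallyClosed S]
    [IsFractionRing S F] {ι : Type} [Fintype ι] [DecidableEq ι] {v : Basis ι F L}
    (hv : ∀ i, IsIntegral S (v i)) (hd : (Algebra.discr F v)⁻¹ ∈ S) : IsIntBasis S v := fun _ =>
  ⟨fun hx => repr_mem_of_trace_mem (fun i j => trace_mem_subring ((hv i).mul (hv j))) hd
    fun j => trace_mem_subring (hx.mul (hv j)), IsIntBasis.isIntegral_of_repr hv⟩

/-- The ring of `R`-integral elements of `L` is self-dual for the trace form of `L/K`, i.e. it is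
étale over `R` if `R` is a principal ideal domain with fraction field `K`. -/
def IsTraceSelfDual (S : Subring F) (L : Type) [Field L] [Algebra F L] : Prop :=
  ∀ x : L, (∀ y, IsIntegral S y → Algebra.trace F L (x * y) ∈ S) → IsIntegral S x

theorem IsTraceSelfDual.of_basis [CharZero F] [FiniteDimensional F L] [IsIntegrallyClosed S]
    [IsFractionRing S F] {ι : Type} [Fintype ι] [DecidableEq ι] {v : Basis ι F L}
    (hv : ∀ i, IsIntegral S (v i)) (hd : (Algebra.discr F v)⁻¹ ∈ S) : IsTraceSelfDual S L :=
  fun _ hx => IsIntBasis.isIntegral_of_repr hv <| repr_mem_of_trace_mem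
    (fun i j => trace_mem_subring ((hv i).mul (hv j))) hd fun j => hx _ (hv j)

theorem IsTraceSelfDual.trans {K : Type} [Field K] [Algebra K F] [Algebra K L] [IsScalarTower K F L]
    [FiniteDimensional K F] [FiniteDimensional F L] {R : Subring K}
    (hF : IsTraceSelfDual R F) (hL : IsTraceSelfDual (intSubring R F) L) : IsTraceSelfDual R L := by
  intro x hx
  rw [← isIntegral_intSubring_iff (F := F)]
  refine hL x fun y hy => hF _ fun z hz => ?_
  rw [isIntegral_intSubring_iff] at hy
  have h1 := hx (y * algebraMap F L z) (hy.mul (hz.map (IsScalarTower.toAlgHom R F L)))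
  rw [← Algebra.trace_trace (S := F), ← mul_assoc, mul_comm, ← Algebra.smul_def, map_smul,
    smul_eq_mul, mul_comm] at h1
  exact h1

theorem isIntegral_aeval {x : L} (hx : IsIntegral S x) (q : S[X]) : IsIntegral S (aeval x q) :=
  IsIntegral.of_mem_of_fg _ hx.fg_adjoin_singleton _ (aeval_mem_adjoin_singleton _ _)

/-- The discriminant of the powers of an integral generator is invertible if the derivative of
some monic equation of the generator is. -/
theorem inv_discr_powerBasis_mem [CharZero F] [FiniteDimensional F L] [IsIntegrallyClosed S]
    [IsFractionRing S F] (pb : PowerBasis F L) {f : S[X]} (hf : f.Monic) (h0 : aeval pb.gen f = 0)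
    (hne : aeval pb.gen (derivative f) ≠ 0) (hd : IsIntegral S (aeval pb.gen (derivative f))⁻¹) :
    (Algebra.discr F pb.basis)⁻¹ ∈ S := by
  have hint : IsIntegral S pb.gen := ⟨f, hf, h0⟩
  obtain ⟨q, hq⟩ := minpoly.isIntegrallyClosed_dvd hint h0
  have h1 : aeval pb.gen (derivative f) =
      aeval pb.gen (derivative (minpoly S pb.gen)) * aeval pb.gen q := by
    rw [hq, derivative_mul, map_add, map_mul, map_mul, minpoly.aeval, zero_mul, add_zero]
  have h2 : aeval pb.gen (derivative (minpoly F pb.gen)) =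
      aeval pb.gen (derivative (minpoly S pb.gen)) := by
    rw [minpoly.isIntegrallyClosed_eq_field_fractions' F hint, derivative_map, aeval_map_algebraMap]
  have hq0 : aeval pb.gen q ≠ 0 := fun h => hne (by rw [h1, h, mul_zero])
  have h3 : IsIntegral S (aeval pb.gen (derivative (minpoly F pb.gen)))⁻¹ := by
    have h4 : (aeval pb.gen (derivative (minpoly F pb.gen)))⁻¹ =
        aeval pb.gen q * (aeval pb.gen (derivative f))⁻¹ := by
      rw [h1, h2, mul_inv_rev, mul_inv_cancel_left₀ hq0]
    rw [h4]
    exact (isIntegral_aeval hint q).mul hd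
  have h5 : (Algebra.norm F (aeval pb.gen (derivative (minpoly F pb.gen))))⁻¹ =
      Algebra.norm F (aeval pb.gen (derivative (minpoly F pb.gen)))⁻¹ := by
    refine inv_eq_of_mul_eq_one_right ?_
    rw [← map_mul, mul_inv_cancel₀ (by rw [h2]; exact left_ne_zero_of_mul (h1 ▸ hne)), map_one]
  rw [Algebra.discr_powerBasis_eq_norm, mul_inv, h5]
  refine S.mul_mem ?_ (mem_of_isIntegral_subring (Algebra.isIntegral_norm F h3))
  rw [← inv_pow, inv_neg_one]
  exact S.pow_mem (S.neg_mem S.one_mem) _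

end UnitDiscriminant

section UnramifiedClosure

open Module Polynomial IntermediateField

variable {K : Type} [Field K] [CharZero K] {R : Subring K} [IsDedekindDomain R] [IsFractionRing R K]

theorem IsTraceSelfDual.of_powerBasis {F L : Type} [Field F] [Field L] [Algebra K F] [Algebra F L]
    [Algebra K L] [IsScalarTower K F L] [FiniteDimensional K F] [FiniteDimensional F L]
    (hF : IsTraceSelfDual R F) (pb : PowerBasis F L) {f : R[X]} (hf : f.Monic)
    (h0 : aeval pb.gen f = 0) (hne : aeval pb.gen (derivative f) ≠ 0)
    (hd : IsIntegral R (aeval pb.gen (derivative f))⁻¹) : IsTraceSelfDual R L := by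
  have : CharZero F := charZero_of_injective_algebraMap (algebraMap K F).injective
  let : Algebra R (intSubring R F) := inferInstanceAs (Algebra R (integralClosure R F))
  have : IsScalarTower R (intSubring R F) L :=
    IsScalarTower.of_algebraMap_eq fun r => IsScalarTower.algebraMap_apply K F L r
  have := isFractionRing_intSubring (R := R) (F := F)
  have := isDedekindDomain_intSubring (R := R) (F := F)
  have hint : IsIntegral (intSubring R F) pb.gen :=
    isIntegral_intSubring_iff.2 ⟨f, hf, h0⟩
  refine hF.trans (.of_basis (v := pb.basis) (fun i => ?_)
    (inv_discr_powerBasis_mem pb (hf.map (algebraMap R (intSubring R F))) ?_ ?_ ?_))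
  · rw [pb.basis_eq_pow]
    exact hint.pow _
  · rwa [aeval_map_algebraMap]
  · rwa [derivative_map, aeval_map_algebraMap]
  · rwa [derivative_map, aeval_map_algebraMap, isIntegral_intSubring_iff]

omit [CharZero K] [IsDedekindDomain R] [IsFractionRing R K] in
theorem IsTraceSelfDual.of_finrank_eq_one {L : Type} [Field L] [Algebra K L]
    (h : finrank K L = 1) : IsTraceSelfDual R L := fun x hx => by
  have h1 := hx 1 isIntegral_one
  obtain ⟨y, rfl⟩ := (Algebra.finrank_eq_one_iff_bijective_algebraMap.1 h).2 x
  rw [mul_one, Algebra.trace_algebraMap, h, one_smul] at h1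
  exact isIntegral_algebraMap_of_mem h1

theorem IsTraceSelfDual.adjoin_finset {E : Type} [Field E] [Algebra K E] [Algebra.IsAlgebraic K E]
    (S : Finset E) {f : R[X]} (hf : f.Monic) (hS : ∀ x ∈ S, aeval x f = 0)
    (hne : ∀ x ∈ S, aeval x (derivative f) ≠ 0)
    (hd : ∀ x ∈ S, IsIntegral R (aeval x (derivative f))⁻¹) :
    IsTraceSelfDual R (adjoin K (S : Set E)) := by
  suffices h : FiniteDimensional K (adjoin K (S : Set E)) ∧
      IsTraceSelfDual R (adjoin K (S : Set E)) from h.2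
  refine induction_on_adjoin_finset S
    (fun M => FiniteDimensional K M ∧ IsTraceSelfDual R M) ⟨inferInstance, ?_⟩ ?_
  · exact .of_finrank_eq_one IntermediateField.finrank_bot
  · rintro M x hx ⟨hfin, hM⟩
    have hx' : IsIntegral M x := (Algebra.IsIntegral.isIntegral (R := K) x).tower_top
    have := adjoin.finiteDimensional hx'
    refine ⟨FiniteDimensional.trans K M M⟮x⟯, ?_⟩
    have hval (q : R[X]) : ((aeval (AdjoinSimple.gen M x) q : M⟮x⟯) : E) = aeval x q :=
      (aeval_algHom_apply (M⟮x⟯.val.restrictScalars R) _ _).symm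
    have h := IsTraceSelfDual.of_powerBasis (R := R) hM (adjoin.powerBasis hx') hf ?_ ?_ ?_
    · exact h
    all_goals rw [adjoin.powerBasis_gen]
    · exact Subtype.ext ((hval f).trans (hS x hx))
    · exact fun h => hne x hx (by rw [← hval, h]; rfl)
    · refine (isIntegral_algHom_iff (M⟮x⟯.val.restrictScalars R)
        Subtype.val_injective).1 ?_
      change IsIntegral R (((aeval (AdjoinSimple.gen M x) (derivative f))⁻¹ : M⟮x⟯) : E)
      rw [IntermediateField.coe_inv, hval]
      exact hd x hx

end UnramifiedClosure

section Reducedness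

open Module IsDedekindDomain WithZero

variable {k L : Type} [Field k] [Field L] [Algebra (RatFunc k) L]

/-- The fibre over infinity of the smooth model of `L` is reduced: if `x²` is divisible by the
local parameter `X⁻¹`, so is `x`. -/
def IsReducedAtInfinity (k L : Type) [Field k] [Field L] [Algebra (RatFunc k) L] : Prop :=
  ∀ x : L, IsIntegral (infSubring k) (RatFunc.X (K := k) • x ^ 2) →
    IsIntegral (infSubring k) (RatFunc.X (K := k) • x)

theorem IsReducedAtInfinity.of_algHom {E : Type} [Field E] [Algebra (RatFunc k) E]
    (j : L →ₐ[RatFunc k] E) (hE : IsReducedAtInfinity k E) : IsReducedAtInfinity k L := by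
  intro x hx
  have hj {y : L} := isIntegral_algHom_iff (j.restrictScalars (infSubring k)) j.injective (x := y)
  refine hj.1 ?_
  have h := hj.2 hx
  simp only [AlgHom.coe_restrictScalars', map_smul, map_pow] at h ⊢
  exact hE _ h

variable [CharZero k] [FiniteDimensional (RatFunc k) L]

theorem X_mul_trace_mem {z : L} (hz : IsIntegral (infSubring k) (RatFunc.X (K := k) • z ^ 2)) :
    RatFunc.X * Algebra.trace (RatFunc k) L z ∈ infSubring k := by
  set t := Algebra.trace (RatFunc k) L z with ht
  by_cases ht0 : t = 0
  · rw [ht0, mul_zero]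
    exact zero_mem _
  let E := AlgebraicClosure (RatFunc k)
  have h1 (σ τ : L →ₐ[RatFunc k] E) :
      IsIntegral (infSubring k) (RatFunc.X (K := k) • (σ z * τ z)) := by
    refine IsIntegral.of_pow two_pos ?_
    have h2 : (RatFunc.X (K := k) • (σ z * τ z)) ^ 2 =
        σ (RatFunc.X (K := k) • z ^ 2) * τ (RatFunc.X (K := k) • z ^ 2) := by
      rw [map_smul, map_smul, map_pow, map_pow, smul_mul_smul_comm, smul_pow, mul_pow, sq, sq]
    rw [h2]
    exact (hz.map (σ.restrictScalars (infSubring k))).mul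
      (hz.map (τ.restrictScalars (infSubring k)))
  have h3 : IsIntegral (infSubring k) (algebraMap (RatFunc k) E (RatFunc.X * t ^ 2)) := by
    rw [map_mul, map_pow, ht, trace_eq_sum_embeddings E, sq, Finset.sum_mul_sum, Finset.mul_sum]
    simp only [Finset.mul_sum]
    refine IsIntegral.sum _ fun σ _ => IsIntegral.sum _ fun τ _ => ?_
    rw [← Algebra.smul_def]
    exact h1 σ τ
  have h4 := mem_of_isIntegral_subring ((isIntegral_algebraMap_iff
    (algebraMap (RatFunc k) E).injective).1 h3)
  rw [mem_infSubring, RatFunc.intDegree_mul RatFunc.X_ne_zero (pow_ne_zero _ ht0),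
    intDegree_pow ht0,
    RatFunc.intDegree_X] at h4
  rw [mem_infSubring, RatFunc.intDegree_mul RatFunc.X_ne_zero ht0, RatFunc.intDegree_X]
  push_cast at h4
  lia

theorem IsTraceSelfDual.isReducedAtInfinity (h : IsTraceSelfDual (infSubring k) L) :
    IsReducedAtInfinity k L := by
  intro x hx
  refine h _ fun y hy => ?_
  rw [smul_mul_assoc, map_smul, smul_eq_mul]
  refine X_mul_trace_mem ?_
  rw [mul_pow, ← smul_mul_assoc]
  exact hx.mul (hy.pow 2)

theorem not_isReducedAtInfinity [Algebra k L] [IsScalarTower k (RatFunc k) L] (A : FFPlace k L)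
    (hX : algebraMap (RatFunc k) L RatFunc.X ∉ A.1)
    (hA : ordAt A.1 (algebraMap (RatFunc k) L RatFunc.X) ≤ -2) : ¬ IsReducedAtInfinity k L := by
  intro h
  obtain ⟨v, hv⟩ := exists_eq_valRing_integralClosure (A.algebraMap_mem_of_inf hX) A.2.2
  have : IsPrincipalIdealRing (integralClosure (infSubring k) L) :=
    isPrincipalIdealRing_intSubring (R := infSubring k) (F := L)
  obtain ⟨π, hπ⟩ := (IsPrincipalIdealRing.principal v.asIdeal).principal
  have hπ0 : (π : L) ≠ 0 := fun h0 => v.ne_bot (by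
    rw [hπ, Subtype.ext (a2 := (0 : integralClosure (infSubring k) L)) h0]
    exact Ideal.span_singleton_eq_bot.2 rfl)
  let s : integralClosure (infSubring k) L :=
    ⟨algebraMap (RatFunc k) L RatFunc.X⁻¹, isIntegral_algebraMap_of_mem inv_X_mem_infSubring⟩
  have hs : s ∈ v.asIdeal ^ 2 := by
    rw [← HeightOneSpectrum.intValuation_le_pow_iff_mem, ← v.valuation_of_algebraMap (K := L)]
    change v.valuation L (algebraMap (RatFunc k) L RatFunc.X⁻¹) ≤ _
    rw [map_inv₀, map_inv₀, valuation_eq_exp_ordAt_valRing v algebraMap_X_ne_zero, ← hv, ← exp_neg,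
      exp_le_exp]
    push_cast
    lia
  rw [hπ, Ideal.submodule_span_eq, Ideal.span_singleton_pow, Ideal.mem_span_singleton] at hs
  obtain ⟨t, ht⟩ := hs
  have ht' : algebraMap (RatFunc k) L RatFunc.X⁻¹ = (π : L) ^ 2 * t := congrArg Subtype.val ht
  have hXX : algebraMap (RatFunc k) L RatFunc.X * algebraMap (RatFunc k) L RatFunc.X⁻¹ = 1 := by
    rw [← map_mul, mul_inv_cancel₀ RatFunc.X_ne_zero, map_one]
  have h1 := h (algebraMap (RatFunc k) L RatFunc.X⁻¹ * (π : L)⁻¹) (by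
    have : RatFunc.X (K := k) • (algebraMap (RatFunc k) L RatFunc.X⁻¹ * (π : L)⁻¹) ^ 2 = t := by
      rw [mul_pow, Algebra.smul_def, sq, ← mul_assoc, ← mul_assoc, hXX, one_mul, ht']
      field_simp
    rw [this]
    exact t.2)
  rw [Algebra.smul_def, ← mul_assoc, hXX, one_mul] at h1
  refine v.isPrime.ne_top ?_
  rw [hπ]
  refine Ideal.span_singleton_eq_top.2 (IsUnit.of_mul_eq_one ⟨_, h1⟩ (Subtype.ext ?_))
  exact mul_inv_cancel₀ hπ0

/-- The discriminant of a ramified extension is divisible by the local parameter at infinity. -/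
theorem intDegree_discr_le_neg_one (h : ¬ IsReducedAtInfinity k L) {ι : Type} [Fintype ι]
    [DecidableEq ι] {b : Basis ι (RatFunc k) L} (hb : IsIntBasis (infSubring k) b) :
    (Algebra.discr (RatFunc k) b).intDegree ≤ -1 := by
  have h1 := mem_infSubring.1 (discr_mem_subring (R := infSubring k) hb.isIntegral)
  by_contra h2
  refine h (IsTraceSelfDual.isReducedAtInfinity (.of_basis hb.isIntegral ?_))
  rw [mem_infSubring, RatFunc.intDegree_inv]
  lia

end Reducedness

section UnramifiedExtensions

open Module Polynomial IntermediateField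

variable {k : Type} [Field k] [CharZero k] [IsAlgClosed k]
variable {L : Type} [Field L] [Algebra (RatFunc k) L] [Algebra k L] [IsScalarTower k (RatFunc k) L]
  [FiniteDimensional (RatFunc k) L]

theorem exists_place_over_infinity (k L : Type) [Field k] [CharZero k] [IsAlgClosed k] [Field L]
    [Algebra (RatFunc k) L] [Algebra k L] [IsScalarTower k (RatFunc k) L]
    [FiniteDimensional (RatFunc k) L] :
    ∃ P : FFPlace k L, algebraMap (RatFunc k) L RatFunc.X ∉ P.1 := by
  by_contra! h
  have h1 : IsIntegral (infSubring k) (algebraMap (RatFunc k) L RatFunc.X) :=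
    isIntegral_infSubring_iff.2 fun P hP => absurd (h P) hP
  have h2 := mem_of_isIntegral_subring ((isIntegral_algebraMap_iff
    (algebraMap (RatFunc k) L).injective).1 h1)
  rw [mem_infSubring, RatFunc.intDegree_X] at h2
  lia

theorem aeval_derivative_ne_zero {f : (infSubring k)[X]} (hf : f.Monic)
    (hsep : (f.map (IsLocalRing.residue (infSubring k))).Separable) {x : L} (hx : aeval x f = 0) :
    aeval x (derivative f) ≠ 0 := by
  obtain ⟨P, hP⟩ := exists_place_over_infinity k L
  have h := valuation_aeval_derivative_eq_one P hP hf hsep hx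
  rintro h0
  rw [h0, map_zero] at h
  exact zero_ne_one h

theorem aeval_derivative_ne_zero_and_isIntegral_inv {E : Type} [Field E] [Algebra (RatFunc k) E]
    [Algebra k E] [IsScalarTower k (RatFunc k) E] {f : (infSubring k)[X]} (hf : f.Monic)
    (hsep : (f.map (IsLocalRing.residue (infSubring k))).Separable) {x : E} (hx : aeval x f = 0) :
    aeval x (derivative f) ≠ 0 ∧ IsIntegral (infSubring k) (aeval x (derivative f))⁻¹ := by
  have hint : IsIntegral (RatFunc k) x := IsIntegral.tower_top (R := infSubring k) ⟨f, hf, hx⟩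
  have : FiniteDimensional (RatFunc k) (RatFunc k)⟮x⟯ := adjoin.finiteDimensional hint
  let φ : (RatFunc k)⟮x⟯ →ₐ[infSubring k] E := (RatFunc k)⟮x⟯.val.restrictScalars (infSubring k)
  have hφ : Function.Injective φ := φ.toRingHom.injective
  have hval (p : (infSubring k)[X]) : φ (aeval (AdjoinSimple.gen (RatFunc k) x) p) = aeval x p := by
    rw [← aeval_algHom_apply]
    rfl
  have hx' : aeval (AdjoinSimple.gen (RatFunc k) x) f = 0 := hφ (by rw [hval, hx, map_zero])
  constructor
  · rw [← hval, Ne, map_eq_zero_iff φ hφ]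
    exact aeval_derivative_ne_zero hf hsep hx'
  · rw [← hval, ← map_inv₀]
    exact (isIntegral_inv_aeval_derivative hf hsep hx').map φ

theorem exists_isIntBasis_inv_discr_mem (hunr : ∀ P : FFPlace k L,
      algebraMap (RatFunc k) L RatFunc.X ∉ P.1 →
      ordAt P.1 (algebraMap (RatFunc k) L RatFunc.X) = -1) :
    ∃ b : Basis (Fin (finrank (RatFunc k) L)) (RatFunc k) L, IsIntBasis (infSubring k) b ∧
      (Algebra.discr (RatFunc k) b)⁻¹ ∈ infSubring k := by
  obtain ⟨θ, hθ, hdeg, hsep⟩ := exists_separable_generator hunr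
  have hmonic := minpoly.monic hθ
  have h0 := minpoly.aeval (infSubring k) θ
  have htop : Algebra.adjoin (RatFunc k) {θ} = ⊤ := by
    have h1 : (minpoly (RatFunc k) θ).natDegree = finrank (RatFunc k) L := by
      rw [minpoly.isIntegrallyClosed_eq_field_fractions' (RatFunc k) hθ, hmonic.natDegree_map, hdeg]
    rw [← Field.primitive_element_iff_minpoly_natDegree_eq] at h1
    rw [← adjoin_simple_toSubalgebra_of_isAlgebraic (Algebra.IsAlgebraic.isAlgebraic θ), h1,
      top_toSubalgebra]
  let pb := PowerBasis.ofAdjoinEqTop (hθ.tower_top (A := RatFunc k)) htop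
  have hgen : pb.gen = θ := PowerBasis.ofAdjoinEqTop_gen _ _
  have hd := inv_discr_powerBasis_mem pb hmonic (by rw [hgen, h0])
    (by rw [hgen]; exact aeval_derivative_ne_zero hmonic hsep h0)
    (by rw [hgen]; exact isIntegral_inv_aeval_derivative hmonic hsep h0)
  let e : Fin pb.dim ≃ Fin (finrank (RatFunc k) L) := finCongr pb.finrank.symm
  have hd' : (Algebra.discr (RatFunc k) (pb.basis.reindex e))⁻¹ ∈ infSubring k := by
    rwa [Basis.coe_reindex, Algebra.discr_reindex]
  refine ⟨pb.basis.reindex e, .of_inv_discr_mem (fun i => ?_) hd', hd'⟩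
  rw [Basis.reindex_apply, pb.basis_eq_pow, hgen]
  exact hθ.pow _

/-- A primitive extension that is ramified over infinity and an extension that is unramified over
infinity are linearly disjoint. -/
theorem isField_tensorProduct {F : Type} [Field F] [Algebra (RatFunc k) F]
    [FiniteDimensional (RatFunc k) F]
    (hF : ∀ M : IntermediateField (RatFunc k) F, M = ⊥ ∨ M = ⊤)
    (hram : ¬ IsReducedAtInfinity k F)
    (hunr : ∀ P : FFPlace k L, algebraMap (RatFunc k) L RatFunc.X ∉ P.1 →
      ordAt P.1 (algebraMap (RatFunc k) L RatFunc.X) = -1) :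
    IsField (F ⊗[RatFunc k] L) := by
  obtain ⟨θ, hθ, hdeg, hsep⟩ := exists_separable_generator hunr
  set f := minpoly (infSubring k) θ with hf
  have hmonic : f.Monic := minpoly.monic hθ
  have hfmap : f.map (algebraMap (infSubring k) (RatFunc k)) = minpoly (RatFunc k) θ :=
    (minpoly.isIntegrallyClosed_eq_field_fractions' (RatFunc k) hθ).symm
  let E := AlgebraicClosure (RatFunc k)
  let i : F →ₐ[RatFunc k] E := IsAlgClosed.lift
  let j : L →ₐ[RatFunc k] E := IsAlgClosed.lift
  let g := minpoly (RatFunc k) θ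
  have : CharZero (RatFunc k) := inferInstance
  let N : IntermediateField (RatFunc k) E := adjoin (RatFunc k) (g.rootSet E)
  have hsplit : g.IsSplittingField (RatFunc k) N :=
    adjoin_rootSet_isSplittingField (IsAlgClosed.splits _)
  have hnormal : Normal (RatFunc k) N := Normal.of_isSplittingField g
  have hfin : FiniteDimensional (RatFunc k) N := Polynomial.IsSplittingField.finiteDimensional N g
  have hgal : IsGalois (RatFunc k) N := ⟨⟩
  have hjN : j.fieldRange ≤ N := by
    have h1 : (RatFunc k)⟮θ⟯ = ⊤ := by
      rw [Field.primitive_element_iff_minpoly_natDegree_eq, ← hfmap, hmonic.natDegree_map, hdeg]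
    rw [AlgHom.fieldRange_eq_map, ← h1, adjoin_map, Set.image_singleton, adjoin_simple_le_iff]
    refine subset_adjoin _ _ ((mem_rootSet_of_ne (minpoly.ne_zero (hθ.tower_top))).2 ?_)
    rw [aeval_algHom_apply, minpoly.aeval, map_zero]
  have hN : IsReducedAtInfinity k N := by
    have h1 (x : E) (hx : x ∈ (g.rootSet E).toFinset) : aeval x f = 0 := by
      rw [Set.mem_toFinset, mem_rootSet] at hx
      rw [← aeval_map_algebraMap (RatFunc k), hfmap]
      exact hx.2
    have h2 := IsTraceSelfDual.adjoin_finset (R := infSubring k) (g.rootSet E).toFinset hmonic h1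
      (fun x hx => (aeval_derivative_ne_zero_and_isIntegral_inv hmonic hsep (h1 x hx)).1)
      (fun x hx => (aeval_derivative_ne_zero_and_isIntegral_inv hmonic hsep (h1 x hx)).2)
    rw [Set.coe_toFinset] at h2
    exact h2.isReducedAtInfinity
  have hbot : N ⊓ i.fieldRange = ⊥ := by
    rcases hF (N.comap i) with h | h
    · rw [eq_bot_iff]
      rintro _ ⟨hx, y, rfl⟩
      have hy : y ∈ N.comap i := hx
      rw [h, mem_bot] at hy
      obtain ⟨z, rfl⟩ := hy
      exact mem_bot.2 ⟨z, (i.commutes z).symm⟩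
    · refine absurd (hN.of_algHom (i.codRestrict N.toSubalgebra fun x => ?_)) hram
      have hx : x ∈ N.comap i := h ▸ mem_top
      exact hx
  have : FiniteDimensional (RatFunc k) i.fieldRange :=
    (AlgEquiv.ofInjectiveField i).toLinearEquiv.finiteDimensional
  have hdisj := (IntermediateField.LinearDisjoint.of_inf_eq_bot hbot).of_le_left hjN
  exact hdisj.symm.isField_of_isAlgebraic' (.inl inferInstance)

end UnramifiedExtensions

section Compositum

open Module

section BaseChange

variable {K E F T : Type} [Field K] [Field E] [Field F] [Field T] [Algebra K E] [Algebra K F]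
  [Algebra K T] [Algebra E T] [Algebra F T] [IsScalarTower K E T] [IsScalarTower K F T]
  {ι : Type} [Fintype ι] [DecidableEq ι] {b : Basis ι K F} {v : Basis ι E T}

omit [DecidableEq ι] in
theorem repr_algebraMap_of_basis_eq (hv : ∀ i, v i = algebraMap F T (b i)) (y : F) (i : ι) :
    v.repr (algebraMap F T y) i = algebraMap K E (b.repr y i) := by
  have h : algebraMap F T y = ∑ i, algebraMap K E (b.repr y i) • v i := by
    conv_lhs => rw [← b.sum_repr y]
    rw [map_sum]
    refine Finset.sum_congr rfl fun i _ => ?_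
    rw [algebraMap_smul, hv, Algebra.smul_def, Algebra.smul_def, map_mul,
      ← IsScalarTower.algebraMap_apply]
  rw [h, v.repr_sum_self]

theorem trace_algebraMap_of_basis_eq (hv : ∀ i, v i = algebraMap F T (b i)) (y : F) :
    Algebra.trace E T (algebraMap F T y) = algebraMap K E (Algebra.trace K F y) := by
  rw [Algebra.trace_eq_matrix_trace v, Algebra.trace_eq_matrix_trace b, Matrix.trace, Matrix.trace,
    map_sum]
  refine Finset.sum_congr rfl fun i _ => ?_
  rw [Matrix.diag_apply, Matrix.diag_apply, Algebra.leftMulMatrix_eq_repr_mul,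
    Algebra.leftMulMatrix_eq_repr_mul, hv, ← map_mul, repr_algebraMap_of_basis_eq hv]

theorem discr_of_basis_eq (hv : ∀ i, v i = algebraMap F T (b i)) :
    Algebra.discr E v = algebraMap K E (Algebra.discr K b) := by
  rw [Algebra.discr_def, Algebra.discr_def, RingHom.map_det]
  congr 1
  ext i j
  rw [RingHom.mapMatrix_apply, Matrix.map_apply, Algebra.traceMatrix_apply,
    Algebra.traceMatrix_apply, Algebra.traceForm_apply, Algebra.traceForm_apply, hv, hv, ← map_mul,
    trace_algebraMap_of_basis_eq hv]

end BaseChange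

variable {k KC KD T : Type} [Field k] [CharZero k] [IsAlgClosed k] [Field KC] [Field KD] [Field T]
  [Algebra (RatFunc k) KC] [Algebra (RatFunc k) KD] [Algebra (RatFunc k) T]
  [Algebra KC T] [Algebra KD T] [IsScalarTower (RatFunc k) KC T] [IsScalarTower (RatFunc k) KD T]
  [Algebra k KD] [IsScalarTower k (RatFunc k) KD] [Algebra k T] [IsScalarTower k (RatFunc k) T]
  [FiniteDimensional (RatFunc k) KC] [FiniteDimensional (RatFunc k) KD]

/-- The genus estimate for a field that is a base change of `KD` to `KC`. -/
theorem two_mul_ffGenus_sub_two_ge (hram : ¬ IsReducedAtInfinity k KC)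
    (hunr : ∀ P : FFPlace k KD, algebraMap (RatFunc k) KD RatFunc.X ∉ P.1 →
      ordAt P.1 (algebraMap (RatFunc k) KD RatFunc.X) = -1)
    (hT : ∀ b : Basis (Fin (finrank (RatFunc k) KD)) (RatFunc k) KD,
      ∃ v : Basis (Fin (finrank (RatFunc k) KD)) KC T, ∀ i, v i = algebraMap KD T (b i)) :
    2 * (ffGenus k T : ℤ) - 2 ≥
      finrank (RatFunc k) KC * (2 * (ffGenus k KD : ℤ) - 2) + finrank (RatFunc k) KD := by
  obtain ⟨b, hb, hbd⟩ := exists_isIntBasis_inv_discr_mem hunr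
  obtain ⟨v, hv⟩ := hT b
  have : FiniteDimensional KC T := v.finiteDimensional_of_finite
  have : FiniteDimensional (RatFunc k) T := .trans _ KC _
  have : FiniteDimensional KD T := .right (RatFunc k) KD T
  have : CharZero KC := charZero_of_injective_algebraMap (algebraMap (RatFunc k) KC).injective
  have : IsDedekindDomain (intSubring (infSubring k) KC) := isDedekindDomain_intSubring
  have : IsFractionRing (intSubring (infSubring k) KC) KC := isFractionRing_intSubring
  have hd : finrank KC T = finrank (RatFunc k) KD := by
    rw [finrank_eq_card_basis v, Fintype.card_fin]
  have hrank : finrank (RatFunc k) T = finrank (RatFunc k) KC * finrank (RatFunc k) KD := by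
    rw [← finrank_mul_finrank (RatFunc k) KC T, hd]
  have hn : finrank KD T = finrank (RatFunc k) KC := by
    refine Nat.eq_of_mul_eq_mul_left (finrank_pos (R := RatFunc k) (M := KD)) ?_
    rw [finrank_mul_finrank, hrank, mul_comm]
  have hvint (i) : IsIntegral (infSubring k) (v i) := by
    rw [hv]
    exact (hb.isIntegral i).algebraMap
  have hvb : IsIntBasis (intSubring (infSubring k) KC) v := by
    refine .of_inv_discr_mem (fun i => isIntegral_intSubring_iff.2 (hvint i)) ?_
    rw [discr_of_basis_eq hv, ← map_inv₀, mem_intSubring]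
    exact isIntegral_algebraMap_of_mem hbd
  obtain ⟨c, hc⟩ := IsIntBasis.exists (R := infSubring k) (L := KC)
  obtain ⟨r, hr, hcv⟩ := hc.discr_smulTower (c := v) hvint
  obtain ⟨p, hp⟩ := IsIntBasis.exists (R := finSubring k) (L := KD)
  obtain ⟨q, hq⟩ := IsIntBasis.exists (R := finSubring k) (L := T)
  obtain ⟨s, hs, hpq⟩ := discr_pow_dvd hp (c := q) hq.isIntegral
  have hD := two_mul_ffGenus_sub_two hp hb
  have hTg := two_mul_ffGenus_sub_two hq (hc.smulTower hvb)
  have hb0 := intDegree_eq_zero_of_mem_infSubring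
    (discr_mem_subring (R := infSubring k) hb.isIntegral) hbd
  have hc1 := intDegree_discr_le_neg_one hram hc
  have hinf : (Algebra.discr (RatFunc k) (c.smulTower v)).intDegree ≤
      -finrank (RatFunc k) KD := by
    have h0 := Algebra.discr_not_zero_of_basis (RatFunc k) (c.smulTower v)
    rw [hcv] at h0 ⊢
    have h1 := mem_infSubring.1 hr
    rw [RatFunc.intDegree_mul (left_ne_zero_of_mul h0) (right_ne_zero_of_mul h0),
      intDegree_pow (Algebra.discr_not_zero_of_basis _ _), Fintype.card_fin]
    nlinarith
  have hfin : finrank (RatFunc k) KC * (Algebra.discr (RatFunc k) p).intDegree ≤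
      (Algebra.discr (RatFunc k) q).intDegree := by
    have h0 := Algebra.discr_not_zero_of_basis (RatFunc k) q
    rw [hpq] at h0 ⊢
    have h1 := intDegree_nonneg_of_mem_finSubring hs
    rw [RatFunc.intDegree_mul (left_ne_zero_of_mul h0) (right_ne_zero_of_mul h0),
      intDegree_pow (Algebra.discr_not_zero_of_basis _ _), hn]
    lia
  have hrank' : (finrank (RatFunc k) T : ℤ) = finrank (RatFunc k) KC * finrank (RatFunc k) KD := by
    exact_mod_cast hrank
  rw [hD, hTg, hb0]
  linarith

theorem two_mul_genusRing_sub_two_ge {S : Type} [inst : CommRing S] [Algebra (RatFunc k) S]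
    [Algebra KC S] [Algebra KD S] [IsScalarTower (RatFunc k) KC S] [IsScalarTower (RatFunc k) KD S]
    [Algebra k S] [IsScalarTower k (RatFunc k) S] (h : IsField S)
    (hram : ¬ IsReducedAtInfinity k KC)
    (hunr : ∀ P : FFPlace k KD, algebraMap (RatFunc k) KD RatFunc.X ∉ P.1 →
      ordAt P.1 (algebraMap (RatFunc k) KD RatFunc.X) = -1)
    (hT : ∀ b : Basis (Fin (finrank (RatFunc k) KD)) (RatFunc k) KD,
      ∃ v : Basis (Fin (finrank (RatFunc k) KD)) KC S, ∀ i, v i = algebraMap KD S (b i)) :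
    2 * (genusRing k S : ℤ) - 2 ≥
      finrank (RatFunc k) KC * (2 * (ffGenus k KD : ℤ) - 2) + finrank (RatFunc k) KD := by
  obtain ⟨F, rfl, hF⟩ : ∃ F : Field S, ∃ e : F.toCommRing = inst,
      genusRing k S = @ffGenus k S _ F (by subst e; assumption) :=
    ⟨h.toField, rfl, by rw [genusRing, dif_pos h]⟩
  rw [hF]
  exact two_mul_ffGenus_sub_two_ge hram hunr hT

end Compositum

theorem genus_estimate_fiber_product_branched
    (k : Type) [Field k] [IsAlgClosed k] [CharZero k]
    (KC KD : Type) [Field KC] [Field KD]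
    [Algebra (RatFunc k) KC] [Algebra (RatFunc k) KD]
    [Algebra k KC] [IsScalarTower k (RatFunc k) KC]
    [Algebra k KD] [IsScalarTower k (RatFunc k) KD]
    [FiniteDimensional (RatFunc k) KC] [FiniteDimensional (RatFunc k) KD]
    (n d : ℕ) (hn : 2 ≤ n)
    (hdegC : Module.finrank (RatFunc k) KC = n)
    (hdegD : Module.finrank (RatFunc k) KD = d)
    -- (1) no non-trivial intermediate extension of `k(ℙ¹) ⊆ k(C)`
    (h1 : ∀ M : IntermediateField (RatFunc k) KC, M = ⊥ ∨ M = ⊤)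
    -- (2) `∞` is a branch point of `f`: some place of `K_C` over `∞` is ramified
    (h2 : ∃ A : FFPlace k KC, algebraMap (RatFunc k) KC RatFunc.X ∉ A.1 ∧
      ordAt A.1 (algebraMap (RatFunc k) KC RatFunc.X) ≤ -2)
    -- (3) `D̃ → D → ℙ¹` is étale over `∞`: every place of `K_D` over `∞` is unramified
    (h3 : ∀ A : FFPlace k KD, algebraMap (RatFunc k) KD RatFunc.X ∉ A.1 →
      ordAt A.1 (algebraMap (RatFunc k) KD RatFunc.X) = -1) :
    IsField (KC ⊗[RatFunc k] KD) ∧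
      2 * (genusRing k (KC ⊗[RatFunc k] KD) : ℤ) - 2 ≥
        (n : ℤ) * (2 * (ffGenus k KD : ℤ) - 2) + (d : ℤ) := by
  subst hdegC hdegD
  obtain ⟨A, hX, hA⟩ := h2
  have hram : ¬ IsReducedAtInfinity k KC := not_isReducedAtInfinity A hX hA
  have h := isField_tensorProduct h1 hram h3
  let : Algebra KD (KC ⊗[RatFunc k] KD) := Algebra.TensorProduct.rightAlgebra
  refine ⟨h, two_mul_genusRing_sub_two_ge (KC := KC) (KD := KD) h hram h3 fun b => ?_⟩
  exact ⟨Algebra.TensorProduct.basis KC b, fun i => Algebra.TensorProduct.basis_apply b i⟩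

end
end

section
/- Let k be an algebraically closed field of characteristic zero and let P(x) ∈ k[x] be a polynomial of degree n ≥ 2, regarded as a self-morphism of ℙ¹_k. Let X ⊂ ℙ¹ × ℙ¹ be an irreducible component of (P × P)^{-1}(Δ), where Δ is the diagonal, and let X̃ → X be the normalization. Then for each i = 1, 2, the composite morphism X̃ → X ⊂ ℙ¹ × ℙ¹ → ℙ¹ given by the i-th projection is étale over ∞. -/
/-!
STATEMENT 11: Let `k` be an algebraically closed field of characteristic zero and
`P ∈ k[x]` of degree `n ≥ 2`, viewed as a self-morphism of `ℙ¹_k`.  Let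
`X ⊂ ℙ¹ × ℙ¹` be an irreducible component of `(P × P)^{-1}(Δ)` and `X̃ → X` its
normalization.  Then for `i = 1, 2` the composite `X̃ → X ⊂ ℙ¹ × ℙ¹ → ℙ¹` (the `i`-th
projection) is étale over `∞`.

Formalization notes.  Since `P` is a polynomial map, `(P × P)^{-1}(Δ)` meets the lines at
infinity only in `(∞, ∞)`, so its irreducible components correspond exactly to the
irreducible factors `F` of `P(x) − P(y) ∈ k[x, y]`; the component `X` is the curve `F = 0`
with affine coordinate ring `Q = k[x, y]/(F)`.  Points of the normalization `X̃` over `∞`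
under the `i`-th projection correspond to the places of the function field `k(X)` at which
the coordinate `x_i` has a pole, and such a place arises from a `k`-algebra embedding
`ψ : Q → k((u))` with `order ψ(x_i) < 0` (completion at the place); the ramification index
there is `(−order ψ(x_i))` divided by the positive generator of the value group
`order(ψ(Q ∖ {0}))`.  Hence étaleness over `∞` (all such points unramified) is equivalent
to: for every `k`-algebra homomorphism `ψ : Q → k((u))` with `order ψ(x_i) < 0`, the
integer `order ψ(x_i)` divides `order ψ(a)` for every `a` with `ψ a ≠ 0`.
-/

open MvPolynomial

noncomputable section

/-- `f = c u ^ e + (terms of higher order)`, where `c` may vanish. -/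
def HasLead {k : Type*} [Field k] (f : LaurentSeries k) (e : ℤ) (c : k) : Prop :=
  ∃ g : PowerSeries k, PowerSeries.constantCoeff g = c ∧
    f = HahnSeries.single e 1 * HahnSeries.ofPowerSeries ℤ k g

namespace HasLead

variable {k : Type*} [Field k] {f g : LaurentSeries k} {e e' : ℤ} {c c' : k}

lemma mul (hf : HasLead f e c) (hg : HasLead g e' c') : HasLead (f * g) (e + e') (c * c') := by
  obtain ⟨p, rfl, rfl⟩ := hf
  obtain ⟨q, rfl, rfl⟩ := hg
  refine ⟨p * q, by simp, ?_⟩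
  rw [map_mul, ← mul_one (1 : k), ← HahnSeries.single_mul_single]
  simp only [mul_one]
  ring

lemma add (hf : HasLead f e c) (hg : HasLead g e c') : HasLead (f + g) e (c + c') := by
  obtain ⟨p, rfl, rfl⟩ := hf
  obtain ⟨q, rfl, rfl⟩ := hg
  exact ⟨p + q, by simp, by rw [map_add]; ring⟩

lemma zero (e : ℤ) : HasLead (0 : LaurentSeries k) e 0 := ⟨0, by simp, by simp⟩

lemma const (a : k) : HasLead (algebraMap k (LaurentSeries k) a) 0 a := by
  refine ⟨PowerSeries.C a, by simp, ?_⟩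
  rw [HahnSeries.algebraMap_apply']
  simp

lemma const_mul (a : k) (hf : HasLead f e c) :
    HasLead (algebraMap k (LaurentSeries k) a * f) e (a * c) := by
  simpa using (const a).mul hf

lemma neg (hf : HasLead f e c) : HasLead (-f) e (-c) := by
  simpa using hf.const_mul (-1)

lemma sub (hf : HasLead f e c) (hg : HasLead g e c') : HasLead (f - g) e (c - c') := by
  simpa [sub_eq_add_neg] using hf.add hg.neg

lemma pow (hf : HasLead f e c) (j : ℕ) : HasLead (f ^ j) (j * e) (c ^ j) := by
  induction j with
  | zero => simpa using const (1 : k)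
  | succ j ih =>
    rw [pow_succ, pow_succ]
    convert ih.mul hf using 1
    push_cast; ring

lemma sum {ι : Type*} {s : Finset ι} {F : ι → LaurentSeries k} {C : ι → k}
    (h : ∀ i ∈ s, HasLead (F i) e (C i)) : HasLead (∑ i ∈ s, F i) e (∑ i ∈ s, C i) := by
  classical
  induction s using Finset.induction_on with
  | empty => simpa using zero e
  | insert a s ha ih =>
    rw [Finset.sum_insert ha, Finset.sum_insert ha]
    exact (h a (by simp)).add (ih fun i hi => h i (by simp [hi]))

lemma shift (n : ℕ) (hf : HasLead f e c) : HasLead f (e - n) (c * 0 ^ n) := by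
  obtain ⟨p, rfl, rfl⟩ := hf
  refine ⟨p * PowerSeries.X ^ n, by simp, ?_⟩
  rw [map_mul, HahnSeries.ofPowerSeries_X_pow, mul_left_comm, HahnSeries.single_mul_single]
  simp [mul_comm]

lemma of_lt (hf : HasLead f e c) (h : e' < e) : HasLead f e' 0 := by
  obtain ⟨n, hn⟩ := Int.eq_ofNat_of_zero_le (sub_nonneg.2 h.le)
  have := hf.shift n
  rwa [zero_pow (by omega), mul_zero, ← hn, sub_sub_cancel] at this

lemma succ_of_zero (hf : HasLead f e 0) : ∃ c, HasLead f (e + 1) c := by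
  obtain ⟨p, hp, rfl⟩ := hf
  obtain ⟨q, rfl⟩ := PowerSeries.X_dvd_iff.2 hp
  refine ⟨_, q, rfl, ?_⟩
  rw [map_mul, HahnSeries.ofPowerSeries_X, ← mul_assoc, HahnSeries.single_mul_single, mul_one]

lemma order_eq (hf : HasLead f e c) (hc : c ≠ 0) : f ≠ 0 ∧ f.order = e := by
  obtain ⟨p, rfl, rfl⟩ := hf
  have h0 : (HahnSeries.ofPowerSeries ℤ k p).coeff 0 ≠ 0 := by
    simpa using (HahnSeries.ofPowerSeries_apply_coeff (Γ := ℤ) p 0).trans_ne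
      (by simpa using hc)
  have hp : HahnSeries.ofPowerSeries ℤ k p ≠ 0 := by
    intro h; simp [h] at h0
  have h1 : (HahnSeries.single e (1 : k)) ≠ 0 := by simp
  refine ⟨mul_ne_zero h1 hp, ?_⟩
  rw [HahnSeries.order_mul h1 hp, HahnSeries.order_single one_ne_zero]
  have hle := HahnSeries.order_le_of_coeff_ne_zero h0
  have hge : 0 ≤ (HahnSeries.ofPowerSeries ℤ k p).order := by
    by_contra! hlt
    apply HahnSeries.coeff_order_eq_zero.not.2 hp
    rw [HahnSeries.ofPowerSeries_apply]
    apply HahnSeries.embDomain_of_notMem_range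
    rintro ⟨n, hn⟩
    have : (n : ℤ) = (HahnSeries.ofPowerSeries ℤ k p).order := hn
    omega
  omega

lemma of_ne_zero (hf : f ≠ 0) : ∃ c ≠ 0, HasLead f f.order c := by
  refine ⟨f.coeff f.order, HahnSeries.coeff_order_eq_zero.not.2 hf, f.powerSeriesPart, ?_, ?_⟩
  · rw [← PowerSeries.coeff_zero_eq_constantCoeff_apply, LaurentSeries.powerSeriesPart_coeff]
    simp
  · exact (LaurentSeries.single_order_mul_powerSeriesPart f).symm

lemma exists_of_le_order (h : e ≤ f.order) : ∃ c, HasLead f e c := by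
  by_cases hf : f = 0
  · exact ⟨0, hf ▸ zero e⟩
  obtain ⟨c, -, hc⟩ := of_ne_zero hf
  obtain h | rfl := h.lt_or_eq
  · exact ⟨0, hc.of_lt h⟩
  · exact ⟨c, hc⟩

lemma le_order (hf : HasLead f e c) (h0 : f ≠ 0) : e ≤ f.order := by
  by_contra! h
  obtain ⟨c', hc', h'⟩ := of_ne_zero h0
  obtain ⟨p, hp, hp'⟩ := hf.of_lt h
  obtain ⟨q, hq, hq'⟩ := h'
  have : p = q := HahnSeries.ofPowerSeries_injective (Γ := ℤ)
    (mul_left_cancel₀ (a := HahnSeries.single f.order (1 : k)) (by simp) (hp'.symm.trans hq'))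
  exact hc' (by rw [← hq, ← this, hp])

lemma zpow (hf : HasLead f e c) (hc : c ≠ 0) (j : ℤ) : ∃ c' ≠ 0, HasLead (f ^ j) (j * e) c' := by
  have h0 := (hf.order_eq hc).1
  obtain ⟨d, hd, h⟩ := of_ne_zero (inv_ne_zero h0)
  have h1 := ((hf.mul h).order_eq (mul_ne_zero hc hd)).2
  rw [mul_inv_cancel₀ h0, HahnSeries.order_one] at h1
  have he : f⁻¹.order = -e := by omega
  rw [he] at h
  obtain ⟨n, rfl | rfl⟩ := j.eq_nat_or_neg
  · exact ⟨c ^ n, pow_ne_zero _ hc, by simpa using hf.pow n⟩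
  · exact ⟨d ^ n, pow_ne_zero _ hd, by simpa using h.pow n⟩

lemma aeval (hf : HasLead f e c) (he : e < 0) (p : Polynomial k) :
    HasLead (Polynomial.aeval f p) (p.natDegree * e) (p.leadingCoeff * c ^ p.natDegree) := by
  rw [Polynomial.aeval_def, Polynomial.eval₂_eq_sum_range]
  have h : ∀ j ∈ Finset.range (p.natDegree + 1), HasLead (algebraMap k (LaurentSeries k) (p.coeff j) * f ^ j) (p.natDegree * e)
      (if j = p.natDegree then p.leadingCoeff * c ^ p.natDegree else 0) := by
    intro j hj
    split_ifs with h
    · subst h; exact (hf.pow _).const_mul _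
    · refine ((hf.pow j).const_mul _).of_lt ?_
      have : (j : ℤ) < p.natDegree := by simp at hj; omega
      nlinarith
  simpa using sum h

/-- For `f`, `g` with the same polar leading term, the difference quotient of `p` is governed by
the leading term of the derivative of `p`. -/
lemma exists_aeval_sub (hf : HasLead f e c) (hg : HasLead g e c) (he : e < 0) (p : Polynomial k) :
    ∃ q, Polynomial.aeval f p - Polynomial.aeval g p = q * (f - g) ∧
      HasLead q ((p.natDegree - 1 : ℤ) * e)
        (p.leadingCoeff * (p.natDegree * c ^ (p.natDegree - 1))) := by
  refine ⟨∑ j ∈ Finset.range (p.natDegree + 1),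
    algebraMap k (LaurentSeries k) (p.coeff j) * ∑ i ∈ Finset.range j, f ^ i * g ^ (j - 1 - i), ?_, ?_⟩
  · rw [Polynomial.aeval_def, Polynomial.eval₂_eq_sum_range, Polynomial.aeval_def, Polynomial.eval₂_eq_sum_range, ← Finset.sum_sub_distrib,
      Finset.sum_mul]
    refine Finset.sum_congr rfl fun j _ => ?_
    rw [mul_assoc, (Commute.all f g).geom_sum₂_mul, mul_sub]
  have h (j : ℕ) : HasLead (∑ i ∈ Finset.range j, f ^ i * g ^ (j - 1 - i)) ((j - 1 : ℤ) * e)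
      (j * c ^ (j - 1)) := by
    have : ∀ i ∈ Finset.range j, HasLead (f ^ i * g ^ (j - 1 - i)) ((j - 1 : ℤ) * e)
        (c ^ (j - 1)) := by
      intro i hi
      rw [Finset.mem_range] at hi
      obtain ⟨l, rfl⟩ : ∃ l, j = i + l + 1 := ⟨j - i - 1, by omega⟩
      have hl : i + l + 1 - 1 - i = l := by omega
      rw [hl, Nat.add_sub_cancel, pow_add]
      convert (hf.pow i).mul (hg.pow l) using 1
      push_cast; ring
    simpa using sum this
  have h' : ∀ j ∈ Finset.range (p.natDegree + 1),
      HasLead (algebraMap k (LaurentSeries k) (p.coeff j) * ∑ i ∈ Finset.range j, f ^ i * g ^ (j - 1 - i))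
      ((p.natDegree - 1 : ℤ) * e) (if j = p.natDegree then
        p.leadingCoeff * (p.natDegree * c ^ (p.natDegree - 1)) else 0) := by
    intro j hj
    split_ifs with hjn
    · subst hjn; exact (h _).const_mul _
    · refine ((h j).const_mul _).of_lt ?_
      have : (j : ℤ) < p.natDegree := by simp at hj; omega
      nlinarith
  simpa using sum h'

end HasLead

lemma aeval_mem_of_mem {R A : Type*} [CommSemiring R] [Semiring A] [Algebra R A]
    {S : Subalgebra R A} {a : A} (ha : a ∈ S) (p : Polynomial R) : Polynomial.aeval a p ∈ S :=
  Algebra.adjoin_le (by simpa using ha) (Polynomial.aeval_mem_adjoin_singleton R a)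

section Approximation

variable {k : Type*} [Field k] {x y : LaurentSeries k}

lemma order_aeval (hx : x.order < 0) {p : Polynomial k} (hp : p ≠ 0) :
    Polynomial.aeval x p ≠ 0 ∧ (Polynomial.aeval x p).order = p.natDegree * x.order := by
  have hx0 : x ≠ 0 := by rintro rfl; simp at hx
  obtain ⟨c, hc, h⟩ := HasLead.of_ne_zero hx0
  exact (h.aeval hx p).order_eq
    (mul_ne_zero (Polynomial.leadingCoeff_ne_zero.2 hp) (pow_ne_zero _ hc))

lemma order_dvd_of_mem_adjoin (hx : x.order < 0) {z : LaurentSeries k}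
    (hz : z ∈ Algebra.adjoin k {x, x⁻¹}) (hz0 : z ≠ 0) : x.order ∣ z.order := by
  have hx0 : x ≠ 0 := by rintro rfl; simp at hx
  obtain ⟨N, q, hq⟩ : ∃ (N : ℕ) (q : Polynomial k), z * x ^ N = Polynomial.aeval x q := by
    clear hz0
    induction hz using Algebra.adjoin_induction with
    | mem a ha =>
      obtain rfl | rfl := ha
      · exact ⟨0, Polynomial.X, by simp⟩
      · exact ⟨1, 1, by simp [hx0]⟩
    | algebraMap r => exact ⟨0, Polynomial.C r, by simp⟩
    | add a b _ _ ha hb =>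
      obtain ⟨N, q, hq⟩ := ha
      obtain ⟨M, r, hr⟩ := hb
      refine ⟨N + M, q * Polynomial.X ^ M + r * Polynomial.X ^ N, ?_⟩
      simp only [map_add, map_mul, map_pow, Polynomial.aeval_X, ← hq, ← hr]
      ring
    | mul a b _ _ ha hb =>
      obtain ⟨N, q, hq⟩ := ha
      obtain ⟨M, r, hr⟩ := hb
      refine ⟨N + M, q * r, ?_⟩
      simp only [map_mul, ← hq, ← hr]
      ring
  have hne : z * x ^ N ≠ 0 := mul_ne_zero hz0 (pow_ne_zero _ hx0)
  have hq0 : q ≠ 0 := by rintro rfl; simp [hq] at hne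
  have h := (order_aeval hx hq0).2
  rw [← hq, HahnSeries.order_mul hz0 (pow_ne_zero _ hx0), HahnSeries.order_pow] at h
  refine ⟨q.natDegree - N, ?_⟩
  simp only [nsmul_eq_mul] at h
  linear_combination h

/-- `a` is a `u`-adic limit of Laurent polynomials in `x`. -/
def IsApprox (x a : LaurentSeries k) : Prop :=
  ∀ N : ℤ, ∃ z ∈ Algebra.adjoin k {x, x⁻¹}, ∃ c, HasLead (a - z) N c

lemma IsApprox.of_mem {a : LaurentSeries k} (ha : a ∈ Algebra.adjoin k {x, x⁻¹}) :
    IsApprox x a :=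
  fun N => ⟨a, ha, 0, by simpa using HasLead.zero N⟩

lemma IsApprox.add {a b : LaurentSeries k} (ha : IsApprox x a) (hb : IsApprox x b) :
    IsApprox x (a + b) := by
  intro N
  obtain ⟨z, hz, c, h⟩ := ha N
  obtain ⟨w, hw, d, h'⟩ := hb N
  exact ⟨z + w, add_mem hz hw, c + d, by simpa [add_sub_add_comm] using h.add h'⟩

lemma IsApprox.mul {a b : LaurentSeries k} (ha : IsApprox x a) (hb : IsApprox x b) :
    IsApprox x (a * b) := by
  intro N
  obtain ⟨s, hs⟩ := HasLead.exists_of_le_order (le_refl b.order)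
  obtain ⟨z, hz, c, h⟩ := ha (N - b.order)
  obtain ⟨t, ht⟩ := HasLead.exists_of_le_order (le_refl z.order)
  obtain ⟨w, hw, d, h'⟩ := hb (N - z.order)
  refine ⟨z * w, mul_mem hz hw, c * s + t * d, ?_⟩
  have h1 := h.mul hs
  have h2 := ht.mul h'
  rw [sub_add_cancel] at h1
  rw [add_sub_cancel] at h2
  convert h1.add h2 using 1
  ring

lemma IsApprox.order_dvd (hx : x.order < 0) {a : LaurentSeries k} (ha : IsApprox x a)
    (ha0 : a ≠ 0) : x.order ∣ a.order := by
  obtain ⟨z, hz, d, h⟩ := ha (a.order + 1)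
  obtain ⟨c, hc, hac⟩ := HasLead.of_ne_zero ha0
  have := hac.sub (h.of_lt (lt_add_one _))
  rw [sub_sub_cancel, sub_zero] at this
  obtain ⟨hz0, hord⟩ := this.order_eq hc
  exact hord ▸ order_dvd_of_mem_adjoin hx hz hz0

lemma order_eq_of_aeval_eq {P : Polynomial k} (hP : P.natDegree ≠ 0)
    (hx : x.order < 0) (h : Polynomial.aeval x P = Polynomial.aeval y P) : y.order = x.order := by
  have hP0 : P ≠ 0 := by rintro rfl; simp at hP
  obtain ⟨hne, hord⟩ := order_aeval hx hP0
  have hpos : (0 : ℤ) < P.natDegree := by omega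
  have hy : y.order < 0 := by
    by_contra! hy
    obtain ⟨c, hc⟩ := HasLead.exists_of_le_order hy
    rw [h] at hne hord
    have : HasLead (Polynomial.aeval y P) 0
        (∑ j ∈ Finset.range (P.natDegree + 1), P.coeff j * c ^ j) := by
      rw [Polynomial.aeval_def, Polynomial.eval₂_eq_sum_range]
      exact HasLead.sum fun j _ => by simpa using (hc.pow j).const_mul (P.coeff j)
    have := this.le_order hne
    nlinarith
  have h' := (order_aeval hy hP0).2
  rw [← h, hord] at h'
  exact (mul_left_cancel₀ hpos.ne' h').symm

lemma isApprox_of_aeval_eq [CharZero k] {P : Polynomial k} (hP : P.natDegree ≠ 0)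
    (hx : x.order < 0) (h : Polynomial.aeval x P = Polynomial.aeval y P) : IsApprox x y := by
  have hP0 : P ≠ 0 := by rintro rfl; simp at hP
  have hxy := order_eq_of_aeval_eq hP hx h
  have hx0 : x ≠ 0 := by rintro rfl; simp at hx
  have hy0 : y ≠ 0 := by rintro rfl; simp at hxy; omega
  obtain ⟨l, hl, hxl⟩ := HasLead.of_ne_zero hx0
  obtain ⟨m, hm, hym⟩ := HasLead.of_ne_zero hy0
  rw [hxy] at hym
  have hxA : x ∈ Algebra.adjoin k {x, x⁻¹} := Algebra.subset_adjoin (by simp)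
  have hiA : x⁻¹ ∈ Algebra.adjoin k {x, x⁻¹} := Algebra.subset_adjoin (by simp)
  have key (N : ℕ) : ∃ z ∈ Algebra.adjoin k {x, x⁻¹}, ∃ c, HasLead (y - z) (x.order + 1 + N) c := by
    induction N with
    | zero =>
      refine ⟨algebraMap k _ (m / l) * x, mul_mem (Subalgebra.algebraMap_mem _ _) hxA, ?_⟩
      have := hym.sub (hxl.const_mul (m / l))
      rw [div_mul_cancel₀ _ hl, sub_self] at this
      simpa using this.succ_of_zero
    | succ N ih =>
      obtain ⟨z, hz, c, hc⟩ := ih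
      push_cast
      rw [← add_assoc]
      by_cases hc0 : c = 0
      · subst hc0; exact ⟨z, hz, hc.succ_of_zero⟩
      obtain ⟨-, hord⟩ := hc.order_eq hc0
      have hzm : HasLead z x.order m := by
        have := hym.sub (hc.of_lt (by omega : x.order < _))
        rwa [sub_sub_cancel, sub_zero] at this
      obtain ⟨q, hq, hqlead⟩ := hym.exists_aeval_sub hzm hx P
      rw [← h] at hq
      have hqc : P.leadingCoeff * (P.natDegree * m ^ (P.natDegree - 1)) ≠ 0 :=
        mul_ne_zero (Polynomial.leadingCoeff_ne_zero.2 hP0)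
          (mul_ne_zero (Nat.cast_ne_zero.2 hP) (pow_ne_zero _ hm))
      obtain ⟨hne, hdord⟩ := (hqlead.mul hc).order_eq (mul_ne_zero hqc hc0)
      rw [← hq] at hne hdord
      have hmem : Polynomial.aeval x P - Polynomial.aeval z P ∈ Algebra.adjoin k {x, x⁻¹} :=
        sub_mem (aeval_mem_of_mem hxA P) (aeval_mem_of_mem hz P)
      have hdvd := order_dvd_of_mem_adjoin hx hmem hne
      rw [hdord, dvd_add_right (dvd_mul_left _ _)] at hdvd
      obtain ⟨j, hj⟩ := hdvd
      obtain ⟨d, hd, hxj⟩ := hxl.zpow hl j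
      rw [mul_comm, ← hj] at hxj
      have hjA : x ^ j ∈ Algebra.adjoin k {x, x⁻¹} := by
        obtain ⟨n, rfl | rfl⟩ := j.eq_nat_or_neg
        · simpa using pow_mem hxA n
        · simpa using pow_mem hiA n
      refine ⟨z + algebraMap k _ (c / d) * x ^ j, add_mem hz (mul_mem (Subalgebra.algebraMap_mem _ _) hjA), ?_⟩
      have := hc.sub (hxj.const_mul (c / d))
      rw [div_mul_cancel₀ _ hd, sub_self, sub_sub] at this
      exact this.succ_of_zero
  intro N
  obtain ⟨z, hz, c, hc⟩ := key (N - x.order).toNat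
  exact ⟨z, hz, 0, hc.of_lt (by omega)⟩

end Approximation

theorem projection_etale_at_infinity
    (k : Type) [Field k] [IsAlgClosed k] [CharZero k]
    (P : Polynomial k) (n : ℕ) (hn : 2 ≤ n) (hP : P.natDegree = n)
    (F : MvPolynomial (Fin 2) k) (hFirr : Irreducible F)
    (hFdvd : F ∣ (Polynomial.aeval (X 0 : MvPolynomial (Fin 2) k) P -
      Polynomial.aeval (X 1 : MvPolynomial (Fin 2) k) P))
    [hFp : (Ideal.span {F}).IsPrime]
    (i : Fin 2)
    (ψ : (MvPolynomial (Fin 2) k ⧸ Ideal.span {F}) →ₐ[k] LaurentSeries k)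
    (hpole : (ψ (Ideal.Quotient.mk (Ideal.span {F}) (X i))).order < 0) :
    ∀ a : MvPolynomial (Fin 2) k ⧸ Ideal.span {F}, ψ a ≠ 0 →
      (ψ (Ideal.Quotient.mk (Ideal.span {F}) (X i))).order ∣ (ψ a).order := by
  set x : Fin 2 → LaurentSeries k := fun j => ψ (Ideal.Quotient.mk (Ideal.span {F}) (X j))
  have hmk (G : MvPolynomial (Fin 2) k) :
      ψ (Ideal.Quotient.mk (Ideal.span {F}) G) = MvPolynomial.aeval x G := by
    have : ψ.comp (Ideal.Quotient.mkₐ k (Ideal.span {F})) = MvPolynomial.aeval x := by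
      ext j; simp [x]
    exact DFunLike.congr_fun this G
  have hPx : Polynomial.aeval (x 0) P = Polynomial.aeval (x 1) P := by
    have h := hmk (Polynomial.aeval (X 0 : MvPolynomial (Fin 2) k) P -
      Polynomial.aeval (X 1 : MvPolynomial (Fin 2) k) P)
    rw [Ideal.Quotient.eq_zero_iff_mem.2 (Ideal.mem_span_singleton.2 hFdvd), map_zero, map_sub,
      ← Polynomial.aeval_algHom_apply, ← Polynomial.aeval_algHom_apply, aeval_X, aeval_X] at h
    exact sub_eq_zero.1 h.symm
  change (x i).order < 0 at hpole
  change ∀ a, ψ a ≠ 0 → (x i).order ∣ (ψ a).order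
  have hP0 : P.natDegree ≠ 0 := by omega
  have happ (j : Fin 2) : IsApprox (x i) (x j) := by
    refine isApprox_of_aeval_eq hP0 hpole ?_
    fin_cases i <;> fin_cases j <;> simp [hPx]
  intro a ha
  obtain ⟨G, rfl⟩ := Ideal.Quotient.mk_surjective a
  rw [hmk] at ha ⊢
  refine IsApprox.order_dvd hpole ?_ ha
  clear ha
  induction G using MvPolynomial.induction_on with
  | C r => simpa using IsApprox.of_mem (Subalgebra.algebraMap_mem _ r)
  | add p q hp hq => simpa using hp.add hq
  | mul_X p j hp => simpa using hp.mul (happ j)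

end
end

section
/- Let k be a field of characteristic zero, let P ∈ k[x] be a polynomial of degree n ≥ 2, and let d ≥ 2 be an integer. Let g ∈ k((u)) be a Laurent series with valuation v(g) = −d, and suppose that P(g(u)) = P(u^{-d}) in k((u)). Then g is a Laurent series in u^d, i.e., g lies in the image of the embedding k((t)) → k((u)) sending t to u^d. -/
/-!
STATEMENT 12: Let `k` be a field of characteristic zero, `P ∈ k[x]` of degree `n ≥ 2`, and
`d ≥ 2`.  Let `g ∈ k((u))` with `v(g) = −d`, and suppose `P(g(u)) = P(u^{−d})` in `k((u))`.
Then `g` is a Laurent series in `u^d`, i.e. all coefficients of `g` at exponents not divisible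
by `d` vanish (equivalently, `g` lies in the image of `k((t)) → k((u))`, `t ↦ u^d`).
-/

open HahnSeries

/-- The Laurent series all of whose exponents are divisible by `d`. -/
def laurentSeriesInPow (k : Type*) [Field k] (d : ℤ) : Subalgebra k (LaurentSeries k) where
  carrier := {f | ∀ m, f.coeff m ≠ 0 → d ∣ m}
  mul_mem' := by
    intro a b ha hb m hm
    rw [HahnSeries.coeff_mul] at hm
    obtain ⟨⟨i, j⟩, hij, -⟩ := Finset.exists_ne_zero_of_sum_ne_zero hm
    rw [Finset.mem_antidiagonal] at hij
    obtain ⟨hi, hj, rfl⟩ := hij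
    exact dvd_add (ha i hi) (hb j hj)
  add_mem' := by
    intro a b ha hb m hm
    by_contra h
    have h1 : a.coeff m = 0 := by_contra fun h' => h (ha m h')
    have h2 : b.coeff m = 0 := by_contra fun h' => h (hb m h')
    exact hm (by simp [h1, h2])
  algebraMap_mem' := by
    intro r m hm
    rcases eq_or_ne m 0 with rfl | h
    · exact dvd_zero d
    · exact absurd (by simp [LaurentSeries.algebraMap_apply, HahnSeries.C_apply, h]) hm

/-- `f` has the form `a u ^ N` plus terms of higher order; `a` may vanish. -/
def HasLeadingTerm {k : Type*} [Field k] (f : LaurentSeries k) (N : ℤ) (a : k) : Prop :=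
  ∃ φ : PowerSeries k, f = single N 1 * ofPowerSeries ℤ k φ ∧ PowerSeries.constantCoeff φ = a

namespace HasLeadingTerm

variable {k : Type*} [Field k] {f g : LaurentSeries k} {N M : ℤ} {a b c : k}

lemma zero : HasLeadingTerm (0 : LaurentSeries k) N 0 := ⟨0, by simp, by simp⟩

lemma one : HasLeadingTerm (1 : LaurentSeries k) 0 1 := ⟨1, by simp, by simp⟩

lemma add (hf : HasLeadingTerm f N a) (hg : HasLeadingTerm g N b) :
    HasLeadingTerm (f + g) N (a + b) := by
  obtain ⟨φ, rfl, rfl⟩ := hf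
  obtain ⟨ψ, rfl, rfl⟩ := hg
  exact ⟨φ + ψ, by rw [map_add, mul_add], by simp⟩

lemma C_mul (hf : HasLeadingTerm f N a) (r : k) : HasLeadingTerm (C r * f) N (r * a) := by
  obtain ⟨φ, rfl, rfl⟩ := hf
  refine ⟨PowerSeries.C r * φ, ?_, by simp⟩
  rw [map_mul, HahnSeries.ofPowerSeries_C]
  ring

lemma mul (hf : HasLeadingTerm f N a) (hg : HasLeadingTerm g M b) :
    HasLeadingTerm (f * g) (N + M) (a * b) := by
  obtain ⟨φ, rfl, rfl⟩ := hf
  obtain ⟨ψ, rfl, rfl⟩ := hg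
  refine ⟨φ * ψ, ?_, by simp⟩
  have h : (single (N + M) (1 : k) : LaurentSeries k) = single N 1 * single M 1 := by simp
  rw [map_mul, h]
  ring

lemma pow (hf : HasLeadingTerm f N a) (i : ℕ) : HasLeadingTerm (f ^ i) (i * N) (a ^ i) := by
  induction i with
  | zero => simpa using one
  | succ i ih =>
    rw [pow_succ, pow_succ]
    convert ih.mul hf using 1
    push_cast
    ring

lemma sum {ι : Type*} (s : Finset ι) {F : ι → LaurentSeries k} {A : ι → k}
    (h : ∀ i ∈ s, HasLeadingTerm (F i) N (A i)) :
    HasLeadingTerm (∑ i ∈ s, F i) N (∑ i ∈ s, A i) := by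
  classical
  induction s using Finset.induction_on with
  | empty => simpa using zero
  | insert i s hi ih =>
    rw [Finset.sum_insert hi, Finset.sum_insert hi]
    exact (h i (Finset.mem_insert_self i s)).add
      (ih fun j hj => h j (Finset.mem_insert_of_mem hj))

lemma of_lt (hf : HasLeadingTerm f N a) (h : M < N) : HasLeadingTerm f M 0 := by
  obtain ⟨φ, rfl, rfl⟩ := hf
  obtain ⟨i, hi⟩ := Int.eq_ofNat_of_zero_le (sub_nonneg.2 h.le)
  obtain rfl : N = M + i := by omega
  have hi0 : i ≠ 0 := by rintro rfl; simp at h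
  refine ⟨PowerSeries.X ^ i * φ, ?_, by simp [hi0]⟩
  have h : (single (M + i) (1 : k) : LaurentSeries k) = single M 1 * single (i : ℤ) 1 := by simp
  rw [map_mul, HahnSeries.ofPowerSeries_X_pow, h, mul_assoc]

lemma order (f : LaurentSeries k) : HasLeadingTerm f f.order (f.coeff f.order) :=
  ⟨f.powerSeriesPart, (LaurentSeries.single_order_mul_powerSeriesPart f).symm, by
    rw [← PowerSeries.coeff_zero_eq_constantCoeff_apply, LaurentSeries.powerSeriesPart_coeff]
    simp⟩

lemma coeff_eq (hf : HasLeadingTerm f N a) : f.coeff N = a := by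
  obtain ⟨φ, rfl, rfl⟩ := hf
  have h := HahnSeries.coeff_single_mul_add (r := (1 : k)) (x := ofPowerSeries ℤ k φ) (a := 0)
    (b := N)
  rw [zero_add] at h
  rw [h, one_mul, ← PowerSeries.coeff_zero_eq_constantCoeff_apply]
  exact HahnSeries.ofPowerSeries_apply_coeff φ 0

lemma geom_sum₂ (hf : HasLeadingTerm f N c) (hg : HasLeadingTerm g N c) (i : ℕ) :
    HasLeadingTerm (∑ j ∈ Finset.range i, f ^ j * g ^ (i - 1 - j)) ((i - 1) * N)
      (i * c ^ (i - 1)) := by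
  have h : (i * c ^ (i - 1) : k) = ∑ j ∈ Finset.range i, c ^ (i - 1) := by simp
  rw [h]
  refine sum _ fun j hj => ?_
  have hj := Finset.mem_range.1 hj
  convert (hf.pow j).mul (hg.pow (i - 1 - j)) using 1
  · rw [← add_mul]
    congr 1
    omega
  · rw [← _root_.pow_add]
    congr 1
    omega

/-- The difference quotient of a polynomial at two series with the same leading term `c u ^ N`,
where `N < 0`. -/
lemma exists_aeval_sub_aeval (hf : HasLeadingTerm f N c) (hg : HasLeadingTerm g N c) (hN : N < 0)
    (P : Polynomial k) :
    ∃ S : LaurentSeries k, Polynomial.aeval f P - Polynomial.aeval g P = (f - g) * S ∧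
      HasLeadingTerm S ((P.natDegree - 1) * N)
        (P.leadingCoeff * (P.natDegree * c ^ (P.natDegree - 1))) := by
  refine ⟨∑ i ∈ Finset.range (P.natDegree + 1),
    C (P.coeff i) * ∑ j ∈ Finset.range i, f ^ j * g ^ (i - 1 - j), ?_, ?_⟩
  · rw [Polynomial.aeval_def, Polynomial.aeval_def, Polynomial.eval₂_eq_sum_range,
      Polynomial.eval₂_eq_sum_range, ← Finset.sum_sub_distrib,
      Finset.mul_sum]
    refine Finset.sum_congr rfl fun i _ => ?_
    rw [LaurentSeries.algebraMap_apply, ← mul_sub, ← (Commute.all f g).mul_geom_sum₂]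
    ring
  · rw [Finset.sum_range_succ, ← zero_add (P.leadingCoeff * _)]
    refine add ?_ ((geom_sum₂ hf hg _).C_mul _)
    rw [← Finset.sum_const_zero (s := Finset.range P.natDegree)]
    refine sum _ fun i hi => ?_
    have hi : (i : ℤ) < P.natDegree := by exact_mod_cast Finset.mem_range.1 hi
    exact ((geom_sum₂ hf hg i).C_mul _).of_lt (by nlinarith)

end HasLeadingTerm

theorem laurent_series_in_ud
    (k : Type*) [Field k] [CharZero k]
    (P : Polynomial k) (n : ℕ) (hn : 2 ≤ n) (hP : P.natDegree = n)
    (d : ℕ) (hd : 2 ≤ d)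
    (g : LaurentSeries k)
    (hord : g.order = -(d : ℤ))
    (heq : Polynomial.aeval g P
      = Polynomial.aeval (HahnSeries.single (-(d : ℤ)) (1 : k) : LaurentSeries k) P) :
    ∀ m : ℤ, g.coeff m ≠ 0 → (d : ℤ) ∣ m := by
  classical
  have hg0 : g ≠ 0 := by
    rintro rfl
    rw [HahnSeries.order_zero] at hord
    omega
  let h : LaurentSeries k :=
    { coeff := fun m => if (d : ℤ) ∣ m then g.coeff m else 0
      isPWO_support' := g.isPWO_support.mono fun m hm => by
        by_contra h0
        exact hm (by simp [Function.notMem_support.1 h0]) }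
  have hh : h ∈ laurentSeriesInPow k d := fun m hm => by
    by_contra h0
    exact hm (if_neg h0)
  by_cases he : g - h = 0
  · rw [sub_eq_zero.1 he]
    exact hh
  exfalso
  have hlead : (g - h).coeff (g - h).order ≠ 0 := mt HahnSeries.coeff_order_eq_zero.1 he
  have hcoeff (m : ℤ) (hm : (g - h).coeff m ≠ 0) : ¬ (d : ℤ) ∣ m ∧ g.coeff m ≠ 0 := by
    have h1 : h.coeff m = if (d : ℤ) ∣ m then g.coeff m else 0 := rfl
    rw [HahnSeries.coeff_sub, h1] at hm
    split_ifs at hm with h2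
    · simp at hm
    · exact ⟨h2, by simpa using hm⟩
  obtain ⟨hndvd, hgm⟩ := hcoeff _ hlead
  have hlt : -(d : ℤ) < (g - h).order := by
    refine lt_of_le_of_ne (hord ▸ HahnSeries.order_le_of_coeff_ne_zero hgm) fun h0 => hndvd ?_
    simp [← h0]
  have hgl := HasLeadingTerm.order g
  have hc := mt HahnSeries.coeff_order_eq_zero.1 hg0
  rw [hord] at hgl hc
  have hel := HasLeadingTerm.order (g - h)
  have hhl : HasLeadingTerm h (-(d : ℤ)) (g.coeff (-(d : ℤ))) := by
    simpa using hgl.add ((hel.of_lt hlt).C_mul (-1))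
  obtain ⟨S, hS, hSl⟩ := hgl.exists_aeval_sub_aeval hhl (by omega) P
  have hmem : Polynomial.aeval g P - Polynomial.aeval h P ∈ laurentSeriesInPow k d := by
    rw [heq]
    refine sub_mem (Algebra.adjoin_singleton_le ?_ (Polynomial.aeval_mem_adjoin_singleton k _))
      (Algebra.adjoin_singleton_le hh (Polynomial.aeval_mem_adjoin_singleton k _))
    intro m hm
    by_contra h0
    exact hm (HahnSeries.coeff_single_of_ne (by rintro rfl; simp at h0))
  have hne : (Polynomial.aeval g P - Polynomial.aeval h P).coeff
      ((g - h).order + (P.natDegree - 1) * -(d : ℤ)) ≠ 0 := by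
    rw [hS, (hel.mul hSl).coeff_eq]
    have hP0 : P ≠ 0 := by
      rintro rfl
      simp at hP
      omega
    exact mul_ne_zero hlead (mul_ne_zero (Polynomial.leadingCoeff_ne_zero.2 hP0)
      (mul_ne_zero (Nat.cast_ne_zero.2 (by omega)) (pow_ne_zero _ hc)))
  exact hndvd ((dvd_add_left ((dvd_neg.2 dvd_rfl).mul_left _)).1 (hmem _ hne))
end
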